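/- arXiv:2311.05517 — 2 statements merged into one kernel-verified Lean document; each statement's English description precedes it below -/
import Mathlib

section
/- Let k ≥ 1 and s, t ≥ 2 be integers. There exists a constant C = C(k, s, t) with the following property. Let P be a set of m points in ℝ² and let Γ be a set of n distinct algebraic curves in ℝ², each of degree at most k. If the incidence graph of P and Γ contains no copy of K_{s,t}, then I(P, Γ) ≤ C·( m^{s/(2s−1)} · n^{(2s−2)/(2s−1)} + m + n ). -/
open Polynomial

theorem Polynomial.Bivariate.coeff_coeff_swap {R : Type*} [CommSemiring R] (p : R[X][X])
    (i j : ℕ) : ((Bivariate.swap p).coeff i).coeff j = (p.coeff j).coeff i := by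
  induction p using Polynomial.induction_on' with
  | add p q hp hq => simp only [map_add, coeff_add, hp, hq]
  | monomial n f =>
    induction f using Polynomial.induction_on' with
    | add p q hp hq => simp only [map_add, coeff_add, hp, hq]
    | monomial m r =>
      rw [Bivariate.swap_monomial_monomial]
      simp only [coeff_monomial]
      split_ifs <;> simp [coeff_monomial, *]

theorem Polynomial.Bivariate.natDegree_swap_le_iff {R : Type*} [CommSemiring R] {p : R[X][X]}
    {k : ℕ} : (Bivariate.swap p).natDegree ≤ k ↔ ∀ i, (p.coeff i).natDegree ≤ k := by
  simp only [natDegree_le_iff_coeff_eq_zero]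
  constructor
  · intro h i j hj
    rw [← Bivariate.coeff_coeff_swap, h j hj, coeff_zero]
  · intro h j hj
    ext i
    rw [Bivariate.coeff_coeff_swap, h i j hj, coeff_zero]

theorem Polynomial.natDegree_det_le {R n : Type*} [CommRing R] [Fintype n] [DecidableEq n]
    (M : Matrix n n R[X]) {d : ℕ} (hM : ∀ i j, (M i j).natDegree ≤ d) :
    M.det.natDegree ≤ Fintype.card n * d := by
  rw [Matrix.det_apply]
  refine natDegree_sum_le_of_forall_le _ _ fun σ _ ↦ ?_
  refine (natDegree_smul_le _ _).trans ((natDegree_prod_le _ _).trans ?_)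
  refine (Finset.sum_le_card_nsmul _ _ d fun i _ ↦ hM _ _).trans ?_
  simp

theorem Polynomial.natDegree_resultant_le {R : Type*} [CommRing R] (g h : R[X][X]) {d : ℕ}
    (hg : ∀ i, (g.coeff i).natDegree ≤ d) (hh : ∀ i, (h.coeff i).natDegree ≤ d) :
    (resultant g h).natDegree ≤ (g.natDegree + h.natDegree) * d := by
  have := natDegree_det_le (sylvester g h g.natDegree h.natDegree) (d := d) ?_
  · simpa only [resultant, Fintype.card_fin] using this
  · intro i j
    refine Fin.addCases (fun j₁ ↦ ?_) (fun j₁ ↦ ?_) j <;>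
    · simp only [sylvester, Matrix.of_apply, Fin.addCases_left, Fin.addCases_right]
      split_ifs <;> simp [hg, hh]

theorem Polynomial.resultant_ne_zero_of_irreducible {R : Type*} [CommRing R] [IsDomain R]
    [NormalizedGCDMonoid R] {g h : R[X]} (hg : Irreducible g) (hd : 0 < g.natDegree)
    (hgh : ¬ g ∣ h) : resultant g h ≠ 0 := by
  let φ := algebraMap R (FractionRing R)
  have hφ : Function.Injective φ := IsFractionRing.injective _ _
  have hp : g.IsPrimitive := hg.isPrimitive hd.ne'
  have hirr := (hp.irreducible_iff_irreducible_map_fraction_map (K := FractionRing R)).1 hg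
  have hnd : ¬ g.map φ ∣ h.map φ := fun H ↦
    hgh (hp.dvd_of_fraction_map_dvd_fraction_map (K := FractionRing R) H)
  have hco : IsCoprime (g.map φ) (h.map φ) := (hirr.coprime_iff_not_dvd).2 hnd
  have h0 : resultant (g.map φ) (h.map φ) ≠ 0 := fun H ↦ (resultant_eq_zero_iff.1 H).2 hco
  intro H
  apply h0
  rw [natDegree_map_eq_of_injective hφ, natDegree_map_eq_of_injective hφ, resultant_map_map, H,
    map_zero]

theorem Polynomial.exists_finset_common_zeros {g h : ℝ[X][X]} {k : ℕ} (hg : Irreducible g)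
    (hd : 0 < g.natDegree) (hgh : ¬ g ∣ h) (hgk : g.natDegree ≤ k) (hhk : h.natDegree ≤ k)
    (hgx : ∀ i, (g.coeff i).natDegree ≤ k) (hhx : ∀ i, (h.coeff i).natDegree ≤ k) :
    ∃ E : Finset ℝ, E.card ≤ 2 * k * k ∧
      ∀ x y, evalEval x y g = 0 → evalEval x y h = 0 → x ∈ E := by
  have hr := resultant_ne_zero_of_irreducible hg hd hgh
  refine ⟨(resultant g h).roots.toFinset, ?_, fun x y hx hy ↦ ?_⟩
  · refine (Multiset.toFinset_card_le _).trans ((card_roots' _).trans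
      ((natDegree_resultant_le g h hgx hhx).trans ?_))
    gcongr
    lia
  · obtain ⟨p, q, -, -, e⟩ := exists_mul_add_mul_eq_C_resultant g h le_rfl le_rfl (.inl hd.ne')
    have := congrArg (evalEval x y) e
    rw [evalEval_add, evalEval_mul, evalEval_mul, hx, hy, evalEval_C] at this
    simp only [zero_mul, add_zero] at this
    simp [hr, this.symm]

/-- Outside a bounded set of abscissae, the fibres of an irreducible curve have full degree and
only simple zeros. -/
theorem Polynomial.exists_finset_singular_fibres {g : ℝ[X][X]} {k : ℕ} (hg : Irreducible g)
    (hd : 0 < g.natDegree) (hgk : g.natDegree ≤ k) (hgx : ∀ i, (g.coeff i).natDegree ≤ k) :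
    ∃ E : Finset ℝ, E.card ≤ k + 2 * k * k ∧ ∀ x ∉ E, g.leadingCoeff.eval x ≠ 0 ∧
      ∀ y, evalEval x y g = 0 → evalEval x y (derivative g) ≠ 0 := by
  have hnd : ¬ g ∣ derivative g := by
    intro H
    have h0 : derivative g ≠ 0 := fun H0 ↦ by
      have := derivative_eq_zero.1 H0
      lia
    exact absurd (natDegree_le_of_dvd H h0) (not_le.2 (natDegree_derivative_lt hd.ne'))
  have hdx : ∀ i, ((derivative g).coeff i).natDegree ≤ k := by
    intro i
    rw [coeff_derivative]
    have : ((i : ℝ[X]) + 1) = C ((i : ℝ) + 1) := by simp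
    rw [this]
    exact (natDegree_mul_C_le _ _).trans (hgx _)
  obtain ⟨E, hE, hE'⟩ := exists_finset_common_zeros hg hd hnd hgk
    ((natDegree_derivative_le g).trans (by lia)) hgx hdx
  have hlc : g.leadingCoeff ≠ 0 := leadingCoeff_ne_zero.2 hg.ne_zero
  refine ⟨g.leadingCoeff.roots.toFinset ∪ E, ?_, fun x hx ↦ ?_⟩
  · refine (Finset.card_union_le _ _).trans (add_le_add ?_ hE)
    exact (Multiset.toFinset_card_le _).trans ((card_roots' _).trans (hgx _))
  · simp only [Finset.mem_union, Multiset.mem_toFinset, mem_roots hlc, IsRoot.def, not_or] at hx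
    exact ⟨hx.1, fun y h1 h2 ↦ hx.2 (hE' x y h1 h2)⟩

theorem Polynomial.continuous_evalEval (g : ℝ[X][X]) :
    Continuous fun z : ℝ × ℝ ↦ evalEval z.1 z.2 g := by
  induction g using Polynomial.induction_on' with
  | add p q hp hq =>
    simp only [evalEval_add]
    exact hp.add hq
  | monomial n f =>
    have : (fun z : ℝ × ℝ ↦ evalEval z.1 z.2 (monomial n f)) =
        fun z : ℝ × ℝ ↦ f.eval z.1 * z.2 ^ n := by
      funext z
      rw [← C_mul_X_pow_eq_monomial, evalEval_mul, evalEval_C, evalEval_pow, evalEval_X]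
    rw [this]
    fun_prop

theorem Polynomial.hasDerivAt_evalEval (g : ℝ[X][X]) (x y : ℝ) :
    HasDerivAt (fun y ↦ evalEval x y g) (evalEval x y (derivative g)) y := by
  simp only [← map_evalRingHom_eval, ← derivative_map]
  exact Polynomial.hasDerivAt _ _

theorem Polynomial.continuous_evalEval_right (g : ℝ[X][X]) (x : ℝ) :
    Continuous fun y ↦ evalEval x y g :=
  g.continuous_evalEval.comp (Continuous.prodMk_right x)

/-- A simple zero in a fibre persists, uniquely, in the nearby fibres. -/
theorem Polynomial.eventually_existsUnique_zero (g : ℝ[X][X]) {x₀ y₀ : ℝ}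
    (h0 : evalEval x₀ y₀ g = 0) (h1 : evalEval x₀ y₀ (derivative g) ≠ 0) {ε : ℝ} (hε : 0 < ε) :
    ∃ η, 0 < η ∧ η ≤ ε ∧ ∀ᶠ x in nhds x₀,
      ∃ z, |z - y₀| < η ∧ evalEval x z g = 0 ∧ ∀ w, |w - y₀| < η → evalEval x w g = 0 → w = z := by
  have hnear : ∀ᶠ z in nhds (x₀, y₀), evalEval z.1 z.2 (derivative g) ≠ 0 :=
    (derivative g).continuous_evalEval.continuousAt.eventually_ne h1
  obtain ⟨δ, hδ, hball⟩ := Metric.eventually_nhds_iff.1 hnear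
  set η := min ε (δ / 2) with hη
  have hη0 : 0 < η := lt_min hε (half_pos hδ)
  have hηδ : η < δ := (min_le_right _ _).trans_lt (half_lt_self hδ)
  have hinj : ∀ x, |x - x₀| < δ →
      Set.InjOn (fun y ↦ evalEval x y g) (Set.Icc (y₀ - η) (y₀ + η)) := by
    intro x hx
    have key : ∀ a ∈ Set.Icc (y₀ - η) (y₀ + η), ∀ b ∈ Set.Icc (y₀ - η) (y₀ + η),
        a < b → evalEval x a g ≠ evalEval x b g := by
      intro a ha b hb hab heq
      obtain ⟨c, hc, hc0⟩ := exists_hasDerivAt_eq_zero hab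
        (g.continuous_evalEval_right x).continuousOn heq (fun y _ ↦ g.hasDerivAt_evalEval x y)
      refine hball (y := (x, c)) ?_ hc0
      rw [Prod.dist_eq, Real.dist_eq, Real.dist_eq]
      refine max_lt hx ((abs_le.2 ⟨?_, ?_⟩).trans_lt hηδ)
      · linarith [ha.1, hc.1]
      · linarith [hb.2, hc.2]
    intro a ha b hb hab
    by_contra hne
    rcases lt_or_gt_of_ne hne with h | h
    · exact key a ha b hb h hab
    · exact key b hb a ha h hab.symm
  have hsign : evalEval x₀ (y₀ - η) g * evalEval x₀ (y₀ + η) g < 0 := by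
    have hm : y₀ ∈ Set.Icc (y₀ - η) (y₀ + η) := ⟨by linarith, by linarith⟩
    have hl : y₀ - η ∈ Set.Icc (y₀ - η) (y₀ + η) := ⟨by linarith, by linarith⟩
    have hr : y₀ + η ∈ Set.Icc (y₀ - η) (y₀ + η) := ⟨by linarith, by linarith⟩
    rcases ContinuousOn.strictMonoOn_of_injOn_Icc' (by linarith)
      (g.continuous_evalEval_right x₀).continuousOn (hinj x₀ (by simpa using hδ)) with h | h
    · have h2 := h hl hm (by linarith)
      have h3 := h hm hr (by linarith)
      simp only [h0] at h2 h3
      exact mul_neg_of_neg_of_pos h2 h3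
    · have h2 := h hl hm (by linarith)
      have h3 := h hm hr (by linarith)
      simp only [h0] at h2 h3
      exact mul_neg_of_pos_of_neg h2 h3
  have hsign' : ∀ᶠ x in nhds x₀, evalEval x (y₀ - η) g * evalEval x (y₀ + η) g < 0 := by
    have hc : Continuous fun x ↦ evalEval x (y₀ - η) g * evalEval x (y₀ + η) g :=
      (g.continuous_evalEval.comp (Continuous.prodMk_left _)).mul
        (g.continuous_evalEval.comp (Continuous.prodMk_left _))
    exact hc.continuousAt.eventually_lt continuousAt_const hsign
  refine ⟨η, hη0, min_le_left _ _, ?_⟩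
  filter_upwards [hsign', Metric.ball_mem_nhds x₀ hδ] with x hx hxδ
  have hex : ∃ z ∈ Set.Ioo (y₀ - η) (y₀ + η), evalEval x z g = 0 := by
    have hc := (g.continuous_evalEval_right x).continuousOn (s := Set.Icc (y₀ - η) (y₀ + η))
    rcases mul_neg_iff.1 hx with ⟨h1, h2⟩ | ⟨h1, h2⟩
    · exact intermediate_value_Ioo' (by linarith) hc ⟨h2, h1⟩
    · exact intermediate_value_Ioo (by linarith) hc ⟨h1, h2⟩
  obtain ⟨z, hz, hz0⟩ := hex
  refine ⟨z, abs_lt.2 ⟨by linarith [hz.1], by linarith [hz.2]⟩, hz0, fun w hw hw0 ↦ ?_⟩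
  have hw' := abs_lt.1 hw
  exact hinj x (by simpa [Real.dist_eq] using hxδ) ⟨by linarith, by linarith⟩
    ⟨hz.1.le, hz.2.le⟩ (hw0.trans hz0.symm)

theorem Polynomial.eventually_zeros_bounded (g : ℝ[X][X]) {x₀ : ℝ}
    (hlc : g.leadingCoeff.eval x₀ ≠ 0) :
    ∃ M : ℝ, ∀ᶠ x in nhds x₀, ∀ y, evalEval x y g = 0 → |y| ≤ M := by
  have h0 : evalEval x₀ 0 g.reverse ≠ 0 := by
    rw [evalEval, C_0, ← coeff_zero_eq_eval_zero, coeff_zero_reverse]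
    exact hlc
  have hnear : ∀ᶠ z in nhds (x₀, (0 : ℝ)), evalEval z.1 z.2 g.reverse ≠ 0 :=
    g.reverse.continuous_evalEval.continuousAt.eventually_ne h0
  obtain ⟨δ, hδ, hball⟩ := Metric.eventually_nhds_iff.1 hnear
  refine ⟨δ⁻¹, ?_⟩
  filter_upwards [Metric.ball_mem_nhds x₀ hδ] with x hx y hy
  by_contra hM
  have hM := not_le.1 hM
  have hy0 : y ≠ 0 := by
    rintro rfl
    rw [abs_zero] at hM
    exact absurd hM (not_lt.2 (inv_nonneg.2 hδ.le))
  have := invertibleOfNonzero hy0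
  refine hball (y := (x, ⅟y)) ?_ ?_
  · rw [Prod.dist_eq, Real.dist_eq, Real.dist_eq, sub_zero, invOf_eq_inv, abs_inv]
    exact max_lt (by simpa [Real.dist_eq] using hx) ((inv_lt_comm₀ hδ (abs_pos.2 hy0)).1 hM)
  · have := (eval₂_reverse_eq_zero_iff (evalRingHom x) y g).2 (by rwa [eval₂_evalRingHom])
    rwa [eval₂_evalRingHom] at this

/-- The real zeros of the fibre of `g` over `x` (junk when the fibre vanishes identically). -/
noncomputable def Polynomial.fibreZeros (g : ℝ[X][X]) (x : ℝ) : Finset ℝ :=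
  (g.map (evalRingHom x)).roots.toFinset

theorem Polynomial.mem_fibreZeros {g : ℝ[X][X]} {x y : ℝ} (h : g.map (evalRingHom x) ≠ 0) :
    y ∈ g.fibreZeros x ↔ evalEval x y g = 0 := by
  rw [fibreZeros, Multiset.mem_toFinset, mem_roots h, IsRoot.def, map_evalRingHom_eval]

theorem Polynomial.map_evalRingHom_ne_zero {g : ℝ[X][X]} {x : ℝ}
    (h : g.leadingCoeff.eval x ≠ 0) : g.map (evalRingHom x) ≠ 0 := by
  intro H
  apply h
  have := congrArg (fun p ↦ p.coeff g.natDegree) H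
  simpa using this

/-- The `j`-th smallest real zero of the fibre of `g` over `x`, when there is one. -/
noncomputable def Polynomial.nthZero (g : ℝ[X][X]) (j : ℕ) (x : ℝ) : ℝ :=
  if h : j < (g.fibreZeros x).card then (g.fibreZeros x).orderEmbOfFin rfl ⟨j, h⟩ else 0

theorem Polynomial.nthZero_mem {g : ℝ[X][X]} {j : ℕ} {x : ℝ} (h : j < (g.fibreZeros x).card) :
    g.nthZero j x ∈ g.fibreZeros x := by
  rw [nthZero, dif_pos h]
  exact Finset.orderEmbOfFin_mem _ _ _

theorem Polynomial.exists_nthZero_eq {g : ℝ[X][X]} {x y : ℝ} (h : y ∈ g.fibreZeros x) :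
    ∃ j < (g.fibreZeros x).card, g.nthZero j x = y := by
  have : y ∈ Set.range ((g.fibreZeros x).orderEmbOfFin rfl) := by
    rwa [Finset.range_orderEmbOfFin]
  obtain ⟨j, rfl⟩ := this
  exact ⟨j, j.2, by rw [nthZero, dif_pos j.2]⟩

theorem Polynomial.nthZero_lt {g : ℝ[X][X]} {i j : ℕ} {x : ℝ} (hij : i < j)
    (h : j < (g.fibreZeros x).card) : g.nthZero i x < g.nthZero j x := by
  rw [nthZero, nthZero, dif_pos h, dif_pos (hij.trans h)]
  exact (OrderEmbedding.strictMono _) hij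

theorem Polynomial.nthZero_eq_of_strictMono {g : ℝ[X][X]} {x : ℝ} {q : ℕ} {z : Fin q → ℝ}
    (hz : StrictMono z) (hz' : ∀ y, y ∈ g.fibreZeros x ↔ ∃ i, z i = y) :
    (g.fibreZeros x).card = q ∧ ∀ i : Fin q, g.nthZero i x = z i := by
  have himg : g.fibreZeros x = Finset.univ.image z := by
    ext y
    simp [hz']
  have hcard : (g.fibreZeros x).card = q := by
    rw [himg, Finset.card_image_of_injective _ hz.injective, Finset.card_fin]
  refine ⟨hcard, fun i ↦ ?_⟩
  have hi : (i : ℕ) < (g.fibreZeros x).card := hcard.symm ▸ i.2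
  subst hcard
  rw [nthZero, dif_pos hi, ← Finset.orderEmbOfFin_unique rfl (fun i ↦ (hz' _).2 ⟨i, rfl⟩) hz]

/-- Near a regular abscissa the number of zeros in a fibre is constant, and each zero varies
continuously. -/
theorem Polynomial.eventually_card_fibreZeros {g : ℝ[X][X]} {x₀ : ℝ}
    (hlc : g.leadingCoeff.eval x₀ ≠ 0)
    (hs : ∀ y, evalEval x₀ y g = 0 → evalEval x₀ y (derivative g) ≠ 0) {ε : ℝ} (hε : 0 < ε) :
    ∀ᶠ x in nhds x₀, (g.fibreZeros x).card = (g.fibreZeros x₀).card ∧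
      ∀ j < (g.fibreZeros x₀).card, |g.nthZero j x - g.nthZero j x₀| < ε := by
  set q := (g.fibreZeros x₀).card with hq
  set y : Fin q → ℝ := ⇑((g.fibreZeros x₀).orderEmbOfFin rfl) with hy
  have hymono : StrictMono y := OrderEmbedding.strictMono _
  have hyz : ∀ i, evalEval x₀ (y i) g = 0 := fun i ↦
    (mem_fibreZeros (map_evalRingHom_ne_zero hlc)).1 (Finset.orderEmbOfFin_mem _ _ _)
  have hyall : ∀ w, evalEval x₀ w g = 0 → ∃ i, y i = w := fun w hw ↦ by
    have : w ∈ Set.range y := by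
      rw [hy, Finset.range_orderEmbOfFin]
      exact (mem_fibreZeros (map_evalRingHom_ne_zero hlc)).2 hw
    exact this
  obtain ⟨ε', hε', hε'ε, hgap⟩ : ∃ ε', 0 < ε' ∧ ε' ≤ ε ∧ ∀ i j, i < j → y i + ε' < y j - ε' := by
    have h : ∀ᶠ e in nhdsWithin (0 : ℝ) (Set.Ioi 0), ∀ i j, i < j → y i + e < y j - e := by
      simp only [Filter.eventually_all]
      intro i j hij
      refine nhdsWithin_le_nhds (ContinuousAt.eventually_lt (f := fun e : ℝ ↦ y i + e)
        (g := fun e ↦ y j - e) (by fun_prop) (by fun_prop) ?_)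
      simpa using hymono hij
    obtain ⟨e, he1, he2⟩ := (h.and (Ioc_mem_nhdsGT hε)).exists
    exact ⟨e, he2.1, he2.2, he1⟩
  choose η hη0 hηε hη using fun i ↦
    g.eventually_existsUnique_zero (hyz i) (hs _ (hyz i)) hε'
  obtain ⟨M, hM⟩ := g.eventually_zeros_bounded hlc
  have hK : IsCompact (Set.Icc (-M) M \ ⋃ i, Metric.ball (y i) (η i)) :=
    isCompact_Icc.diff (isOpen_iUnion fun i ↦ Metric.isOpen_ball)
  have hout : ∀ᶠ x in nhds x₀, ∀ w ∈ Set.Icc (-M) M \ ⋃ i, Metric.ball (y i) (η i),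
      evalEval x w g ≠ 0 := by
    refine hK.eventually_forall_of_forall_eventually fun w hw ↦ ?_
    refine g.continuous_evalEval.continuousAt.eventually_ne fun h0 ↦ hw.2 ?_
    obtain ⟨i, rfl⟩ := hyall w h0
    exact Set.mem_iUnion.2 ⟨i, Metric.mem_ball_self (hη0 i)⟩
  have hlc' : ∀ᶠ x in nhds x₀, g.leadingCoeff.eval x ≠ 0 :=
    g.leadingCoeff.continuous.continuousAt.eventually_ne hlc
  filter_upwards [Filter.eventually_all.2 hη, hM, hout, hlc'] with x hx hxM hxout hxlc
  choose z hz1 hz2 hz3 using hx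
  have hzmono : StrictMono z := by
    intro i j hij
    have h1 := (abs_lt.1 (hz1 i)).2
    have h2 := (abs_lt.1 (hz1 j)).1
    have h3 := hgap i j hij
    linarith [hηε i, hηε j]
  have hzall : ∀ w, w ∈ g.fibreZeros x ↔ ∃ i, z i = w := by
    intro w
    rw [mem_fibreZeros (map_evalRingHom_ne_zero hxlc)]
    constructor
    · intro hw
      by_contra hne
      refine hxout w ⟨abs_le.1 (hxM w hw), fun hmem ↦ ?_⟩ hw
      obtain ⟨i, hi⟩ := Set.mem_iUnion.1 hmem
      exact hne ⟨i, (hz3 i w (by simpa [Real.dist_eq] using hi) hw).symm⟩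
    · rintro ⟨i, rfl⟩
      exact hz2 i
  obtain ⟨hcard, hval⟩ := nthZero_eq_of_strictMono hzmono hzall
  refine ⟨hcard, fun j hj ↦ ?_⟩
  rw [hval ⟨j, hj⟩]
  have : g.nthZero j x₀ = y ⟨j, hj⟩ := by rw [nthZero, dif_pos hj]
  rw [this]
  exact (hz1 _).trans_le ((hηε _).trans hε'ε)

/-- Over an interval of regular abscissae the number of zeros in a fibre is constant. -/
theorem Polynomial.card_fibreZeros_eq {g : ℝ[X][X]} {a b : ℝ} (hab : a ≤ b)
    (hreg : ∀ x ∈ Set.Icc a b, g.leadingCoeff.eval x ≠ 0 ∧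
      ∀ y, evalEval x y g = 0 → evalEval x y (derivative g) ≠ 0) {x : ℝ} (hx : x ∈ Set.Icc a b) :
    (g.fibreZeros x).card = (g.fibreZeros a).card := by
  refine isPreconnected_Icc.constant (f := fun x ↦ (g.fibreZeros x).card) (fun x hx ↦ ?_) hx
    (Set.left_mem_Icc.2 hab)
  refine ContinuousAt.continuousWithinAt (tendsto_nhds_of_eventually_eq ?_)
  filter_upwards [eventually_card_fibreZeros (hreg x hx).1 (hreg x hx).2 one_pos] with w hw
  exact hw.1

theorem Polynomial.continuousOn_nthZero {g : ℝ[X][X]} {a b : ℝ} (hab : a ≤ b)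
    (hreg : ∀ x ∈ Set.Icc a b, g.leadingCoeff.eval x ≠ 0 ∧
      ∀ y, evalEval x y g = 0 → evalEval x y (derivative g) ≠ 0) {j : ℕ}
    (hj : j < (g.fibreZeros a).card) : ContinuousOn (g.nthZero j) (Set.Icc a b) := by
  intro x hx
  refine ContinuousAt.continuousWithinAt (Metric.continuousAt_iff'.2 fun ε hε ↦ ?_)
  filter_upwards [eventually_card_fibreZeros (hreg x hx).1 (hreg x hx).2 hε] with w hw
  rw [Real.dist_eq]
  exact hw.2 j (by rwa [card_fibreZeros_eq hab hreg hx])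

theorem lt_iff_lt_of_continuousOn_Icc {u v : ℝ → ℝ} {a b : ℝ} (hab : a ≤ b)
    (hu : ContinuousOn u (Set.Icc a b)) (hv : ContinuousOn v (Set.Icc a b))
    (hne : ∀ x ∈ Set.Icc a b, u x ≠ v x) : u a < v a ↔ u b < v b := by
  have hc : ContinuousOn (fun x ↦ u x - v x) (Set.Icc a b) := hu.sub hv
  constructor
  · intro h
    by_contra hb
    obtain ⟨x, hx, h0⟩ := intermediate_value_Icc hab hc
      (show (0 : ℝ) ∈ Set.Icc _ _ from ⟨by linarith, by linarith⟩)
    exact hne x hx (sub_eq_zero.1 h0)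
  · intro h
    by_contra hb
    obtain ⟨x, hx, h0⟩ := intermediate_value_Icc' hab hc
      (show (0 : ℝ) ∈ Set.Icc _ _ from ⟨by linarith, by linarith⟩)
    exact hne x hx (sub_eq_zero.1 h0)

/-- A family of partially defined functions `ℝ → ℝ` (extended by the constants `⊤` and `⊥`), any
two of which keep the same domain and the same strict order along every interval that avoids a
finite set of at most `c` abscissae. -/
structure ArcSystem (ι : Type*) (c : ℕ) where
  dom : ι → Set ℝ
  val : ι → ℝ → EReal
  event : ι → ι → Finset ℝ
  top : ι
  bot : ι
  card_event_le : ∀ i l, (event i l).card ≤ c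
  top_dom : ∀ x, x ∈ dom top
  bot_dom : ∀ x, x ∈ dom bot
  val_top : ∀ x, val top x = ⊤
  val_bot : ∀ x, val bot x = ⊥
  stable : ∀ i l, i ≠ l → ∀ x x', x ≤ x' → (∀ e ∈ event i l, e ∉ Set.Icc x x') →
    (x ∈ dom i ↔ x' ∈ dom i) ∧ (x ∈ dom l ↔ x' ∈ dom l) ∧
    (x ∈ dom i → x ∈ dom l → val i x ≠ val l x ∧ val i x' ≠ val l x' ∧
      (val i x < val l x ↔ val i x' < val l x'))

namespace ArcSystem

open scoped Classical in
section

variable {ι : Type*} [LinearOrder ι] {c : ℕ} (𝒜 : ArcSystem ι c)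

/-- The point `p` lies on the arc `γ`. -/
def On (p : ℝ × ℝ) (γ : ι) : Prop := p.1 ∈ 𝒜.dom γ ∧ 𝒜.val γ p.1 = (p.2 : EReal)

/-- The sample `B` together with the two arcs at infinity. -/
noncomputable def ext (B : Finset ι) : Finset ι := insert 𝒜.top (insert 𝒜.bot B)

/-- The height of an arc, with ties broken by the order on the index type. -/
noncomputable def key (x : ℝ) (i : ι) : EReal ×ₗ ι := toLex (𝒜.val i x, i)

/-- The arcs of the sample passing through or above `p`. -/
noncomputable def upper (p : ℝ × ℝ) (B : Finset ι) : Finset ι :=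
  {l ∈ 𝒜.ext B | p.1 ∈ 𝒜.dom l ∧ (p.2 : EReal) ≤ 𝒜.val l p.1}

/-- The arcs of the sample passing strictly below `p`. -/
noncomputable def lower (p : ℝ × ℝ) (B : Finset ι) : Finset ι :=
  {l ∈ 𝒜.ext B | p.1 ∈ 𝒜.dom l ∧ 𝒜.val l p.1 < (p.2 : EReal)}

variable {𝒜}

theorem mem_ext {B : Finset ι} {i : ι} : i ∈ 𝒜.ext B ↔ i = 𝒜.top ∨ i = 𝒜.bot ∨ i ∈ B := by
  simp [ext]

theorem ext_mono {B B' : Finset ι} (h : B ⊆ B') : 𝒜.ext B ⊆ 𝒜.ext B' :=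
  Finset.insert_subset_insert _ (Finset.insert_subset_insert _ h)

theorem mem_ext_erase {B : Finset ι} {i b : ι} (hi : i ∈ 𝒜.ext B) (hb : b ≠ i) :
    i ∈ 𝒜.ext (B.erase b) := by
  rw [mem_ext] at hi ⊢
  rcases hi with h | h | h
  · exact .inl h
  · exact .inr (.inl h)
  · exact .inr (.inr (Finset.mem_erase.2 ⟨hb.symm, h⟩))

theorem mem_upper {p : ℝ × ℝ} {B : Finset ι} {l : ι} :
    l ∈ 𝒜.upper p B ↔ l ∈ 𝒜.ext B ∧ p.1 ∈ 𝒜.dom l ∧ (p.2 : EReal) ≤ 𝒜.val l p.1 := by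
  simp [upper]

theorem mem_lower {p : ℝ × ℝ} {B : Finset ι} {l : ι} :
    l ∈ 𝒜.lower p B ↔ l ∈ 𝒜.ext B ∧ p.1 ∈ 𝒜.dom l ∧ 𝒜.val l p.1 < (p.2 : EReal) := by
  simp [lower]

theorem upper_nonempty (p : ℝ × ℝ) (B : Finset ι) : (𝒜.upper p B).Nonempty :=
  ⟨𝒜.top, mem_upper.2 ⟨mem_ext.2 (.inl rfl), 𝒜.top_dom _, by rw [𝒜.val_top]; exact le_top⟩⟩

theorem lower_nonempty (p : ℝ × ℝ) (B : Finset ι) : (𝒜.lower p B).Nonempty :=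
  ⟨𝒜.bot, mem_lower.2 ⟨mem_ext.2 (.inr (.inl rfl)), 𝒜.bot_dom _,
    by rw [𝒜.val_bot]; exact EReal.bot_lt_coe _⟩⟩

omit [LinearOrder ι] in
theorem key_injective (x : ℝ) : Function.Injective (𝒜.key x) := fun i j h ↦ by
  have := congrArg (fun z ↦ (ofLex z).2) h
  exact this

theorem val_le_of_key_le {x : ℝ} {i j : ι} (h : 𝒜.key x i ≤ 𝒜.key x j) :
    𝒜.val i x ≤ 𝒜.val j x := by
  rcases Prod.Lex.le_iff.1 h with h | h
  · exact h.le
  · exact h.1.le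

theorem key_le_of_val_lt {x : ℝ} {i j : ι} (h : 𝒜.val i x < 𝒜.val j x) :
    𝒜.key x i ≤ 𝒜.key x j :=
  Prod.Lex.le_iff.2 (.inl h)

variable (𝒜)

/-- The arc of the sample immediately above `p`. -/
noncomputable def above (p : ℝ × ℝ) (B : Finset ι) : ι :=
  (Finset.exists_min_image _ (𝒜.key p.1) (𝒜.upper_nonempty p B)).choose

/-- The arc of the sample immediately below `p`. -/
noncomputable def below (p : ℝ × ℝ) (B : Finset ι) : ι :=
  (Finset.exists_max_image _ (𝒜.key p.1) (𝒜.lower_nonempty p B)).choose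

/-- The abscissae at which the arc above or below `p` may meet another arc of the sample. -/
noncomputable def events (p : ℝ × ℝ) (B : Finset ι) : Finset ℝ :=
  (𝒜.ext B).biUnion fun l ↦ 𝒜.event (𝒜.above p B) l ∪ 𝒜.event (𝒜.below p B) l

/-- The right wall of the cell of `p`. -/
noncomputable def wall (p : ℝ × ℝ) (B : Finset ι) : WithTop ℝ :=
  ({e ∈ 𝒜.events p B | p.1 ≤ e} : Finset ℝ).min

/-- The combinatorial description of the cell of `p`. -/
noncomputable def cell (p : ℝ × ℝ) (B : Finset ι) : ι × ι × WithTop ℝ :=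
  (𝒜.above p B, 𝒜.below p B, 𝒜.wall p B)

variable {𝒜} {p q : ℝ × ℝ} {B : Finset ι} {i b l γ : ι}

theorem above_mem : 𝒜.above p B ∈ 𝒜.upper p B :=
  (Finset.exists_min_image _ (𝒜.key p.1) (𝒜.upper_nonempty p B)).choose_spec.1

theorem key_above_le (h : l ∈ 𝒜.upper p B) : 𝒜.key p.1 (𝒜.above p B) ≤ 𝒜.key p.1 l :=
  (Finset.exists_min_image _ (𝒜.key p.1) (𝒜.upper_nonempty p B)).choose_spec.2 l h

theorem below_mem : 𝒜.below p B ∈ 𝒜.lower p B :=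
  (Finset.exists_max_image _ (𝒜.key p.1) (𝒜.lower_nonempty p B)).choose_spec.1

theorem le_key_below (h : l ∈ 𝒜.lower p B) : 𝒜.key p.1 l ≤ 𝒜.key p.1 (𝒜.below p B) :=
  (Finset.exists_max_image _ (𝒜.key p.1) (𝒜.lower_nonempty p B)).choose_spec.2 l h

theorem above_eq_of (h : i ∈ 𝒜.upper p B) (h' : ∀ l ∈ 𝒜.upper p B, 𝒜.key p.1 i ≤ 𝒜.key p.1 l) :
    𝒜.above p B = i :=
  key_injective _ ((key_above_le h).antisymm (h' _ above_mem))

theorem below_eq_of (h : i ∈ 𝒜.lower p B) (h' : ∀ l ∈ 𝒜.lower p B, 𝒜.key p.1 l ≤ 𝒜.key p.1 i) :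
    𝒜.below p B = i :=
  key_injective _ ((h' _ below_mem).antisymm (le_key_below h))

theorem above_erase (hb : b ≠ 𝒜.above p B) : 𝒜.above p (B.erase b) = 𝒜.above p B := by
  have hm := mem_upper.1 (above_mem (𝒜 := 𝒜) (p := p) (B := B))
  refine above_eq_of (mem_upper.2 ⟨mem_ext_erase hm.1 hb, hm.2⟩) fun l hl ↦ key_above_le ?_
  have := mem_upper.1 hl
  exact mem_upper.2 ⟨ext_mono (Finset.erase_subset _ _) this.1, this.2⟩

theorem below_erase (hb : b ≠ 𝒜.below p B) : 𝒜.below p (B.erase b) = 𝒜.below p B := by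
  have hm := mem_lower.1 (below_mem (𝒜 := 𝒜) (p := p) (B := B))
  refine below_eq_of (mem_lower.2 ⟨mem_ext_erase hm.1 hb, hm.2⟩) fun l hl ↦ le_key_below ?_
  have := mem_lower.1 hl
  exact mem_lower.2 ⟨ext_mono (Finset.erase_subset _ _) this.1, this.2⟩

theorem mem_events {e : ℝ} : e ∈ 𝒜.events p B ↔
    ∃ l ∈ 𝒜.ext B, e ∈ 𝒜.event (𝒜.above p B) l ∨ e ∈ 𝒜.event (𝒜.below p B) l := by
  simp [events]

theorem mem_events_of_wall_eq {e : ℝ} (h : 𝒜.wall p B = e) : e ∈ 𝒜.events p B ∧ p.1 ≤ e := by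
  have := Finset.mem_of_min h
  simpa using this

theorem le_wall : (p.1 : WithTop ℝ) ≤ 𝒜.wall p B := by
  refine Finset.le_min fun e he ↦ ?_
  exact WithTop.coe_le_coe.2 (Finset.mem_filter.1 he).2

theorem wall_le {e : ℝ} (he : e ∈ 𝒜.events p B) (hp : p.1 ≤ e) : 𝒜.wall p B ≤ e :=
  Finset.min_le (Finset.mem_filter.2 ⟨he, hp⟩)

theorem wall_erase (ha : b ≠ 𝒜.above p B) (hb : b ≠ 𝒜.below p B)
    (hl : ∀ e : ℝ, 𝒜.wall p B = e →
      e ∈ 𝒜.event (𝒜.above p B) l ∨ e ∈ 𝒜.event (𝒜.below p B) l)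
    (hl' : l ∈ 𝒜.ext B) (hbl : b ≠ l) : 𝒜.wall p (B.erase b) = 𝒜.wall p B := by
  have hsub : 𝒜.events p (B.erase b) ⊆ 𝒜.events p B := by
    intro e he
    rw [mem_events, above_erase ha, below_erase hb] at he
    obtain ⟨l, hl, h⟩ := he
    exact mem_events.2 ⟨l, ext_mono (Finset.erase_subset _ _) hl, h⟩
  refine le_antisymm ?_ (Finset.min_mono (Finset.filter_subset_filter _ hsub))
  cases h : 𝒜.wall p B with
  | top => exact le_top
  | coe e =>
    refine wall_le (mem_events.2 ?_) (mem_events_of_wall_eq h).2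
    rw [above_erase ha, below_erase hb]
    exact ⟨l, mem_ext_erase hl' hbl, hl e h⟩

theorem exists_cell_erase (𝒜 : ArcSystem ι c) (p : ℝ × ℝ) (B : Finset ι) :
    ∃ D : Finset ι, D.card ≤ 3 ∧ ∀ b ∉ D, 𝒜.cell p (B.erase b) = 𝒜.cell p B := by
  obtain ⟨l, hl', hl⟩ : ∃ l ∈ 𝒜.ext B, ∀ e : ℝ, 𝒜.wall p B = e →
      e ∈ 𝒜.event (𝒜.above p B) l ∨ e ∈ 𝒜.event (𝒜.below p B) l := by
    cases h : 𝒜.wall p B with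
    | top => exact ⟨𝒜.top, mem_ext.2 (.inl rfl), fun e he ↦ absurd he (by simp)⟩
    | coe e =>
      obtain ⟨l, hl, hl'⟩ := mem_events.1 (mem_events_of_wall_eq h).1
      exact ⟨l, hl, fun e' he' ↦ by rwa [← WithTop.coe_injective he']⟩
  refine ⟨{𝒜.above p B, 𝒜.below p B, l}, Finset.card_le_three, fun b hb ↦ ?_⟩
  simp only [Finset.mem_insert, Finset.mem_singleton, not_or] at hb
  rw [cell, cell, above_erase hb.1, below_erase hb.2.1, wall_erase hb.1 hb.2.1 hl hl' hb.2.2]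

theorem mem_lower_iff : l ∈ 𝒜.lower p B ↔
    l ∈ 𝒜.ext B ∧ p.1 ∈ 𝒜.dom l ∧ 𝒜.val l p.1 < 𝒜.val (𝒜.above p B) p.1 := by
  rw [mem_lower]
  refine and_congr_right fun h1 ↦ and_congr_right fun h2 ↦ ⟨fun h ↦ ?_, fun h ↦ ?_⟩
  · exact h.trans_le (mem_upper.1 above_mem).2.2
  · by_contra H
    exact absurd h (not_lt.2 (val_le_of_key_le (key_above_le (mem_upper.2 ⟨h1, h2, not_lt.1 H⟩))))

theorem mem_upper_iff : l ∈ 𝒜.upper p B ↔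
    l ∈ 𝒜.ext B ∧ p.1 ∈ 𝒜.dom l ∧ 𝒜.val (𝒜.below p B) p.1 < 𝒜.val l p.1 := by
  rw [mem_upper]
  refine and_congr_right fun h1 ↦ and_congr_right fun h2 ↦ ⟨fun h ↦ ?_, fun h ↦ ?_⟩
  · exact (mem_lower.1 below_mem).2.2.trans_le h
  · by_contra H
    exact absurd h (not_lt.2 (val_le_of_key_le (le_key_below (mem_lower.2 ⟨h1, h2, not_le.1 H⟩))))

/-- If `p` is to the left of `q` and both are in the same position with respect to the wall of `p`,
then no event separates them. -/
theorem eq_or_no_event (hq : (q.1 : WithTop ℝ) ≤ 𝒜.wall p B)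
    (hw : 𝒜.wall p B = p.1 ↔ 𝒜.wall p B = q.1) :
    p.1 = q.1 ∨ ∀ e ∈ 𝒜.events p B, e ∉ Set.Icc p.1 q.1 := by
  by_cases h : 𝒜.wall p B = p.1
  · exact .inl (WithTop.coe_injective (h.symm.trans (hw.1 h)))
  · refine .inr fun e he hmem ↦ h (hw.2 (le_antisymm ?_ hq))
    exact (wall_le he hmem.1).trans (WithTop.coe_le_coe.2 hmem.2)

theorem below_eq_of_above_eq (hpq : p.1 ≤ q.1)
    (h : p.1 = q.1 ∨ ∀ e ∈ 𝒜.events p B, e ∉ Set.Icc p.1 q.1)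
    (ha : 𝒜.above q B = 𝒜.above p B) : 𝒜.below q B = 𝒜.below p B := by
  rcases h with h | h
  · have hmem : ∀ l, l ∈ 𝒜.lower q B ↔ l ∈ 𝒜.lower p B := fun l ↦ by
      rw [mem_lower_iff, mem_lower_iff, ha, h]
    refine below_eq_of ((hmem _).2 below_mem) fun l hl ↦ ?_
    rw [← h]
    exact le_key_below ((hmem l).1 hl)
  · have hmem : ∀ l, l ∈ 𝒜.lower q B ↔ l ∈ 𝒜.lower p B := fun l ↦ by
      rw [mem_lower_iff, mem_lower_iff, ha]
      refine and_congr_right fun hl ↦ ?_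
      by_cases hne : 𝒜.above p B = l
      · subst hne
        simp
      · obtain ⟨hi, hd, hs⟩ := 𝒜.stable _ l hne _ _ hpq fun e he ↦
          h e (mem_events.2 ⟨l, hl, .inl he⟩)
        rw [← hd]
        refine and_congr_right fun hx ↦ ?_
        obtain ⟨h1, h2, h3⟩ := hs (mem_upper.1 above_mem).2.1 hx
        rw [← not_iff_not, not_lt, not_lt, h1.le_iff_lt, h2.le_iff_lt, h3]
    refine below_eq_of ((hmem _).2 below_mem) fun l hl ↦ ?_
    by_cases hne : 𝒜.below p B = l
    · rw [hne]
    · have hlp := (hmem l).1 hl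
      obtain ⟨-, -, hs⟩ := 𝒜.stable _ l hne _ _ hpq fun e he ↦
        h e (mem_events.2 ⟨l, (mem_lower.1 hl).1, .inr he⟩)
      obtain ⟨h1, h2, h3⟩ := hs (mem_lower.1 below_mem).2.1 (mem_lower.1 hlp).2.1
      have := val_le_of_key_le (le_key_below hlp)
      refine key_le_of_val_lt (lt_of_le_of_ne (not_lt.1 ?_) h2.symm)
      rwa [← h3, not_lt]

theorem above_eq_of_below_eq (hpq : p.1 ≤ q.1)
    (h : p.1 = q.1 ∨ ∀ e ∈ 𝒜.events p B, e ∉ Set.Icc p.1 q.1)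
    (ha : 𝒜.below q B = 𝒜.below p B) : 𝒜.above q B = 𝒜.above p B := by
  rcases h with h | h
  · have hmem : ∀ l, l ∈ 𝒜.upper q B ↔ l ∈ 𝒜.upper p B := fun l ↦ by
      rw [mem_upper_iff, mem_upper_iff, ha, h]
    refine above_eq_of ((hmem _).2 above_mem) fun l hl ↦ ?_
    rw [← h]
    exact key_above_le ((hmem l).1 hl)
  · have hmem : ∀ l, l ∈ 𝒜.upper q B ↔ l ∈ 𝒜.upper p B := fun l ↦ by
      rw [mem_upper_iff, mem_upper_iff, ha]
      refine and_congr_right fun hl ↦ ?_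
      by_cases hne : 𝒜.below p B = l
      · subst hne
        simp
      · obtain ⟨hi, hd, hs⟩ := 𝒜.stable _ l hne _ _ hpq fun e he ↦
          h e (mem_events.2 ⟨l, hl, .inr he⟩)
        rw [← hd]
        exact and_congr_right fun hx ↦ (hs (mem_lower.1 below_mem).2.1 hx).2.2.symm
    refine above_eq_of ((hmem _).2 above_mem) fun l hl ↦ ?_
    by_cases hne : 𝒜.above p B = l
    · rw [hne]
    · have hlp := (hmem l).1 hl
      obtain ⟨-, -, hs⟩ := 𝒜.stable _ l hne _ _ hpq fun e he ↦
        h e (mem_events.2 ⟨l, (mem_upper.1 hl).1, .inl he⟩)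
      obtain ⟨h1, h2, h3⟩ := hs (mem_upper.1 above_mem).2.1 (mem_upper.1 hlp).2.1
      have := val_le_of_key_le (key_above_le hlp)
      exact key_le_of_val_lt (h3.1 (lt_of_le_of_ne this h1))

/-- An arc through a point `q ≠ p` of the cell of `p` either is the arc above `p` or changes the
cell of `p` when it is added to the sample. -/
theorem eq_above_or_cell_ne (hpq : p.1 ≤ q.1) (hne : p ≠ q)
    (ha : 𝒜.above q B = 𝒜.above p B) (hb : 𝒜.below q B = 𝒜.below p B)
    (hq : (q.1 : WithTop ℝ) ≤ 𝒜.wall p B) (hw : 𝒜.wall p B = p.1 ↔ 𝒜.wall p B = q.1)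
    (hflag : 𝒜.On p (𝒜.above p B) ↔ 𝒜.On q (𝒜.above p B)) (hγ : 𝒜.On q γ) :
    γ = 𝒜.above p B ∨ 𝒜.cell p (insert γ B) ≠ 𝒜.cell p B := by
  by_contra! H
  obtain ⟨hγa, hcell⟩ := H
  simp only [cell, Prod.mk.injEq] at hcell
  obtain ⟨hca, hcb, hcw⟩ := hcell
  have hγm : γ ∈ 𝒜.ext (insert γ B) := mem_ext.2 (.inr (.inr (Finset.mem_insert_self _ _)))
  have hdich := eq_or_no_event (𝒜 := 𝒜) (B := insert γ B) (hcw ▸ hq) (hcw ▸ hw)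
  have hqa := mem_upper.1 (above_mem (𝒜 := 𝒜) (p := q) (B := B))
  have hqb := mem_lower.1 (below_mem (𝒜 := 𝒜) (p := q) (B := B))
  rw [ha] at hqa
  rw [hb] at hqb
  by_cases hf : 𝒜.On q (𝒜.above p B)
  · have hf' := hflag.2 hf
    rcases hdich with h | h
    · have := hf'.2.symm.trans ((congrArg _ h).trans hf.2)
      exact hne (Prod.ext h (EReal.coe_injective this))
    · obtain ⟨h1, h2, h3⟩ := 𝒜.stable _ γ (Ne.symm hγa) _ _ hpq fun e he ↦
        h e (mem_events.2 ⟨γ, hγm, .inl (hca ▸ he)⟩)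
      exact (h3 hf'.1 (h2.2 hγ.1)).2.1 (hf.2.trans hγ.2.symm)
  · have hlt : 𝒜.val γ q.1 < 𝒜.val (𝒜.above p B) q.1 := by
      rw [hγ.2]
      exact lt_of_le_of_ne hqa.2.2 fun h ↦ hf ⟨hqa.2.1, h.symm⟩
    have hgt : 𝒜.val (𝒜.below p B) q.1 < 𝒜.val γ q.1 := by
      rw [hγ.2]
      exact hqb.2.2
    have hγb : 𝒜.below p B ≠ γ := fun h ↦ by simp [h] at hgt
    obtain ⟨hd, hlt', hgt'⟩ : p.1 ∈ 𝒜.dom γ ∧ 𝒜.val γ p.1 < 𝒜.val (𝒜.above p B) p.1 ∧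
        𝒜.val (𝒜.below p B) p.1 < 𝒜.val γ p.1 := by
      rcases hdich with h | h
      · rw [h]
        exact ⟨hγ.1, hlt, hgt⟩
      · obtain ⟨h1, h2, h3⟩ := 𝒜.stable _ γ (Ne.symm hγa) _ _ hpq fun e he ↦
          h e (mem_events.2 ⟨γ, hγm, .inl (hca ▸ he)⟩)
        obtain ⟨h1', h2', h3'⟩ := 𝒜.stable _ γ hγb _ _ hpq fun e he ↦
          h e (mem_events.2 ⟨γ, hγm, .inr (hcb ▸ he)⟩)
        have hd := h2.2 hγ.1
        obtain ⟨h4, h5, h6⟩ := h3 (h1.2 hqa.2.1) hd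
        refine ⟨hd, lt_of_le_of_ne (not_lt.1 fun hc ↦ ?_) h4.symm,
          (h3' (h1'.2 hqb.2.1) hd).2.2.2 hgt⟩
        exact absurd (h6.1 hc) hlt.not_gt
    have hmem : γ ∈ 𝒜.lower p (insert γ B) := mem_lower_iff.2 ⟨hγm, hd, by rwa [hca]⟩
    have := val_le_of_key_le (le_key_below hmem)
    rw [hcb] at this
    exact absurd hgt' (not_lt.2 this)

/-- The arcs whose addition to the sample changes the cell of `p`. -/
noncomputable def conflicts (𝒜 : ArcSystem ι c) (A : Finset ι) (p : ℝ × ℝ) (B : Finset ι) :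
    Finset ι :=
  {γ ∈ A \ B | 𝒜.cell p (insert γ B) ≠ 𝒜.cell p B}

theorem sum_card_conflicts_le (𝒜 : ArcSystem ι c) (A : Finset ι) (p : ℝ × ℝ) (r : ℕ) :
    ∑ B ∈ A.powersetCard r, (𝒜.conflicts A p B).card ≤ 3 * A.card.choose (r + 1) := by
  rw [← Finset.card_sigma]
  let T : Finset (Σ _ : Finset ι, ι) := (A.powersetCard (r + 1)).sigma
    fun B ↦ {b ∈ B | 𝒜.cell p (B.erase b) ≠ 𝒜.cell p B}
  have hT : T.card ≤ 3 * A.card.choose (r + 1) := by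
    rw [Finset.card_sigma, mul_comm, ← Finset.card_powersetCard, ← smul_eq_mul]
    refine Finset.sum_le_card_nsmul _ _ _ fun B _ ↦ ?_
    obtain ⟨D, hD, h⟩ := 𝒜.exists_cell_erase p B
    refine (Finset.card_le_card fun b hb ↦ ?_).trans hD
    by_contra hbD
    exact (Finset.mem_filter.1 hb).2 (h b hbD)
  refine (Finset.card_le_card_of_injOn (fun x ↦ ⟨insert x.2 x.1, x.2⟩) ?_ ?_).trans hT
  · rintro ⟨B, γ⟩ hx
    simp only [conflicts, Finset.coe_sigma, Set.mem_sigma_iff, Finset.mem_coe,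
      Finset.mem_powersetCard, Finset.mem_filter, Finset.mem_sdiff] at hx
    obtain ⟨⟨hB, hr⟩, ⟨hA, hγ⟩, hne⟩ := hx
    simp only [T, Finset.coe_sigma, Set.mem_sigma_iff, Finset.mem_coe,
      Finset.mem_powersetCard, Finset.mem_filter, Finset.mem_insert_self, true_and,
      Finset.erase_insert hγ, Finset.card_insert_of_notMem hγ, hr, and_true]
    exact ⟨Finset.insert_subset hA hB, hne.symm⟩
  · rintro ⟨B, γ⟩ hx ⟨B', γ'⟩ hx' h
    simp only [conflicts, Finset.coe_sigma, Set.mem_sigma_iff, Finset.mem_coe,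
      Finset.mem_filter, Finset.mem_sdiff] at hx hx'
    simp only [Sigma.mk.injEq, heq_eq_eq] at h
    obtain ⟨h, rfl⟩ := h
    have : B = B' := by
      rw [← Finset.erase_insert hx.2.1.2, h, Finset.erase_insert hx'.2.1.2]
    rw [this]

theorem exists_sample (𝒜 : ArcSystem ι c) (A : Finset ι) (P : Finset (ℝ × ℝ)) {r : ℕ}
    (hr : r ≤ A.card) : ∃ B ∈ A.powersetCard r,
      (r + 1) * ∑ p ∈ P, (𝒜.conflicts A p B).card ≤ 3 * P.card * (A.card - r) := by
  by_contra! H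
  have hne : (A.powersetCard r).Nonempty := Finset.powersetCard_nonempty.2 hr
  have h1 := Finset.sum_lt_sum_of_nonempty hne H
  rw [Finset.sum_const, smul_eq_mul, Finset.card_powersetCard, ← Finset.mul_sum,
    Finset.sum_comm] at h1
  have h2 : ∑ p ∈ P, ∑ B ∈ A.powersetCard r, (𝒜.conflicts A p B).card ≤
      P.card * (3 * A.card.choose (r + 1)) := by
    rw [← smul_eq_mul]
    exact Finset.sum_le_card_nsmul _ _ _ fun p _ ↦ sum_card_conflicts_le 𝒜 A p r
  have h3 := Nat.mul_le_mul_left (r + 1) h2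
  have h4 := Nat.choose_succ_right_eq A.card r
  have h5 : (r + 1) * (P.card * (3 * A.card.choose (r + 1))) =
      A.card.choose r * (3 * P.card * (A.card - r)) := by
    rw [show (r + 1) * (P.card * (3 * A.card.choose (r + 1))) =
      P.card * 3 * (A.card.choose (r + 1) * (r + 1)) by ring, h4]
    ring
  omega

theorem exists_sample_card_le (𝒜 : ArcSystem ι c) (A : Finset ι) (P : Finset (ℝ × ℝ)) {r : ℕ}
    (hr : r ≤ A.card) : ∃ B ⊆ A, B.card = r ∧ P.card ≤
      2 * ({p ∈ P | (r + 1) * (𝒜.conflicts A p B).card ≤ 6 * (A.card - r)} : Finset _).card := by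
  obtain ⟨B, hB, h⟩ := exists_sample 𝒜 A P hr
  obtain ⟨hBA, hBr⟩ := Finset.mem_powersetCard.1 hB
  refine ⟨B, hBA, hBr, ?_⟩
  have hcard := Finset.card_filter_add_card_filter_not (s := P)
    (fun p ↦ (r + 1) * (𝒜.conflicts A p B).card ≤ 6 * (A.card - r))
  set bad := ({p ∈ P | ¬ (r + 1) * (𝒜.conflicts A p B).card ≤ 6 * (A.card - r)} : Finset _)
  have h1 : bad.card * (6 * (A.card - r) + 1) ≤ 3 * P.card * (A.card - r) := by
    refine le_trans ?_ h
    rw [Finset.mul_sum, ← smul_eq_mul]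
    refine (Finset.card_nsmul_le_sum _ _ _ fun p hp ↦ ?_).trans
      (Finset.sum_le_sum_of_subset (Finset.filter_subset _ _))
    have := (Finset.mem_filter.1 hp).2
    omega
  have h2 : 2 * bad.card ≤ P.card := by
    rcases Nat.eq_zero_or_pos (A.card - r) with h0 | h0
    · rw [h0] at h1
      omega
    · by_contra! hc
      nlinarith
  omega

/-- The wall of the cell of `p` is caused by the arc above `p`. -/
def WallAbove (𝒜 : ArcSystem ι c) (p : ℝ × ℝ) (B : Finset ι) : Prop :=
  ∀ e : ℝ, 𝒜.wall p B = e → ∃ l ∈ 𝒜.ext B, e ∈ 𝒜.event (𝒜.above p B) l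

/-- A description of the cell of `p` by an arc and an event on that arc, together with the position
of `p` in the cell. -/
noncomputable def label (𝒜 : ArcSystem ι c) (B : Finset ι) (p : ℝ × ℝ) :
    Bool × Bool × Bool × ι × WithTop ℝ :=
  (decide (𝒜.WallAbove p B), decide (𝒜.wall p B = p.1), decide (𝒜.On p (𝒜.above p B)),
    if 𝒜.WallAbove p B then 𝒜.above p B else 𝒜.below p B, 𝒜.wall p B)

theorem exists_labels (𝒜 : ArcSystem ι c) (B : Finset ι) (hB : 1 ≤ B.card) :
    ∃ T : Finset (Bool × Bool × Bool × ι × WithTop ℝ), T.card ≤ 72 * (c + 1) * B.card ^ 2 ∧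
      ∀ p, 𝒜.label B p ∈ T := by
  let E : Finset (ι × WithTop ℝ) := 𝒜.ext B ×ˢ {⊤} ∪
    (𝒜.ext B ×ˢ 𝒜.ext B).biUnion
      fun x ↦ {x.1} ×ˢ (𝒜.event x.1 x.2).image ((↑) : ℝ → WithTop ℝ)
  refine ⟨Finset.univ ×ˢ Finset.univ ×ˢ Finset.univ ×ˢ E, ?_, fun p ↦ ?_⟩
  · have hext : (𝒜.ext B).card ≤ 3 * B.card := by
      have h1 := Finset.card_insert_le 𝒜.top (insert 𝒜.bot B)
      have h2 := Finset.card_insert_le 𝒜.bot B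
      rw [ext]
      omega
    have hE : E.card ≤ 3 * B.card + (3 * B.card * (3 * B.card)) * c := by
      refine (Finset.card_union_le _ _).trans (add_le_add ?_ ?_)
      · simpa using hext
      · refine (Finset.card_biUnion_le_card_mul _ _ c fun x _ ↦ ?_).trans ?_
        · rw [Finset.card_product, Finset.card_singleton, one_mul]
          exact Finset.card_image_le.trans (𝒜.card_event_le _ _)
        · rw [Finset.card_product]
          gcongr
    simp only [Finset.card_product, Finset.card_univ, Fintype.card_bool]
    nlinarith [Nat.le_self_pow two_ne_zero B.card]
  · simp only [label, Finset.mem_product, Finset.mem_univ, true_and]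
    have ha := (mem_upper.1 (above_mem (𝒜 := 𝒜) (p := p) (B := B))).1
    have hb := (mem_lower.1 (below_mem (𝒜 := 𝒜) (p := p) (B := B))).1
    cases hw : 𝒜.wall p B with
    | top =>
      refine Finset.mem_union_left _ (Finset.mem_product.2 ⟨?_, by simp⟩)
      dsimp only
      split_ifs <;> assumption
    | coe e =>
      refine Finset.mem_union_right _ (Finset.mem_biUnion.2 ?_)
      split_ifs with hk
      · obtain ⟨l, hl, he⟩ := hk e hw
        exact ⟨(_, l), Finset.mem_product.2 ⟨ha, hl⟩, Finset.mem_product.2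
          ⟨Finset.mem_singleton_self _, Finset.mem_image_of_mem _ he⟩⟩
      · obtain ⟨l, hl, he⟩ := mem_events.1 (mem_events_of_wall_eq hw).1
        refine ⟨(_, l), Finset.mem_product.2 ⟨hb, hl⟩, ?_⟩
        rcases he with he | he
        · exact absurd (fun e' he' ↦ ⟨l, hl, by
            rwa [← WithTop.coe_injective (hw.symm.trans he')]⟩) hk
        · exact Finset.mem_product.2 ⟨Finset.mem_singleton_self _, Finset.mem_image_of_mem _ he⟩

/-- Two points with the same label lie in the same cell. -/
theorem cell_eq_of_label_eq (hpq : p.1 ≤ q.1) (h : 𝒜.label B q = 𝒜.label B p) :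
    𝒜.above q B = 𝒜.above p B ∧ 𝒜.below q B = 𝒜.below p B ∧
      (q.1 : WithTop ℝ) ≤ 𝒜.wall p B ∧ (𝒜.wall p B = p.1 ↔ 𝒜.wall p B = q.1) ∧
      (𝒜.On p (𝒜.above p B) ↔ 𝒜.On q (𝒜.above p B)) := by
  simp only [label, Prod.mk.injEq, decide_eq_decide] at h
  obtain ⟨h1, h2, h3, h4, h5⟩ := h
  have hq : (q.1 : WithTop ℝ) ≤ 𝒜.wall p B := h5 ▸ le_wall
  have hw : 𝒜.wall p B = p.1 ↔ 𝒜.wall p B = q.1 := by rw [← h2, h5]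
  have hd := eq_or_no_event hq hw
  have hab : 𝒜.above q B = 𝒜.above p B ∧ 𝒜.below q B = 𝒜.below p B := by
    by_cases hk : 𝒜.WallAbove p B
    · rw [if_pos hk, if_pos (h1.2 hk)] at h4
      exact ⟨h4, below_eq_of_above_eq hpq hd h4⟩
    · rw [if_neg hk, if_neg (mt h1.1 hk)] at h4
      exact ⟨above_eq_of_below_eq hpq hd h4, h4⟩
  refine ⟨hab.1, hab.2, hq, hw, ?_⟩
  rw [← h3, hab.1]

/-- Many points of `P` only lie on few arcs of `A` altogether. -/
theorem exists_cluster (𝒜 : ArcSystem ι c) (A : Finset ι) (P : Finset (ℝ × ℝ)) {r n : ℕ}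
    (hr : 1 ≤ r) (hrA : r ≤ A.card) (hn : 2 * (72 * (c + 1) * r ^ 2) * n < P.card) :
    ∃ S ⊆ P, ∃ A' ⊆ A, n ≤ S.card ∧ (r + 1) * A'.card ≤ 6 * (A.card - r) + (r + 1) ∧
      ∀ q ∈ S, ∀ γ ∈ A, 𝒜.On q γ → γ ∈ A' := by
  obtain ⟨B, hBA, rfl, hG⟩ := exists_sample_card_le 𝒜 A P hrA
  obtain ⟨T, hT, hTl⟩ := exists_labels 𝒜 B hr
  set G := ({p ∈ P | (B.card + 1) * (𝒜.conflicts A p B).card ≤ 6 * (A.card - B.card)} : Finset _)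
  obtain ⟨y, -, hy⟩ := Finset.exists_lt_card_fiber_of_mul_lt_card_of_maps_to
    (s := G) (t := T) (f := 𝒜.label B) (n := n) (fun p _ ↦ hTl p) (by
      have := Nat.mul_le_mul_right n hT
      nlinarith)
  set S := ({p ∈ G | 𝒜.label B p = y} : Finset _)
  obtain ⟨p, hp, hmin⟩ := S.exists_min_image Prod.fst (Finset.card_pos.1 (by omega))
  have hpG := Finset.mem_filter.1 (Finset.mem_filter.1 hp).1
  refine ⟨S.erase p, fun q hq ↦ ?_, {γ ∈ A | γ = 𝒜.above p B ∨ γ ∈ 𝒜.conflicts A p B},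
    Finset.filter_subset _ _, ?_, ?_, fun q hq γ hγ hon ↦ ?_⟩
  · exact (Finset.mem_filter.1 (Finset.mem_filter.1 (Finset.mem_of_mem_erase hq)).1).1
  · rw [Finset.card_erase_of_mem hp]
    omega
  · have h1 : ({γ ∈ A | γ = 𝒜.above p B ∨ γ ∈ 𝒜.conflicts A p B} : Finset ι).card ≤
        (𝒜.conflicts A p B).card + 1 := by
      refine (Finset.card_le_card fun γ hγ ↦ ?_).trans
        (Finset.card_insert_le (𝒜.above p B) (𝒜.conflicts A p B))
      exact Finset.mem_insert.2 (Finset.mem_filter.1 hγ).2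
    have := Nat.mul_le_mul_left (B.card + 1) h1
    have := hpG.2
    linarith
  · obtain ⟨hqp, hqS⟩ := Finset.mem_erase.1 hq
    have hpq := hmin q hqS
    obtain ⟨h1, h2, h3, h4, h5⟩ := cell_eq_of_label_eq hpq
      ((Finset.mem_filter.1 hqS).2.trans (Finset.mem_filter.1 hp).2.symm)
    refine Finset.mem_filter.2 ⟨hγ, ?_⟩
    refine (eq_above_or_cell_ne hpq hqp.symm h1 h2 h3 h4 h5 hon).imp id fun hne ↦ ?_
    refine Finset.mem_filter.2 ⟨Finset.mem_sdiff.2 ⟨hγ, fun hB ↦ hne ?_⟩, hne⟩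
    rw [Finset.insert_eq_of_mem hB]

end

end ArcSystem

namespace Incidence

open scoped Classical in
section

variable {α β : Type*} (R : α → β → Prop)

theorem le_add_choose {s : ℕ} (hs : 1 ≤ s) (d : ℕ) : d ≤ s + d.choose s := by
  induction d with
  | zero => simp
  | succ d ih =>
    rcases lt_or_ge d s with h | h
    · omega
    · obtain ⟨s, rfl⟩ := Nat.exists_eq_add_of_le' hs
      rw [Nat.choose_succ_succ']
      have := Nat.choose_pos (n := d) (k := s) (by omega)
      omega

/-- The elementary bound on the number of incidences in the absence of a `K_{s,t+1}`. -/
theorem sum_card_le {s t : ℕ} (hs : 1 ≤ s) (P : Finset α) (A : Finset β)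
    (h : ∀ T ⊆ P, T.card = s → ({γ ∈ A | ∀ p ∈ T, R p γ} : Finset β).card ≤ t) :
    ∑ γ ∈ A, ({p ∈ P | R p γ} : Finset α).card ≤ s * A.card + t * P.card ^ s := by
  have h1 : ∑ γ ∈ A, (({p ∈ P | R p γ} : Finset α).card.choose s) ≤ t * P.card ^ s := by
    calc ∑ γ ∈ A, (({p ∈ P | R p γ} : Finset α).card.choose s)
        = ∑ γ ∈ A, ((P.powersetCard s).bipartiteBelow (fun T γ ↦ ∀ p ∈ T, R p γ) γ).card := by
          refine Finset.sum_congr rfl fun γ _ ↦ ?_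
          rw [← Finset.card_powersetCard]
          congr 1
          ext T
          simp only [Finset.mem_powersetCard, Finset.mem_bipartiteBelow, Finset.subset_iff,
            Finset.mem_filter]
          grind
      _ = ∑ T ∈ P.powersetCard s, (A.bipartiteAbove (fun T γ ↦ ∀ p ∈ T, R p γ) T).card :=
          (Finset.sum_card_bipartiteAbove_eq_sum_card_bipartiteBelow _).symm
      _ ≤ (P.powersetCard s).card • t := Finset.sum_le_card_nsmul _ _ _ fun T hT ↦ by
          obtain ⟨hT, hc⟩ := Finset.mem_powersetCard.1 hT
          exact h T hT hc
      _ ≤ t * P.card ^ s := by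
          rw [Finset.card_powersetCard, smul_eq_mul, mul_comm]
          exact Nat.mul_le_mul_left _ (Nat.choose_le_pow _ _)
  calc ∑ γ ∈ A, ({p ∈ P | R p γ} : Finset α).card
      ≤ ∑ γ ∈ A, (s + ({p ∈ P | R p γ} : Finset α).card.choose s) :=
        Finset.sum_le_sum fun γ _ ↦ le_add_choose hs _
    _ ≤ s * A.card + t * P.card ^ s := by
        rw [Finset.sum_add_distrib, Finset.sum_const, smul_eq_mul, mul_comm]
        exact Nat.add_le_add_left h1 _

/-- Every large set of points contains a set of at least `n` points which only lie on few members
of `A` altogether, where `n` depends on a parameter `r`. -/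
def HasClusters (A : Finset β) (a : ℕ) : Prop :=
  ∀ (P : Finset α) (r n : ℕ), 1 ≤ r → r ≤ A.card → a * r ^ 2 * n < P.card →
    ∃ S ⊆ P, ∃ A' ⊆ A, n ≤ S.card ∧ (r + 1) * A'.card ≤ 6 * (A.card - r) + (r + 1) ∧
      ∀ q ∈ S, ∀ γ ∈ A, R q γ → γ ∈ A'

variable {R}

theorem exists_maximal_scale {s N M : ℕ} (hN : 1 ≤ N) (hM : N ≤ M) :
    ∃ r, 1 ≤ r ∧ r ≤ N ∧ r ^ s * N ≤ M ∧ (r < N → M < (r + 1) ^ s * N) := by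
  let Q : ℕ → Prop := fun r ↦ r ^ s * N ≤ M
  have h1 : Q 1 := by simpa [Q] using hM
  refine ⟨Nat.findGreatest Q N, Nat.le_findGreatest hN h1, Nat.findGreatest_le N,
    Nat.findGreatest_spec hN h1, fun h ↦ ?_⟩
  exact not_le.1 (Nat.findGreatest_is_greatest (P := Q) (Nat.lt_succ_self _) h)

theorem exists_low_degree {s t a : ℕ} (hs : 1 ≤ s) (ha : 1 ≤ a) {P : Finset α} {A : Finset β}
    (hR : HasClusters R A a)
    (h : ∀ T ⊆ P, T.card = s → ({γ ∈ A | ∀ p ∈ T, R p γ} : Finset β).card ≤ t)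
    (hA : 1 ≤ A.card) (hP : (2 * a) ^ s * A.card ≤ P.card ^ s) :
    ∃ q ∈ P, ∃ r, r ^ (2 * s - 1) * A.card ≤ P.card ^ s ∧
      ({γ ∈ A | R q γ} : Finset β).card * P.card ≤
        4 * a * (7 * s + t * 2 ^ (2 * s - 1)) * A.card * r + P.card := by
  set N := A.card
  set m := P.card
  have hK : 0 < (2 * a) ^ s := by positivity
  obtain ⟨r, hr, hrN, hrm, hmax⟩ := exists_maximal_scale (s := 2 * s - 1) (N := N)
    (M := m ^ s / (2 * a) ^ s) hA (by rw [Nat.le_div_iff_mul_le hK, mul_comm]; exact hP)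
  rw [Nat.le_div_iff_mul_le hK] at hrm
  have hpow : r ^ (2 * s - 1) * r = r ^ (2 * s) := by
    rw [← pow_succ]; congr 1; omega
  have hrm' : 2 * a * r ^ 2 ≤ m := by
    refine le_of_pow_le_pow_left₀ (n := s) (by omega) (Nat.zero_le _) ?_
    refine le_trans ?_ hrm
    calc (2 * a * r ^ 2) ^ s = r ^ (2 * s - 1) * r * (2 * a) ^ s := by
          rw [hpow, mul_pow, ← pow_mul]; ring
      _ ≤ _ := by gcongr
  set n := m / (2 * a * r ^ 2)
  have hpos : 0 < 2 * a * r ^ 2 := by positivity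
  have hn1 : 1 ≤ n := (Nat.one_le_div_iff hpos).2 hrm'
  have hn2 : 2 * a * r ^ 2 * n ≤ m := Nat.mul_div_le _ _
  have hn3 : m < 2 * a * r ^ 2 * (n + 1) := Nat.lt_mul_div_succ _ hpos
  have hn4 : m ≤ 4 * a * r ^ 2 * n := by nlinarith
  obtain ⟨S, hSP, A', hA', hnS, hcard, hinc⟩ := hR P r n hr hrN (by
    have : 0 < a * r ^ 2 * n := by positivity
    change _ < m
    linarith)
  obtain ⟨S, hSS, hSn⟩ := Finset.exists_subset_card_eq hnS
  have hdeg : ∀ q ∈ S, ({γ ∈ A | R q γ} : Finset β) = ({γ ∈ A' | R q γ} : Finset β) := by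
    intro q hq
    ext γ
    simp only [Finset.mem_filter]
    exact ⟨fun hh ↦ ⟨hinc q (hSS hq) γ hh.1 hh.2, hh.2⟩, fun hh ↦ ⟨hA' hh.1, hh.2⟩⟩
  rcases hrN.eq_or_lt with hrN | hrN
  · obtain ⟨q, hq⟩ : S.Nonempty := Finset.card_pos.1 (by omega)
    refine ⟨q, hSP (hSS hq), r, ?_, ?_⟩
    · exact (Nat.le_mul_of_pos_right _ hK).trans hrm
    · have : A'.card ≤ 1 := by
        have : (r + 1) * A'.card ≤ (r + 1) * 1 := by
          change _ ≤ 6 * (N - r) + (r + 1) at hcard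
          rw [hrN] at hcard ⊢
          simpa using hcard
        exact Nat.le_of_mul_le_mul_left this (by omega)
      have h2 : ({γ ∈ A | R q γ} : Finset β).card ≤ 1 := by
        rw [hdeg q hq]
        exact (Finset.card_filter_le _ _).trans this
      have := Nat.mul_le_mul_right m h2
      rw [one_mul] at this
      exact this.trans (Nat.le_add_left _ _)
  · have hsum := sum_card_le R hs S A' (t := t) fun T hT hTs ↦
      (Finset.card_le_card (Finset.filter_subset_filter _ hA')).trans
        (h T (hT.trans (hSS.trans hSP)) hTs)
    have hswap : ∑ γ ∈ A', ({p ∈ S | R p γ} : Finset α).card =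
        ∑ q ∈ S, ({γ ∈ A | R q γ} : Finset β).card := by
      rw [Finset.sum_congr rfl fun q hq ↦ congrArg Finset.card (hdeg q hq)]
      exact (Finset.sum_card_bipartiteAbove_eq_sum_card_bipartiteBelow R).symm
    rw [hswap, hSn] at hsum
    obtain ⟨q, hq, hqd⟩ : ∃ q ∈ S, n * ({γ ∈ A | R q γ} : Finset β).card ≤
        s * A'.card + t * n ^ s := by
      by_contra! H
      have := Finset.sum_lt_sum_of_nonempty (Finset.card_pos.1 (by omega)) H
      rw [Finset.sum_const, ← Finset.mul_sum, hSn, smul_eq_mul] at this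
      exact absurd hsum (not_le.2 (Nat.lt_of_mul_lt_mul_left this))
    have hA'N : r * A'.card ≤ 7 * N := by
      have h1 : 6 * (N - r) + (r + 1) ≤ 7 * N := by omega
      nlinarith
    have hnN : r * n ^ s ≤ 2 ^ (2 * s - 1) * N := by
      have h1 : m ^ s < (2 * a) ^ s * ((r + 1) ^ (2 * s - 1) * N) := by
        have := hmax hrN
        rwa [Nat.div_lt_iff_lt_mul hK, mul_comm] at this
      have h2 : (r + 1) ^ (2 * s - 1) ≤ 2 ^ (2 * s - 1) * r ^ (2 * s - 1) := by
        rw [← mul_pow]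
        gcongr
        omega
      have h3 : (2 * a) ^ s * r ^ (2 * s - 1) * (r * n ^ s) ≤ m ^ s := by
        calc _ = (2 * a) ^ s * (r ^ (2 * s - 1) * r) * n ^ s := by ring
          _ = (2 * a * r ^ 2 * n) ^ s := by
            rw [hpow, mul_pow _ n, mul_pow _ (r ^ 2), ← pow_mul]
          _ ≤ _ := by gcongr
      refine Nat.le_of_mul_le_mul_left (c := (2 * a) ^ s * r ^ (2 * s - 1)) ?_ (by positivity)
      refine h3.trans (h1.le.trans ?_)
      calc _ ≤ (2 * a) ^ s * (2 ^ (2 * s - 1) * r ^ (2 * s - 1) * N) := by gcongr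
        _ = _ := by ring
    refine ⟨q, hSP (hSS hq), r, (Nat.le_mul_of_pos_right _ hK).trans hrm, ?_⟩
    refine le_trans ?_ (Nat.le_add_right _ _)
    set d := ({γ ∈ A | R q γ} : Finset β).card
    have h1 : r * (n * d) ≤ (7 * s + t * 2 ^ (2 * s - 1)) * N := by
      calc r * (n * d) ≤ r * (s * A'.card + t * n ^ s) := by gcongr
        _ = s * (r * A'.card) + t * (r * n ^ s) := by ring
        _ ≤ s * (7 * N) + t * (2 ^ (2 * s - 1) * N) := by gcongr
        _ = _ := by ring
    calc d * m ≤ d * (4 * a * r ^ 2 * n) := by gcongr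
      _ = 4 * a * r * (r * (n * d)) := by ring
      _ ≤ 4 * a * r * ((7 * s + t * 2 ^ (2 * s - 1)) * N) := by gcongr
      _ = _ := by ring

theorem rpow_sub_one_add_le {β x : ℝ} (h0 : 1 / 2 ≤ β) (h1 : β ≤ 1) (hx : 1 ≤ x) :
    (x - 1) ^ β + x ^ β / (2 * x) ≤ x ^ β := by
  have hx0 : 0 < x := by linarith
  have h2 : (1 + -(1 / x)) ^ β ≤ 1 + β * -(1 / x) :=
    rpow_one_add_le_one_add_mul_self (by
      rw [neg_le_neg_iff, div_le_one hx0]; exact hx) (by linarith) h1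
  have h3 : x - 1 = x * (1 + -(1 / x)) := by field_simp; ring
  have h4 : 0 ≤ 1 + -(1 / x) := by
    have : 1 / x ≤ 1 := by rw [div_le_one hx0]; exact hx
    linarith
  rw [h3, Real.mul_rpow hx0.le h4]
  have h5 : x ^ β / (2 * x) = x ^ β * (1 / 2 * (1 / x)) := by field_simp
  have h6 : 1 / 2 * (1 / x) ≤ β * (1 / x) := by gcongr
  have h7 : 0 ≤ x ^ β := by positivity
  rw [h5]
  nlinarith

theorem scale_le {s r N m : ℕ} (hs : 2 ≤ s) (h : r ^ (2 * s - 1) * N ≤ m ^ s) :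
    (N * r : ℝ) ≤ (m : ℝ) ^ ((s : ℝ) / (2 * s - 1)) *
      (N : ℝ) ^ ((2 * (s : ℝ) - 2) / (2 * s - 1)) := by
  have hs' : (2 : ℝ) ≤ s := by exact_mod_cast hs
  have hd : (0 : ℝ) < 2 * s - 1 := by linarith
  have hc : ((2 * s - 1 : ℕ) : ℝ) = 2 * s - 1 := by
    rw [Nat.cast_sub (by omega)]; push_cast; ring
  have hc' : ((2 * s - 2 : ℕ) : ℝ) = 2 * s - 2 := by
    rw [Nat.cast_sub (by omega)]; push_cast; ring
  have h1 : ((N : ℝ) * r) ^ (2 * s - 1) ≤ (m : ℝ) ^ s * (N : ℝ) ^ (2 * s - 2) := by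
    have : (N * r) ^ (2 * s - 1) ≤ m ^ s * N ^ (2 * s - 2) := by
      calc (N * r) ^ (2 * s - 1) = r ^ (2 * s - 1) * N * N ^ (2 * s - 2) := by
            rw [mul_pow, show 2 * s - 1 = (2 * s - 2) + 1 by omega, pow_succ N]; ring
        _ ≤ _ := by gcongr
    exact_mod_cast this
  refine le_of_pow_le_pow_left₀ (n := 2 * s - 1) (by omega) (by positivity) (h1.trans_eq ?_)
  rw [mul_pow, ← Real.rpow_mul_natCast (by positivity), ← Real.rpow_mul_natCast (by positivity),
    hc, div_mul_cancel₀ _ hd.ne', div_mul_cancel₀ _ hd.ne', ← hc', Real.rpow_natCast,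
    Real.rpow_natCast]

/-- The incidence bound in the presence of clusters. -/
theorem sum_card_le_of_hasClusters {s t a : ℕ} (hs : 2 ≤ s) (ha : 1 ≤ a) :
    ∃ D : ℝ, 0 < D ∧ ∀ {α β : Type} {R : α → β → Prop} {A : Finset β}, HasClusters R A a →
      ∀ P : Finset α,
      (∀ T ⊆ P, T.card = s → ({γ ∈ A | ∀ p ∈ T, R p γ} : Finset β).card ≤ t) →
      (∑ γ ∈ A, ({p ∈ P | R p γ} : Finset α).card : ℝ) ≤
        D * ((P.card : ℝ) ^ ((s : ℝ) / (2 * s - 1)) *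
          (A.card : ℝ) ^ ((2 * (s : ℝ) - 2) / (2 * s - 1)) + P.card + A.card) := by
  have hs' : (2 : ℝ) ≤ s := by exact_mod_cast hs
  have hd : (0 : ℝ) < 2 * s - 1 := by linarith
  set b : ℝ := (s : ℝ) / (2 * s - 1)
  set e : ℝ := (2 * (s : ℝ) - 2) / (2 * s - 1)
  have hb0 : 1 / 2 ≤ b := by rw [le_div_iff₀ hd]; linarith
  have hb1 : b ≤ 1 := by rw [div_le_one hd]; linarith
  set E : ℕ := 4 * a * (7 * s + t * 2 ^ (2 * s - 1))
  refine ⟨s + t * (2 * a) ^ s + 2 * E + 1, by positivity, fun {α β R A} hR P ↦ ?_⟩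
  set D : ℝ := s + t * (2 * a) ^ s + 2 * E + 1
  have hD1 : (s + t * (2 * a) ^ s : ℝ) ≤ D := by
    have : (0 : ℝ) ≤ E := by positivity
    simp only [D]; linarith
  have hD2 : (2 * E : ℝ) ≤ D := by
    have : (0 : ℝ) ≤ s + t * (2 * a) ^ s := by positivity
    simp only [D]; linarith
  have hD3 : 1 ≤ D := by
    have : (0 : ℝ) ≤ s + t * (2 * a) ^ s + 2 * E := by positivity
    simp only [D]; linarith
  induction P using Finset.strongInduction with
  | H P ih =>
    intro h
    have hN : (0 : ℝ) ≤ A.card := by positivity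
    have hm : (0 : ℝ) ≤ P.card := by positivity
    rcases lt_or_ge (P.card ^ s) ((2 * a) ^ s * A.card) with hlt | hge
    · have h1 := sum_card_le R (by omega) P A h
      have h2 : s * A.card + t * P.card ^ s ≤ (s + t * (2 * a) ^ s) * A.card := by
        nlinarith [Nat.mul_le_mul_left t hlt.le]
      have h3 : (∑ γ ∈ A, ({p ∈ P | R p γ} : Finset α).card : ℝ) ≤
          (s + t * (2 * a) ^ s) * A.card := by exact_mod_cast h1.trans h2
      refine h3.trans (mul_le_mul hD1 ?_ hN (by linarith))
      have : 0 ≤ (P.card : ℝ) ^ b * (A.card : ℝ) ^ e := by positivity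
      linarith
    · rcases Nat.eq_zero_or_pos A.card with h0 | h0
      · rw [Finset.card_eq_zero.1 h0, Finset.sum_empty]
        positivity
      obtain ⟨q, hq, r, hr, hqd⟩ := exists_low_degree (by omega) ha hR h h0 hge
      have hsub := Finset.erase_subset q P
      have hih := ih _ (Finset.erase_ssubset hq) fun T hT ↦ h T (hT.trans hsub)
      have hP1 : 1 ≤ P.card := Finset.card_pos.2 ⟨q, hq⟩
      have hP1' : (1 : ℝ) ≤ P.card := by exact_mod_cast hP1
      have hstep : ∑ γ ∈ A, ({p ∈ P | R p γ} : Finset α).card =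
          ∑ γ ∈ A, ({p ∈ P.erase q | R p γ} : Finset α).card +
            ({γ ∈ A | R q γ} : Finset β).card := by
        rw [Finset.card_filter (fun γ ↦ R q γ) A, ← Finset.sum_add_distrib]
        refine Finset.sum_congr rfl fun γ _ ↦ ?_
        rw [Finset.card_filter, Finset.card_filter, Finset.sum_erase_add _ _ hq]
      have hstep' : (∑ γ ∈ A, ({p ∈ P | R p γ} : Finset α).card : ℝ) =
          ∑ γ ∈ A, (({p ∈ P.erase q | R p γ} : Finset α).card : ℝ) +
            ({γ ∈ A | R q γ} : Finset β).card := by exact_mod_cast hstep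
      rw [hstep']
      rw [Finset.card_erase_of_mem hq, Nat.cast_sub hP1, Nat.cast_one] at hih
      have hsc := scale_le hs hr
      change _ ≤ (P.card : ℝ) ^ b * (A.card : ℝ) ^ e at hsc
      have hqd' : (({γ ∈ A | R q γ} : Finset β).card : ℝ) * P.card ≤
          E * A.card * r + P.card := by exact_mod_cast hqd
      have hber := rpow_sub_one_add_le hb0 hb1 hP1'
      set x : ℝ := (P.card : ℝ)
      set y : ℝ := (A.card : ℝ) ^ e
      have hy : 0 ≤ y := by positivity
      have hx0 : 0 < x := by linarith
      have hd1 : (({γ ∈ A | R q γ} : Finset β).card : ℝ) ≤ 2 * E * (x ^ b / (2 * x)) * y + 1 := by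
        rw [← mul_le_mul_iff_left₀ hx0]
        refine hqd'.trans ?_
        have : (2 * E * (x ^ b / (2 * x)) * y + 1) * x = E * (x ^ b * y) + x := by field_simp
        rw [this, mul_assoc]
        gcongr
      have hd2 : 2 * E * (x ^ b / (2 * x)) * y ≤ D * (x ^ b / (2 * x)) * y := by gcongr
      have hd3 : ((x - 1) ^ b + x ^ b / (2 * x)) * y ≤ x ^ b * y := by gcongr
      have hd4 := mul_le_mul_of_nonneg_left hd3 (by linarith : 0 ≤ D)
      linarith

end

end Incidence

namespace Polynomial

/-- A normalized irreducible bivariate polynomial of degree at most `k` in each variable which does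
depend on the second variable. -/
structure IsCurve (k : ℕ) (g : ℝ[X][X]) : Prop where
  irreducible : Irreducible g
  natDegree_pos : 0 < g.natDegree
  natDegree_le : g.natDegree ≤ k
  natDegree_coeff_le : ∀ i, (g.coeff i).natDegree ≤ k
  normalize_eq : normalize g = g

theorem IsCurve.not_dvd {k : ℕ} {g h : ℝ[X][X]} (hg : IsCurve k g) (hh : IsCurve k h)
    (hne : g ≠ h) : ¬ g ∣ h := fun H ↦
  hne (by
    rw [← hg.normalize_eq, ← hh.normalize_eq]
    exact normalize_eq_normalize H (hg.irreducible.dvd_symm hh.irreducible H))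

/-- Between two consecutive exceptional abscissae, the real zeros of two curves move continuously
without meeting. -/
theorem exists_exceptional {k : ℕ} {g h : ℝ[X][X]} (hg : IsCurve k g) (hh : IsCurve k h) :
    ∃ E : Finset ℝ, E.card ≤ 2 * k + 6 * k * k ∧ ∀ x x', x ≤ x' →
      (∀ e ∈ E, e ∉ Set.Icc x x') → ∀ i j : ℕ,
      (i < (g.fibreZeros x).card ↔ i < (g.fibreZeros x').card) ∧
      (j < (h.fibreZeros x).card ↔ j < (h.fibreZeros x').card) ∧
      ((g, i) ≠ (h, j) → i < (g.fibreZeros x).card → j < (h.fibreZeros x).card →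
        g.nthZero i x ≠ h.nthZero j x ∧ g.nthZero i x' ≠ h.nthZero j x' ∧
        (g.nthZero i x < h.nthZero j x ↔ g.nthZero i x' < h.nthZero j x')) := by
  obtain ⟨E₁, hE₁, h₁⟩ := exists_finset_singular_fibres hg.irreducible hg.natDegree_pos
    hg.natDegree_le hg.natDegree_coeff_le
  obtain ⟨E₂, hE₂, h₂⟩ := exists_finset_singular_fibres hh.irreducible hh.natDegree_pos
    hh.natDegree_le hh.natDegree_coeff_le
  obtain ⟨E₃, hE₃, h₃⟩ : ∃ E : Finset ℝ, E.card ≤ 2 * k * k ∧ (g ≠ h →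
      ∀ x y, evalEval x y g = 0 → evalEval x y h = 0 → x ∈ E) := by
    by_cases hne : g = h
    · exact ⟨∅, by simp, fun H ↦ absurd hne H⟩
    · obtain ⟨E, hE, h⟩ := exists_finset_common_zeros hg.irreducible hg.natDegree_pos
        (hg.not_dvd hh hne) hg.natDegree_le hh.natDegree_le hg.natDegree_coeff_le
        hh.natDegree_coeff_le
      exact ⟨E, hE, fun _ ↦ h⟩
  refine ⟨E₁ ∪ E₂ ∪ E₃, ?_, fun x x' hx hE i j ↦ ?_⟩
  · have := Finset.card_union_le (E₁ ∪ E₂) E₃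
    have := Finset.card_union_le E₁ E₂
    linarith
  have hr₁ : ∀ w ∈ Set.Icc x x', _ := fun w hw ↦ h₁ w fun hc ↦ hE w (by simp [hc]) hw
  have hr₂ : ∀ w ∈ Set.Icc x x', _ := fun w hw ↦ h₂ w fun hc ↦ hE w (by simp [hc]) hw
  have hr₃ : g ≠ h → ∀ w ∈ Set.Icc x x', ∀ y, evalEval w y g = 0 → evalEval w y h ≠ 0 :=
    fun hne w hw y hy hy' ↦ hE w (by simp [h₃ hne w y hy hy']) hw
  have hc₁ := fun w (hw : w ∈ Set.Icc x x') ↦ card_fibreZeros_eq hx hr₁ hw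
  have hc₂ := fun w (hw : w ∈ Set.Icc x x') ↦ card_fibreZeros_eq hx hr₂ hw
  have hx' := Set.right_mem_Icc.2 hx
  refine ⟨by rw [hc₁ x' hx'], by rw [hc₂ x' hx'], fun hne hi hj ↦ ?_⟩
  have key : ∀ w ∈ Set.Icc x x', g.nthZero i w ≠ h.nthZero j w := by
    intro w hw heq
    have hi' : i < (g.fibreZeros w).card := by rwa [hc₁ w hw]
    have hj' : j < (h.fibreZeros w).card := by rwa [hc₂ w hw]
    by_cases hgh : g = h
    · subst hgh
      have hij : i ≠ j := fun H ↦ hne (by rw [H])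
      rcases hij.lt_or_gt with H | H
      · exact (nthZero_lt H hj').ne heq
      · exact (nthZero_lt H hi').ne' heq
    · have hzg := (mem_fibreZeros (map_evalRingHom_ne_zero (hr₁ w hw).1)).1 (nthZero_mem hi')
      have hzh := (mem_fibreZeros (map_evalRingHom_ne_zero (hr₂ w hw).1)).1 (nthZero_mem hj')
      rw [heq] at hzg
      exact hr₃ hgh w hw _ hzg hzh
  exact ⟨key x (Set.left_mem_Icc.2 hx), key x' hx', lt_iff_lt_of_continuousOn_Icc hx
    (continuousOn_nthZero hx hr₁ hi) (continuousOn_nthZero hx hr₂ hj) key⟩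

/-- The arcs of all curves of degree at most `k`: the arc `(g, j)` is the `j`-th real zero of `g`,
as a function of the first coordinate. -/
noncomputable def curveArcs (k : ℕ) :
    ArcSystem (Bool ⊕ {g : ℝ[X][X] // IsCurve k g} × ℕ) (2 * k + 6 * k * k) where
  dom := Sum.elim (fun _ ↦ Set.univ) fun a ↦ {x | a.2 < (a.1.1.fibreZeros x).card}
  val := Sum.elim (fun b _ ↦ if b then ⊤ else ⊥) fun a x ↦ (a.1.1.nthZero a.2 x : EReal)
  event
    | .inl _, .inl _ => ∅
    | .inl _, .inr b => (exists_exceptional b.1.2 b.1.2).choose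
    | .inr a, .inl _ => (exists_exceptional a.1.2 a.1.2).choose
    | .inr a, .inr b => (exists_exceptional a.1.2 b.1.2).choose
  top := .inl true
  bot := .inl false
  card_event_le
    | .inl _, .inl _ => by simp
    | .inl _, .inr b => (exists_exceptional b.1.2 b.1.2).choose_spec.1
    | .inr a, .inl _ => (exists_exceptional a.1.2 a.1.2).choose_spec.1
    | .inr a, .inr b => (exists_exceptional a.1.2 b.1.2).choose_spec.1
  top_dom _ := Set.mem_univ _
  bot_dom _ := Set.mem_univ _
  val_top _ := by simp
  val_bot _ := by simp
  stable
    | .inl a, .inl b, hab, x, x', _, _ => by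
      cases a <;> cases b <;> simp at hab ⊢
    | .inl a, .inr b, _, x, x', hx, hE => by
      have h := ((exists_exceptional b.1.2 b.1.2).choose_spec.2 x x' hx hE b.2 b.2).1
      refine ⟨by simp, h, fun _ _ ↦ ?_⟩
      cases a <;> simp
    | .inr a, .inl b, _, x, x', hx, hE => by
      have h := ((exists_exceptional a.1.2 a.1.2).choose_spec.2 x x' hx hE a.2 a.2).1
      refine ⟨h, by simp, fun _ _ ↦ ?_⟩
      cases b <;> simp
    | .inr a, .inr b, hab, x, x', hx, hE => by
      obtain ⟨h1, h2, h3⟩ := (exists_exceptional a.1.2 b.1.2).choose_spec.2 x x' hx hE a.2 b.2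
      refine ⟨h1, h2, fun hi hj ↦ ?_⟩
      have hne : (a.1.1, a.2) ≠ (b.1.1, b.2) := fun H ↦ hab (congrArg Sum.inr (Prod.ext
        (Subtype.ext (Prod.mk.inj H).1) (Prod.mk.inj H).2))
      simpa using h3 hne hi hj

theorem map_evalRingHom_ne_zero_of_irreducible {g : ℝ[X][X]} (hg : Irreducible g)
    (hd : 0 < g.natDegree) (x : ℝ) : g.map (evalRingHom x) ≠ 0 := by
  intro H
  have hdvd : (C (X - C x) : ℝ[X][X]) ∣ g := by
    rw [C_dvd_iff_dvd_coeff]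
    intro i
    rw [dvd_iff_isRoot]
    simpa using congrArg (fun p ↦ p.coeff i) H
  exact not_isUnit_X_sub_C x (hg.isPrimitive hd.ne' _ hdvd)

theorem exists_arc {k : ℕ} {g : ℝ[X][X]} (hg : IsCurve k g) {p : ℝ × ℝ}
    (hp : evalEval p.1 p.2 g = 0) :
    ∃ j < k, (curveArcs k).On p (.inr (⟨g, hg⟩, j)) := by
  have h0 := map_evalRingHom_ne_zero_of_irreducible hg.irreducible hg.natDegree_pos p.1
  obtain ⟨j, hj, h⟩ := exists_nthZero_eq ((mem_fibreZeros h0).2 hp)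
  refine ⟨j, hj.trans_le ?_, hj, congrArg Real.toEReal h⟩
  refine (Multiset.toFinset_card_le _).trans ((card_roots' _).trans ?_)
  exact (natDegree_map_le).trans hg.natDegree_le

theorem evalEval_eq_zero_of_on {k : ℕ} {a : {g : ℝ[X][X] // IsCurve k g} × ℕ} {p : ℝ × ℝ}
    (h : (curveArcs k).On p (.inr a)) : evalEval p.1 p.2 a.1.1 = 0 := by
  have h0 := map_evalRingHom_ne_zero_of_irreducible a.1.2.irreducible a.1.2.natDegree_pos p.1
  have := (mem_fibreZeros h0).1 (nthZero_mem h.1)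
  rwa [EReal.coe_injective h.2] at this

theorem hasClusters_curveArcs (k : ℕ) (A : Finset (Bool ⊕ {g : ℝ[X][X] // IsCurve k g} × ℕ)) :
    Incidence.HasClusters (curveArcs k).On A (2 * (72 * (2 * k + 6 * k * k + 1))) := by
  classical
  let : LinearOrder (Bool ⊕ {g : ℝ[X][X] // IsCurve k g} × ℕ) := linearOrderOfSTO WellOrderingRel
  intro P r n hr hrA h
  refine (curveArcs k).exists_cluster A P hr hrA (lt_of_eq_of_lt ?_ h)
  ring

end Polynomial

namespace Polynomial

open scoped Classical in
/-- The incidence bound for irreducible curves which are not vertical lines. -/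
theorem sum_card_incidences_le {s : ℕ} (k t : ℕ) (hk : 1 ≤ k) (hs : 2 ≤ s) :
    ∃ D : ℝ, 0 < D ∧ ∀ (P : Finset (ℝ × ℝ)) (G : Finset ℝ[X][X]), (∀ g ∈ G, IsCurve k g) →
      (∀ T ⊆ P, T.card = s →
        ({g ∈ G | ∀ p ∈ T, evalEval p.1 p.2 g = 0} : Finset ℝ[X][X]).card ≤ t) →
      (∑ g ∈ G, ({p ∈ P | evalEval p.1 p.2 g = 0} : Finset (ℝ × ℝ)).card : ℝ) ≤
        D * ((P.card : ℝ) ^ ((s : ℝ) / (2 * s - 1)) *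
          (G.card : ℝ) ^ ((2 * (s : ℝ) - 2) / (2 * s - 1)) + P.card + G.card) := by
  obtain ⟨D, hD, h⟩ := Incidence.sum_card_le_of_hasClusters (s := s) (t := k * t)
    (a := 2 * (72 * (2 * k + 6 * k * k + 1))) hs (by omega)
  refine ⟨D * k, by positivity, fun P G hG hfree ↦ ?_⟩
  let G' : Finset {g : ℝ[X][X] // IsCurve k g} := G.subtype (IsCurve k)
  have hcard' : G'.card = G.card := by
    rw [Finset.card_subtype, Finset.filter_true_of_mem hG]
  let A : Finset (Bool ⊕ {g : ℝ[X][X] // IsCurve k g} × ℕ) :=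
    (G' ×ˢ Finset.range k).map Function.Embedding.inr
  have hA : A.card = k * G.card := by
    rw [Finset.card_map, Finset.card_product, Finset.card_range, hcard', mul_comm]
  have h1 := h (hasClusters_curveArcs k A) P fun T hT hTs ↦ by
    refine le_trans (Finset.card_le_card_of_injOn
      (t := Finset.range k ×ˢ ({g ∈ G | ∀ p ∈ T, evalEval p.1 p.2 g = 0} : Finset ℝ[X][X]))
      (Sum.elim (fun _ ↦ (0, 0)) fun a ↦ (a.2, a.1.1)) ?_ ?_)
      (by rw [Finset.card_product, Finset.card_range]
          exact Nat.mul_le_mul_left _ (hfree T hT hTs))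
    · intro a ha
      simp only [A, Finset.coe_filter, Finset.mem_map, Set.mem_ofPred_eq] at ha
      obtain ⟨⟨⟨g, j⟩, hgj, rfl⟩, hon⟩ := ha
      rw [Finset.mem_product, Finset.mem_subtype] at hgj
      simp only [Function.Embedding.inr_apply, Sum.elim_inr, Finset.mem_coe, Finset.mem_product,
        Finset.mem_filter]
      exact ⟨hgj.2, hgj.1, fun p hp ↦ evalEval_eq_zero_of_on (hon p hp)⟩
    · intro a ha b hb hab
      simp only [A, Finset.coe_filter, Finset.mem_map, Set.mem_ofPred_eq] at ha hb
      obtain ⟨⟨a, -, rfl⟩, -⟩ := ha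
      obtain ⟨⟨b, -, rfl⟩, -⟩ := hb
      simp only [Function.Embedding.inr_apply, Sum.elim_inr, Prod.mk.injEq] at hab ⊢
      exact congrArg Sum.inr (Prod.ext (Subtype.ext hab.2) hab.1)
  have h2 : ∑ g ∈ G, ({p ∈ P | evalEval p.1 p.2 g = 0} : Finset (ℝ × ℝ)).card ≤
      ∑ a ∈ A, ({p ∈ P | (curveArcs k).On p a} : Finset (ℝ × ℝ)).card := by
    rw [Finset.sum_map, Finset.sum_product,
      ← Finset.sum_subtype_of_mem _ (p := IsCurve k) hG]
    refine Finset.sum_le_sum fun g _ ↦ ?_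
    refine (Finset.card_le_card fun p hp ↦ ?_).trans Finset.card_biUnion_le
    obtain ⟨hp, h0⟩ := Finset.mem_filter.1 hp
    obtain ⟨j, hj, hon⟩ := exists_arc g.2 h0
    exact Finset.mem_biUnion.2 ⟨j, Finset.mem_range.2 hj, Finset.mem_filter.2 ⟨hp, hon⟩⟩
  have h3 : (∑ g ∈ G, ({p ∈ P | evalEval p.1 p.2 g = 0} : Finset (ℝ × ℝ)).card : ℝ) ≤
      ∑ a ∈ A, (({p ∈ P | (curveArcs k).On p a} : Finset (ℝ × ℝ)).card : ℝ) := by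
    exact_mod_cast h2
  refine h3.trans (h1.trans ?_)
  rw [hA, mul_assoc D]
  gcongr
  have hs' : (2 : ℝ) ≤ s := by exact_mod_cast hs
  have hd : (0 : ℝ) < 2 * s - 1 := by linarith
  have hk' : (1 : ℝ) ≤ k := by exact_mod_cast hk
  set e : ℝ := (2 * (s : ℝ) - 2) / (2 * s - 1)
  have he : e ≤ 1 := by rw [div_le_one hd]; linarith
  have hke : (k : ℝ) ^ e ≤ k := by
    simpa using Real.rpow_le_rpow_of_exponent_le hk' he
  push_cast
  rw [Real.mul_rpow (by positivity) (by positivity)]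
  have h4 : (P.card : ℝ) ^ ((s : ℝ) / (2 * s - 1)) * ((k : ℝ) ^ e * (G.card : ℝ) ^ e) ≤
      k * ((P.card : ℝ) ^ ((s : ℝ) / (2 * s - 1)) * (G.card : ℝ) ^ e) := by
    rw [mul_left_comm]
    gcongr
  have h5 : (P.card : ℝ) ≤ k * P.card := le_mul_of_one_le_left (by positivity) hk'
  linarith

/-- The bivariate polynomials of degree at most `k` in each variable. -/
def BidegreeLE (k : ℕ) (F : ℝ[X][X]) : Prop :=
  F.natDegree ≤ k ∧ (Bivariate.swap F).natDegree ≤ k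

theorem BidegreeLE.of_dvd {k : ℕ} {F g : ℝ[X][X]} (hF : BidegreeLE k F) (h0 : F ≠ 0) (h : g ∣ F) :
    BidegreeLE k g :=
  ⟨(natDegree_le_of_dvd h h0).trans hF.1, (natDegree_le_of_dvd (_root_.map_dvd Bivariate.swap h)
    ((map_ne_zero_iff _ (Bivariate.swap (R := ℝ)).injective).2 h0)).trans hF.2⟩

theorem one_le_natDegree_add_natDegree_swap {g : ℝ[X][X]} (hg : Irreducible g) :
    1 ≤ g.natDegree + (Bivariate.swap g).natDegree := by
  by_contra! H
  obtain ⟨h1, h2⟩ : g.natDegree = 0 ∧ (Bivariate.swap g).natDegree = 0 := by omega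
  have h3 := Bivariate.natDegree_swap_le_iff.1 h2.le 0
  rw [eq_C_of_natDegree_eq_zero h1, eq_C_of_natDegree_le_zero h3] at hg
  refine hg.not_isUnit ?_
  rw [isUnit_C, isUnit_C, isUnit_iff_ne_zero]
  intro h
  rw [h, C_0, C_0] at hg
  exact hg.ne_zero rfl

theorem card_le_natDegree_prod (S : Multiset ℝ[X][X]) (hS : ∀ g ∈ S, Irreducible g) :
    S.card ≤ S.prod.natDegree + (Bivariate.swap S.prod).natDegree := by
  induction S using Multiset.induction with
  | empty => simp
  | cons g S ih =>
    have hg := hS g (Multiset.mem_cons_self _ _)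
    have hS' := fun h hh ↦ hS h (Multiset.mem_cons_of_mem hh)
    have h0 : S.prod ≠ 0 := Multiset.prod_ne_zero fun h ↦ (hS' 0 h).ne_zero rfl
    have hi := (Bivariate.swap (R := ℝ)).injective
    rw [Multiset.card_cons, Multiset.prod_cons, map_mul, natDegree_mul hg.ne_zero h0,
      natDegree_mul ((map_ne_zero_iff _ hi).2 hg.ne_zero) ((map_ne_zero_iff _ hi).2 h0)]
    have := one_le_natDegree_add_natDegree_swap hg
    have := ih hS'
    omega

open UniqueFactorizationMonoid in
open scoped Classical in
/-- The irreducible components of a curve. -/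
theorem exists_components {k : ℕ} {F : ℝ[X][X]} (h0 : F ≠ 0) (hF : BidegreeLE k F) :
    ∃ Φ : Finset ℝ[X][X], Φ.card ≤ 2 * k ∧
      (∀ g ∈ Φ, Irreducible g ∧ normalize g = g ∧ BidegreeLE k g) ∧
      ∀ x y, evalEval x y F = 0 ↔ ∃ g ∈ Φ, evalEval x y g = 0 := by
  refine ⟨(normalizedFactors F).toFinset, ?_, fun g hg ↦ ?_, fun x y ↦ ?_⟩
  · have hd : (normalizedFactors F).prod ∣ F := (prod_normalizedFactors h0).dvd
    have h1 := card_le_natDegree_prod (normalizedFactors F)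
      fun g hg ↦ irreducible_of_normalized_factor g hg
    have h2 := hF.of_dvd h0 hd
    have h3 := Multiset.toFinset_card_le (normalizedFactors F)
    have := h2.1
    have := h2.2
    omega
  · rw [Multiset.mem_toFinset] at hg
    exact ⟨irreducible_of_normalized_factor g hg, normalize_normalized_factor g hg,
      hF.of_dvd h0 (dvd_of_mem_normalizedFactors hg)⟩
  · have h1 := ((prod_normalizedFactors h0).map (evalEvalRingHom x y)).eq_zero_iff
    rw [map_multiset_prod, Multiset.prod_eq_zero_iff] at h1
    simp only [Multiset.mem_map, coe_evalEvalRingHom] at h1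
    simp only [Multiset.mem_toFinset]
    exact h1.symm

theorem eq_of_natDegree_eq_zero {g : ℝ[X][X]} {x y : ℝ} (hg : Irreducible g)
    (hd : g.natDegree = 0) (hn : normalize g = g) (h : evalEval x y g = 0) :
    g = normalize (C (X - C x)) := by
  obtain ⟨a, rfl⟩ := natDegree_eq_zero.1 hd
  have h1 : C (X - C x) ∣ C a := by
    refine _root_.map_dvd C (dvd_iff_isRoot.2 ?_)
    simpa [evalEval] using h
  have h2 : Irreducible (C (X - C x) : ℝ[X][X]) :=
    (prime_C_iff.2 (prime_X_sub_C x)).irreducible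
  rw [← hn]
  exact normalize_eq_normalize (h2.dvd_symm hg h1) h1

theorem exists_bivariate {k : ℕ} {f : MvPolynomial (Fin 2) ℝ} (h0 : f ≠ 0)
    (hf : f.totalDegree ≤ k) : ∃ F : ℝ[X][X], F ≠ 0 ∧ Polynomial.BidegreeLE k F ∧
      ∀ x y, F.evalEval x y = MvPolynomial.eval ![x, y] f := by
  have hdeg : ∀ u : Fin 2 → ℝ[X][X], ∀ i, (∀ j, (u j).natDegree ≤ if j = i then 1 else 0) →
      (MvPolynomial.aeval u f).natDegree ≤ k := by
    intro u i hu
    rw [MvPolynomial.aeval_def, MvPolynomial.eval₂_eq']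
    refine natDegree_sum_le_of_forall_le _ _ fun d hd ↦ ?_
    have hc : (algebraMap ℝ ℝ[X][X] (MvPolynomial.coeff d f)).natDegree = 0 := by
      rw [algebraMap_apply, natDegree_C]
    refine natDegree_mul_le.trans ?_
    rw [hc, zero_add]
    calc (∏ j, u j ^ d j).natDegree ≤ ∑ j, (u j ^ d j).natDegree := natDegree_prod_le _ _
      _ ≤ ∑ j, d j * (if j = i then 1 else 0) := Finset.sum_le_sum fun j _ ↦
          natDegree_pow_le.trans (Nat.mul_le_mul_left _ (hu j))
      _ = d i := by simp
      _ ≤ d.sum fun _ e ↦ e := by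
          rw [Finsupp.sum_fintype _ _ fun _ ↦ rfl]
          exact Finset.single_le_sum (fun _ _ ↦ Nat.zero_le _) (Finset.mem_univ i)
      _ ≤ k := (MvPolynomial.le_totalDegree hd).trans hf
  refine ⟨(Bivariate.equivMvPolynomial ℝ).symm f, ?_, ⟨?_, ?_⟩, fun x y ↦ ?_⟩
  · exact (map_ne_zero_iff _ (Bivariate.equivMvPolynomial ℝ).symm.injective).2 h0
  · refine hdeg ![C X, X] 1 fun j ↦ ?_
    fin_cases j <;> simp
  · have : Bivariate.swap ((Bivariate.equivMvPolynomial ℝ).symm f) =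
        MvPolynomial.aeval (![X, C X] : Fin 2 → ℝ[X][X]) f := by
      have : ((Bivariate.swap (R := ℝ) : ℝ[X][X] →ₐ[ℝ] ℝ[X][X]).comp
          ((Bivariate.equivMvPolynomial ℝ).symm : MvPolynomial (Fin 2) ℝ →ₐ[ℝ] ℝ[X][X])) =
          MvPolynomial.aeval (![X, C X] : Fin 2 → ℝ[X][X]) :=
        MvPolynomial.algHom_ext fun i ↦ by
          fin_cases i <;> simp [Bivariate.swap_X, Bivariate.swap_Y]
      exact DFunLike.congr_fun this f
    rw [this]
    refine hdeg ![X, C X] 0 fun j ↦ ?_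
    fin_cases j <;> simp
  · change ((evalEvalRingHom x y).comp
      ((Bivariate.equivMvPolynomial ℝ).symm : MvPolynomial (Fin 2) ℝ →+* ℝ[X][X])) f = _
    congr 1
    refine MvPolynomial.ringHom_ext (fun r ↦ by simp) fun i ↦ ?_
    fin_cases i <;> simp

end Polynomial

open scoped Classical in
/-- Reduction of an incidence count for unions of components to a count for the components. -/
theorem Incidence.sum_card_le_of_components {α ι κ : Type*} [DecidableEq κ] {s t c : ℕ}
    {P : Finset α} {Γ : Finset ι} {Φ : ι → Finset κ} {Z : α → κ → Prop} {V : κ → Prop}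
    [DecidablePred V]
    (hΦ : ∀ γ ∈ Γ, (Φ γ).card ≤ c)
    (hfree : ∀ S ⊆ P, S.card = s → ({γ ∈ Γ | ∀ p ∈ S, ∃ g ∈ Φ γ, Z p g} : Finset ι).card < t)
    (hV : ∀ p, ∀ g ∈ Γ.biUnion Φ, ∀ g' ∈ Γ.biUnion Φ, V g → V g' → Z p g → Z p g' → g = g') :
    ∑ γ ∈ Γ, ({p ∈ P | ∃ g ∈ Φ γ, Z p g} : Finset α).card ≤
      c * s * Γ.card +
        t * (P.card + ∑ g ∈ Γ.biUnion Φ with ¬ V g, ({p ∈ P | Z p g} : Finset α).card) := by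
  let w : κ → ℕ := fun g ↦ ({p ∈ P | Z p g} : Finset α).card
  let M : κ → Finset ι := fun g ↦ {γ ∈ Γ | g ∈ Φ γ}
  have hw : ∀ g, w g ≤ s + if (M g).card < t then w g else 0 := by
    intro g
    split_ifs with h
    · exact Nat.le_add_left _ _
    · by_contra! hs
      obtain ⟨S, hS, hSs⟩ := Finset.exists_subset_card_eq (show s ≤ w g by omega)
      refine h (lt_of_le_of_lt (Finset.card_le_card fun γ hγ ↦ ?_)
        (hfree S (hS.trans (Finset.filter_subset _ _)) hSs))
      obtain ⟨h1, h2⟩ := Finset.mem_filter.1 hγ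
      exact Finset.mem_filter.2 ⟨h1, fun p hp ↦ ⟨g, h2, (Finset.mem_filter.1 (hS hp)).2⟩⟩
  have h1 : ∀ γ ∈ Γ, ({p ∈ P | ∃ g ∈ Φ γ, Z p g} : Finset α).card ≤
      c * s + ∑ g ∈ Φ γ, if (M g).card < t then w g else 0 := by
    intro γ hγ
    calc ({p ∈ P | ∃ g ∈ Φ γ, Z p g} : Finset α).card
        ≤ ((Φ γ).biUnion fun g ↦ {p ∈ P | Z p g}).card := by
          refine Finset.card_le_card fun p hp ↦ ?_
          obtain ⟨hp, g, hg, h⟩ := Finset.mem_filter.1 hp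
          exact Finset.mem_biUnion.2 ⟨g, hg, Finset.mem_filter.2 ⟨hp, h⟩⟩
      _ ≤ ∑ g ∈ Φ γ, w g := Finset.card_biUnion_le
      _ ≤ ∑ g ∈ Φ γ, (s + if (M g).card < t then w g else 0) := Finset.sum_le_sum fun g _ ↦ hw g
      _ ≤ _ := by
          rw [Finset.sum_add_distrib, Finset.sum_const, smul_eq_mul]
          gcongr
          exact hΦ γ hγ
  have h2 : ∑ γ ∈ Γ, ∑ g ∈ Φ γ, (if (M g).card < t then w g else 0) ≤
      t * ∑ g ∈ Γ.biUnion Φ, w g := by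
    rw [Finset.sum_comm' (t' := Γ.biUnion Φ) (s' := M) (by
      intro γ g
      simp only [M, Finset.mem_filter, Finset.mem_biUnion]
      grind), Finset.mul_sum]
    refine Finset.sum_le_sum fun g _ ↦ ?_
    rw [Finset.sum_const, smul_eq_mul]
    split_ifs with h
    · exact Nat.mul_le_mul_right _ h.le
    · simp
  have h3 : ∑ g ∈ Γ.biUnion Φ with V g, w g ≤ P.card := by
    have := Finset.sum_card_bipartiteAbove_eq_sum_card_bipartiteBelow
      (s := P) (t := ({g ∈ Γ.biUnion Φ | V g} : Finset κ)) Z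
    refine this.symm.le.trans ?_
    rw [Finset.card_eq_sum_ones]
    refine Finset.sum_le_sum fun p _ ↦ Finset.card_le_one.2 fun g hg g' hg' ↦ ?_
    simp only [Finset.mem_bipartiteAbove, Finset.mem_filter] at hg hg'
    exact hV p g hg.1.1 g' hg'.1.1 hg.1.2 hg'.1.2 hg.2 hg'.2
  have h4 := Finset.sum_filter_add_sum_filter_not (Γ.biUnion Φ) V w
  calc _ ≤ ∑ γ ∈ Γ, (c * s + ∑ g ∈ Φ γ, if (M g).card < t then w g else 0) :=
        Finset.sum_le_sum h1
    _ ≤ c * s * Γ.card + t * ∑ g ∈ Γ.biUnion Φ, w g := by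
        rw [Finset.sum_add_distrib, Finset.sum_const, smul_eq_mul, mul_comm Γ.card]
        gcongr
    _ ≤ _ := by
        rw [← h4]
        gcongr

/-- The Pach–Sharir incidence bound for points and algebraic curves of degree at most `k`
in the plane, assuming the incidence graph contains no `K_{s,t}`. -/
theorem pach_sharir_incidences (k s t : ℕ) (hk : 1 ≤ k) (hs : 2 ≤ s) (ht : 2 ≤ t) :
    ∃ C : ℝ, 0 < C ∧
      ∀ (P : Finset (ℝ × ℝ)) (Γ : Finset (Set (ℝ × ℝ))) (m n : ℕ),
        P.card = m → Γ.card = n →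
        (∀ γ ∈ Γ, ∃ f : MvPolynomial (Fin 2) ℝ, f ≠ 0 ∧ f.totalDegree ≤ k ∧
            γ = {p : ℝ × ℝ | MvPolynomial.eval ![p.1, p.2] f = 0}) →
        (¬ ∃ (S : Finset (ℝ × ℝ)) (T : Finset (Set (ℝ × ℝ))),
            S ⊆ P ∧ T ⊆ Γ ∧ S.card = s ∧ T.card = t ∧ ∀ p ∈ S, ∀ γ ∈ T, p ∈ γ) →
        (Set.ncard {x : (ℝ × ℝ) × Set (ℝ × ℝ) | x.1 ∈ P ∧ x.2 ∈ Γ ∧ x.1 ∈ x.2} : ℝ) ≤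
          C * ((m : ℝ) ^ ((s : ℝ) / (2 * (s : ℝ) - 1)) *
                (n : ℝ) ^ ((2 * (s : ℝ) - 2) / (2 * (s : ℝ) - 1)) + (m : ℝ) + (n : ℝ)) := by

  classical
  obtain ⟨D, hD, hbound⟩ := Polynomial.sum_card_incidences_le (s := s) k (t * (2 * k)) hk hs
  refine ⟨2 * k * s + t * (1 + D * (2 * k)), by positivity, fun P Γ m n hm hn hΓ hfree ↦ ?_⟩
  have hcomp : ∀ γ ∈ Γ, ∃ Φ : Finset ℝ[X][X], Φ.card ≤ 2 * k ∧
      (∀ g ∈ Φ, Irreducible g ∧ normalize g = g ∧ Polynomial.BidegreeLE k g) ∧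
      ∀ p : ℝ × ℝ, p ∈ γ ↔ ∃ g ∈ Φ, evalEval p.1 p.2 g = 0 := by
    intro γ hγ
    obtain ⟨f, h0, hf, rfl⟩ := hΓ γ hγ
    obtain ⟨F, hF0, hF, hFf⟩ := Polynomial.exists_bivariate h0 hf
    obtain ⟨Φ, h1, h2, h3⟩ := Polynomial.exists_components hF0 hF
    exact ⟨Φ, h1, h2, fun p ↦ by rw [Set.mem_ofPred_eq, ← hFf, h3]⟩
  choose! Φ hΦ1 hΦ2 hΦ3 using hcomp
  have hfree' : ∀ S ⊆ P, S.card = s → ({γ ∈ Γ | ∀ p ∈ S, ∃ g ∈ Φ γ, evalEval p.1 p.2 g = 0} :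
      Finset (Set (ℝ × ℝ))).card < t := by
    intro S hS hSs
    by_contra! ht
    obtain ⟨T, hT, hTt⟩ := Finset.exists_subset_card_eq ht
    refine hfree ⟨S, T, hS, hT.trans (Finset.filter_subset _ _), hSs, hTt, fun p hp γ hγ ↦ ?_⟩
    obtain ⟨h1, h2⟩ := Finset.mem_filter.1 (hT hγ)
    exact (hΦ3 γ h1 p).2 (h2 p hp)
  have hmem : ∀ g ∈ Γ.biUnion Φ, Irreducible g ∧ normalize g = g ∧ Polynomial.BidegreeLE k g := by
    intro g hg
    obtain ⟨γ, hγ, hg⟩ := Finset.mem_biUnion.1 hg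
    exact hΦ2 γ hγ g hg
  have hred := Incidence.sum_card_le_of_components (P := P)
    (Z := fun p g ↦ evalEval p.1 p.2 g = 0) (V := fun g ↦ g.natDegree = 0) hΦ1 hfree'
    fun p g hg g' hg' hd hd' h h' ↦ by
      rw [Polynomial.eq_of_natDegree_eq_zero (hmem g hg).1 hd (hmem g hg).2.1 h,
        Polynomial.eq_of_natDegree_eq_zero (hmem g' hg').1 hd' (hmem g' hg').2.1 h']
  set G : Finset ℝ[X][X] := {g ∈ Γ.biUnion Φ | ¬ g.natDegree = 0}
  have hGcard : G.card ≤ n * (2 * k) := by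
    rw [← hn]
    exact (Finset.card_filter_le _ _).trans (Finset.card_biUnion_le_card_mul _ _ _ hΦ1)
  have hcurves := hbound P G (fun g hg ↦ by
    obtain ⟨hg, hd⟩ := Finset.mem_filter.1 hg
    obtain ⟨h1, h2, h3⟩ := hmem g hg
    exact ⟨h1, Nat.pos_of_ne_zero hd, h3.1, Polynomial.Bivariate.natDegree_swap_le_iff.1 h3.2, h2⟩)
    fun T hT hTs ↦ by
      refine le_trans (Finset.card_le_card fun g hg ↦ ?_) ((Finset.card_biUnion_le_card_mul
        {γ ∈ Γ | ∀ p ∈ T, ∃ g ∈ Φ γ, evalEval p.1 p.2 g = 0} Φ (2 * k)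
        fun γ hγ ↦ hΦ1 γ (Finset.mem_filter.1 hγ).1).trans
          (Nat.mul_le_mul_right _ (hfree' T hT hTs).le))
      obtain ⟨hg, hgT⟩ := Finset.mem_filter.1 hg
      obtain ⟨γ, hγ, hgγ⟩ := Finset.mem_biUnion.1 (Finset.mem_filter.1 hg).1
      exact Finset.mem_biUnion.2
        ⟨γ, Finset.mem_filter.2 ⟨hγ, fun p hp ↦ ⟨g, hgγ, hgT p hp⟩⟩, hgγ⟩
  have hncard : Set.ncard {x : (ℝ × ℝ) × Set (ℝ × ℝ) | x.1 ∈ P ∧ x.2 ∈ Γ ∧ x.1 ∈ x.2} =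
      ∑ γ ∈ Γ, ({p ∈ P | ∃ g ∈ Φ γ, evalEval p.1 p.2 g = 0} : Finset (ℝ × ℝ)).card := by
    have : {x : (ℝ × ℝ) × Set (ℝ × ℝ) | x.1 ∈ P ∧ x.2 ∈ Γ ∧ x.1 ∈ x.2} =
        (({x ∈ P ×ˢ Γ | x.1 ∈ x.2} : Finset _) : Set ((ℝ × ℝ) × Set (ℝ × ℝ))) := by
      ext x
      simp [and_assoc]
    rw [this, Set.ncard_coe_finset, Finset.card_filter, Finset.sum_product_right]
    refine Finset.sum_congr rfl fun γ hγ ↦ ?_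
    rw [← Finset.card_filter]
    congr 1
    exact Finset.filter_congr fun p _ ↦ hΦ3 γ hγ p
  rw [hncard]
  rw [hm, hn] at hred
  rw [hm] at hcurves
  have hs' : (2 : ℝ) ≤ s := by exact_mod_cast hs
  have hd : (0 : ℝ) < 2 * s - 1 := by linarith
  set b : ℝ := (s : ℝ) / (2 * s - 1)
  set e : ℝ := (2 * (s : ℝ) - 2) / (2 * s - 1)
  have he0 : 0 ≤ e := div_nonneg (by linarith) hd.le
  have he1 : e ≤ 1 := by rw [div_le_one hd]; linarith
  have hk2 : (1 : ℝ) ≤ 2 * k := by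
    have : (1 : ℝ) ≤ k := by exact_mod_cast hk
    linarith
  have hGcard' : (G.card : ℝ) ≤ 2 * k * n := by
    rw [mul_comm]
    exact_mod_cast hGcard
  have hGe : (G.card : ℝ) ^ e ≤ 2 * k * (n : ℝ) ^ e := by
    calc (G.card : ℝ) ^ e ≤ (2 * k * n : ℝ) ^ e := by gcongr
      _ = (2 * k : ℝ) ^ e * (n : ℝ) ^ e := Real.mul_rpow (by positivity) (by positivity)
      _ ≤ _ := by
        gcongr
        simpa using Real.rpow_le_rpow_of_exponent_le hk2 he1
  set X : ℝ := (m : ℝ) ^ b * (n : ℝ) ^ e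
  have hX : 0 ≤ X := by positivity
  have hmX : (m : ℝ) ^ b * (G.card : ℝ) ^ e ≤ 2 * k * X := by
    calc (m : ℝ) ^ b * (G.card : ℝ) ^ e ≤ (m : ℝ) ^ b * (2 * k * (n : ℝ) ^ e) := by gcongr
      _ = _ := by ring
  have hm2 : (m : ℝ) ≤ 2 * k * m := le_mul_of_one_le_left (by positivity) hk2
  have hred' : (∑ γ ∈ Γ, ({p ∈ P | ∃ g ∈ Φ γ, evalEval p.1 p.2 g = 0} : Finset (ℝ × ℝ)).card : ℝ)
      ≤ 2 * k * s * n +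
        t * (m + ∑ g ∈ G, (({p ∈ P | evalEval p.1 p.2 g = 0} : Finset (ℝ × ℝ)).card : ℝ)) := by
    exact_mod_cast hred
  have hn0 : (0 : ℝ) ≤ n := by positivity
  have hm0 : (0 : ℝ) ≤ m := by positivity
  have hmn : 0 ≤ X + m + n := by positivity
  rw [Nat.cast_sum]
  calc _ ≤ 2 * k * s * n + t * (m + D * (2 * k * (X + m + n))) := by
        refine hred'.trans ?_
        gcongr
        refine hcurves.trans ?_
        gcongr
        linarith
    _ ≤ 2 * k * s * (X + m + n) + t * ((X + m + n) + D * (2 * k * (X + m + n))) := by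
        gcongr <;> linarith
    _ = _ := by ring
end

section
/- Let d ≥ 2 and s, t ≥ 2 be integers and let ε > 0. There exists a constant C = C(d, s, t, ε) with the following property. Let P be a set of m points in ℝ^d and let H be a set of n distinct hyperplanes in ℝ^d (affine subspaces of dimension d−1). If the incidence graph of P and H contains no copy of K_{s,t}, then I(P, H) ≤ C·( m^{(sd−s)/(sd−1)+ε} · n^{(sd−d)/(sd−1)} + m + n ). -/
/-- The sign vectors realised on a set `Z` by the affine functions `x ↦ φ i x + c i`. -/
def signVectorsOn {ι E : Type*} [AddCommGroup E] [Module ℝ E] (φ : ι → E →ₗ[ℝ] ℝ) (c : ι → ℝ)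
    (Z : Set E) : Set (ι → SignType) :=
  (fun x i => SignType.sign (φ i x + c i)) '' Z

/-- A convex combination of two reals of the same sign has that sign. -/
theorem sign_convexCombination {a b x y : ℝ} (ha : 0 < a) (hb : 0 < b)
    (h : SignType.sign x = SignType.sign y) :
    SignType.sign (a * x + b * y) = SignType.sign x := by
  rcases lt_trichotomy x 0 with hx | hx | hx
  · rw [sign_neg hx] at h ⊢
    have hy : y < 0 := sign_eq_neg_one_iff.1 h.symm
    exact sign_neg (by nlinarith)
  · subst hx
    have hy : y = 0 := sign_eq_zero_iff.1 (by rw [← h, sign_zero])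
    simp [hy]
  · rw [sign_pos hx] at h ⊢
    have hy : 0 < y := sign_eq_one_iff.1 h.symm
    exact sign_pos (by positivity)

/-- Adding one affine function to a family increases the number of sign vectors by at most twice
the number of sign vectors realised on its zero set. -/
theorem ncard_signVectorsOn_univ_succ_le {E : Type*} [AddCommGroup E] [Module ℝ E] {n : ℕ}
    (φ : Fin (n + 1) → E →ₗ[ℝ] ℝ) (c : Fin (n + 1) → ℝ) :
    (signVectorsOn φ c Set.univ).ncard ≤
      (signVectorsOn (fun i => φ (Fin.succ i)) (fun i => c (Fin.succ i)) Set.univ).ncard +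
        2 * (signVectorsOn (fun i => φ (Fin.succ i)) (fun i => c (Fin.succ i))
          {x | φ 0 x + c 0 = 0}).ncard := by
  set S' := signVectorsOn φ c Set.univ
  set S := signVectorsOn (fun i => φ (Fin.succ i)) (fun i => c (Fin.succ i)) Set.univ
  set S₀ := signVectorsOn (fun i => φ (Fin.succ i)) (fun i => c (Fin.succ i))
          {x | φ 0 x + c 0 = 0}
  let A : SignType → Set (Fin n → SignType) := fun a => Fin.tail '' {σ ∈ S' | σ 0 = a}
  have hA : ∀ a, {σ ∈ S' | σ 0 = a}.ncard = (A a).ncard := fun a => by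
    refine (Set.InjOn.ncard_image ?_).symm
    rintro σ ⟨-, h1⟩ τ ⟨-, h2⟩ h
    rw [← Fin.cons_self_tail σ, ← Fin.cons_self_tail τ, h, h1, h2]
  have hcover : S' = {σ ∈ S' | σ 0 = 0} ∪ ({σ ∈ S' | σ 0 = 1} ∪ {σ ∈ S' | σ 0 = -1}) := by
    ext σ
    simp only [Set.mem_union, Set.mem_ofPred_eq]
    rcases SignType.trichotomy (σ 0) with h | h | h <;> simp [h]
  have h0 : A 0 ⊆ S₀ := by
    rintro _ ⟨_, ⟨⟨x, -, rfl⟩, hx⟩, rfl⟩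
    exact ⟨x, sign_eq_zero_iff.1 hx, rfl⟩
  have hS : A 1 ∪ A (-1) ⊆ S := by
    rintro _ (⟨_, ⟨⟨x, -, rfl⟩, hx⟩, rfl⟩ | ⟨_, ⟨⟨x, -, rfl⟩, hx⟩, rfl⟩) <;>
      exact ⟨x, trivial, rfl⟩
  have hI : A 1 ∩ A (-1) ⊆ S₀ := by
    rintro σ ⟨⟨_, ⟨⟨x, -, rfl⟩, hx⟩, rfl⟩, ⟨_, ⟨⟨y, -, rfl⟩, hy⟩, hxy⟩⟩
    have hx' : 0 < φ 0 x + c 0 := sign_eq_one_iff.1 hx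
    have hy' : φ 0 y + c 0 < 0 := sign_eq_neg_one_iff.1 hy
    set u := φ 0 x + c 0 with hu
    set w := φ 0 y + c 0 with hw
    have hd : 0 < u - w := by linarith
    refine ⟨(-w / (u - w)) • x + (u / (u - w)) • y, ?_, ?_⟩
    · simp only [Set.mem_ofPred_eq, map_add, map_smul, smul_eq_mul]
      have h1 : φ 0 x = u - c 0 := by rw [hu]; ring
      have h2 : φ 0 y = w - c 0 := by rw [hw]; ring
      rw [h1, h2]
      field_simp
      ring
    · funext i
      have hs := congrFun hxy i
      simp only [Fin.tail] at hs ⊢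
      rw [← sign_convexCombination (a := -w / (u - w)) (b := u / (u - w))
        (div_pos (by linarith) hd) (div_pos hx' hd) hs.symm]
      congr 1
      simp only [map_add, map_smul, smul_eq_mul]
      field_simp
      ring
  have f0 := Set.ncard_le_ncard h0 (Set.toFinite _)
  have fS := Set.ncard_le_ncard hS (Set.toFinite _)
  have fI := Set.ncard_le_ncard hI (Set.toFinite _)
  have e := Set.ncard_union_add_ncard_inter (A 1) (A (-1)) (Set.toFinite _) (Set.toFinite _)
  have u1 := Set.ncard_union_le {σ ∈ S' | σ 0 = 0} ({σ ∈ S' | σ 0 = 1} ∪ {σ ∈ S' | σ 0 = -1})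
  have u2 := Set.ncard_union_le {σ ∈ S' | σ 0 = 1} {σ ∈ S' | σ 0 = -1}
  rw [← hcover] at u1
  rw [hA] at u1
  rw [hA, hA] at u2
  omega

/-- The zero set of a nonconstant affine function is a translate of a hyperplane, so sign vectors on
it are sign vectors on the whole of a space of smaller dimension. -/
theorem exists_signVectorsOn_zeroSet_eq {ι E : Type*} [AddCommGroup E] [Module ℝ E]
    (φ : ι → E →ₗ[ℝ] ℝ) (c : ι → ℝ) {g : E →ₗ[ℝ] ℝ} (hg : g ≠ 0) (b : ℝ) :
    ∃ c' : ι → ℝ, signVectorsOn φ c {x | g x + b = 0} =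
      signVectorsOn (fun i => (φ i).comp (LinearMap.ker g).subtype) c' Set.univ := by
  obtain ⟨x₀, hx₀⟩ := LinearMap.surjective hg (-b)
  refine ⟨fun i => φ i x₀ + c i, ?_⟩
  ext σ
  constructor
  · rintro ⟨x, hx, rfl⟩
    refine ⟨⟨x - x₀, ?_⟩, trivial, ?_⟩
    · have : g x + b = 0 := hx
      simp only [LinearMap.mem_ker, map_sub, hx₀]
      linarith
    · funext i
      simp only [LinearMap.comp_apply, Submodule.subtype_apply, map_sub]
      congr 1
      ring
  · rintro ⟨⟨y, hy⟩, -, rfl⟩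
    refine ⟨y + x₀, ?_, ?_⟩
    · have : g y = 0 := hy
      simp [this, hx₀]
    · funext i
      simp [add_assoc]

theorem add_two_pow_le (a k : ℕ) : a ^ (k + 1) + 2 * a ^ k ≤ (a + 2) ^ (k + 1) := by
  have : a ^ k ≤ (a + 2) ^ k := Nat.pow_le_pow_left (by omega) k
  rw [pow_succ, pow_succ]
  nlinarith

theorem ncard_signVectorsOn_univ_fin_le (n : ℕ) : ∀ {E : Type*} [AddCommGroup E] [Module ℝ E]
    [FiniteDimensional ℝ E] (φ : Fin n → E →ₗ[ℝ] ℝ) (c : Fin n → ℝ),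
    (signVectorsOn φ c Set.univ).ncard ≤ (2 * n + 1) ^ Module.finrank ℝ E := by
  induction n with
  | zero =>
    intro E _ _ _ φ c
    simpa using Set.ncard_le_one_iff_subsingleton.2
      (Set.subsingleton_of_subsingleton (s := signVectorsOn φ c Set.univ))
  | succ n ih =>
    intro E _ _ _ φ c
    by_cases hg : φ 0 = 0
    · have h1 : (signVectorsOn φ c Set.univ).ncard ≤
          (signVectorsOn (fun i => φ (Fin.succ i)) (fun i => c (Fin.succ i)) Set.univ).ncard := by
        refine Set.ncard_le_ncard_of_injOn Fin.tail ?_ ?_ (Set.toFinite _)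
        · rintro _ ⟨x, -, rfl⟩
          exact ⟨x, trivial, rfl⟩
        · rintro _ ⟨x, -, rfl⟩ _ ⟨y, -, rfl⟩ h
          refine funext fun i => Fin.cases ?_ (fun i => ?_) i
          · simp [hg]
          · exact congrFun h i
      exact h1.trans ((ih _ _).trans (Nat.pow_le_pow_left (by omega) _))
    · obtain ⟨c', hc'⟩ := exists_signVectorsOn_zeroSet_eq (fun i => φ (Fin.succ i))
        (fun i => c (Fin.succ i)) hg (c 0)
      have h1 := ncard_signVectorsOn_univ_succ_le φ c
      rw [hc'] at h1
      have h2 := ih (fun i => φ (Fin.succ i)) (fun i => c (Fin.succ i))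
      have h3 := ih (fun i => (φ (Fin.succ i)).comp (LinearMap.ker (φ 0)).subtype) c'
      rw [← Module.Dual.finrank_ker_add_one_of_ne_zero hg] at h2 ⊢
      have h4 := add_two_pow_le (2 * n + 1) (Module.finrank ℝ (LinearMap.ker (φ 0)))
      have : 2 * (n + 1) + 1 = 2 * n + 1 + 2 := by ring
      rw [this]
      omega

/-- An arrangement of `n` hyperplanes in dimension `k` has at most `(2 * n + 1)^k` faces. -/
theorem ncard_signVectorsOn_univ_le {ι E : Type*} [Fintype ι] [AddCommGroup E] [Module ℝ E]
    [FiniteDimensional ℝ E] (φ : ι → E →ₗ[ℝ] ℝ) (c : ι → ℝ) :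
    (signVectorsOn φ c Set.univ).ncard ≤ (2 * Fintype.card ι + 1) ^ Module.finrank ℝ E := by
  let e := Fintype.equivFin ι
  refine le_trans ?_ (ncard_signVectorsOn_univ_fin_le (Fintype.card ι) (fun i => φ (e.symm i))
    (fun i => c (e.symm i)))
  refine Set.ncard_le_ncard_of_injOn (fun σ i => σ (e.symm i)) ?_ ?_ (Set.toFinite _)
  · rintro _ ⟨x, -, rfl⟩
    exact ⟨x, trivial, rfl⟩
  · intro σ _ τ _ h
    funext i
    simpa using congrFun h (e i)

/-- A hyperplane meets at most `(2 * n + 1)^(k - 1)` faces of an arrangement of `n` hyperplanes in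
dimension `k`. -/
theorem ncard_signVectorsOn_zeroSet_le {ι E : Type*} [Fintype ι] [AddCommGroup E] [Module ℝ E]
    [FiniteDimensional ℝ E] (φ : ι → E →ₗ[ℝ] ℝ) (c : ι → ℝ) {g : E →ₗ[ℝ] ℝ} (hg : g ≠ 0) (b : ℝ) :
    (signVectorsOn φ c {x | g x + b = 0}).ncard ≤
      (2 * Fintype.card ι + 1) ^ (Module.finrank ℝ E - 1) := by
  obtain ⟨c', hc'⟩ := exists_signVectorsOn_zeroSet_eq φ c hg b
  rw [hc', ← Module.Dual.finrank_ker_add_one_of_ne_zero hg]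
  exact ncard_signVectorsOn_univ_le _ _

/-- Weakly decreasing chains of faces of an arrangement: each sign vector arises from the preceding
one by replacing some of its entries by zero. -/
def faceChains {ι E : Type*} [AddCommGroup E] [Module ℝ E] (φ : ι → E →ₗ[ℝ] ℝ) (c : ι → ℝ)
    (L : ℕ) : Set (Fin L → ι → SignType) :=
  {γ | (∀ j, γ j ∈ signVectorsOn φ c Set.univ) ∧
    ∀ i j j', j ≤ j' → γ j' i = 0 ∨ γ j' i = γ j i}

theorem geom_weight_lt {M : ℝ} (hM : 0 < M) {L : ℕ} {a : Fin L → ℝ} (haM : ∀ j, |a j| ≤ M)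
    (j : Fin L) (h0 : ∀ j', j ≤ j' → a j' = 0) :
    |∑ j' : Fin L, (M ^ 2 + 2) ^ (j' : ℕ) * a j'| < M⁻¹ * (M ^ 2 + 2) ^ (j : ℕ) := by
  set K := M ^ 2 + 2 with hK
  have hK1 : 1 < K := by nlinarith [sq_nonneg M]
  have hKp : 0 < K ^ (j : ℕ) := by positivity
  have h1 : |∑ j' : Fin L, K ^ (j' : ℕ) * a j'| ≤
      ∑ j' : Fin L, if (j' : ℕ) < j then K ^ (j' : ℕ) * M else 0 := by
    refine (Finset.abs_sum_le_sum_abs _ _).trans (Finset.sum_le_sum fun j' _ => ?_)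
    split_ifs with h
    · rw [abs_mul, abs_of_pos (by positivity)]
      exact mul_le_mul_of_nonneg_left (haM j') (by positivity)
    · rw [h0 j' (not_lt.1 h)]
      simp
  have h2 : (∑ j' : Fin L, if (j' : ℕ) < j then K ^ (j' : ℕ) * M else 0) ≤
      ∑ k ∈ Finset.range j, K ^ k * M := by
    rw [Fin.sum_univ_eq_sum_range (fun k => if k < (j : ℕ) then K ^ k * M else 0) L,
      ← Finset.sum_filter]
    refine Finset.sum_le_sum_of_subset_of_nonneg ?_ fun _ _ _ => by positivity
    intro k hk
    simpa using (Finset.mem_filter.1 hk).2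
  have h3 : ∑ k ∈ Finset.range j, K ^ k * M = (K ^ (j : ℕ) - 1) / (K - 1) * M := by
    rw [← Finset.sum_mul, geom_sum_eq hK1.ne']
  have h4 : (K ^ (j : ℕ) - 1) / (K - 1) * M < M⁻¹ * K ^ (j : ℕ) := by
    have : K - 1 = M ^ 2 + 1 := by rw [hK]; ring
    rw [this, div_mul_eq_mul_div, div_lt_iff₀ (by positivity)]
    have e : M⁻¹ * K ^ (j : ℕ) * (M ^ 2 + 1) = M * K ^ (j : ℕ) + M⁻¹ * K ^ (j : ℕ) := by
      field_simp
    rw [e]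
    have : 0 < M⁻¹ * K ^ (j : ℕ) := by positivity
    linarith
  linarith

theorem le_geom_weight {M : ℝ} {L : ℕ} {a : Fin L → ℝ}
    (haM : ∀ j, a j ≠ 0 → M⁻¹ ≤ |a j|) (hs : ∀ j j', j ≤ j' → SignType.sign (a j') = 0 ∨
      SignType.sign (a j') = SignType.sign (a j))
    (j : Fin L) (hj : 0 < a j) :
    M⁻¹ * (M ^ 2 + 2) ^ (j : ℕ) ≤ ∑ j' : Fin L, (M ^ 2 + 2) ^ (j' : ℕ) * a j' := by
  have hnn : ∀ j', 0 ≤ a j' := by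
    intro j'
    rcases le_total j j' with h | h
    · rcases hs j j' h with h1 | h1
      · exact (sign_eq_zero_iff.1 h1).ge
      · rw [sign_pos hj] at h1
        exact (sign_eq_one_iff.1 h1).le
    · rcases hs j' j h with h1 | h1
      · rw [sign_pos hj] at h1
        simp at h1
      · rw [sign_pos hj] at h1
        exact (sign_eq_one_iff.1 h1.symm).le
  refine le_trans ?_ (Finset.single_le_sum (f := fun j' : Fin L => (M ^ 2 + 2) ^ (j' : ℕ) * a j')
    (fun j' _ => mul_nonneg (by positivity) (hnn j')) (Finset.mem_univ j))
  have := haM j hj.ne'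
  rw [abs_of_pos hj] at this
  rw [mul_comm]
  exact mul_le_mul_of_nonneg_left this (by positivity)

theorem geom_weight_sign {M : ℝ} (hM : 0 < M) {L : ℕ} {a : Fin L → ℝ} (haM : ∀ j, |a j| ≤ M)
    (haM' : ∀ j, a j ≠ 0 → M⁻¹ ≤ |a j|) (hs : ∀ j j', j ≤ j' → SignType.sign (a j') = 0 ∨
      SignType.sign (a j') = SignType.sign (a j)) (j : Fin L) :
    (SignType.sign (a j) = 1 ↔
      M⁻¹ * (M ^ 2 + 2) ^ (j : ℕ) ≤ ∑ j' : Fin L, (M ^ 2 + 2) ^ (j' : ℕ) * a j') ∧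
    (SignType.sign (a j) = -1 ↔
      ∑ j' : Fin L, (M ^ 2 + 2) ^ (j' : ℕ) * a j' ≤ -(M⁻¹ * (M ^ 2 + 2) ^ (j : ℕ))) := by
  have hθ : 0 < M⁻¹ * (M ^ 2 + 2) ^ (j : ℕ) := by positivity
  rcases lt_trichotomy (a j) 0 with h | h | h
  · have := le_geom_weight (M := M) (a := fun j => -a j) (fun j hj => by
      rw [abs_neg]; exact haM' j (by simpa using hj)) (fun j j' hjj => by
        rcases hs j j' hjj with h1 | h1
        · left; rw [Left.sign_neg, h1]; rfl
        · right; rw [Left.sign_neg, Left.sign_neg, h1]) j (by simpa using h)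
    simp only [mul_neg, Finset.sum_neg_distrib] at this
    rw [sign_neg h]
    refine ⟨⟨fun h => by simp at h, fun h => by linarith⟩, ⟨fun _ => by linarith, fun _ => rfl⟩⟩
  · have := geom_weight_lt hM haM j (fun j' hj' => by
      rcases hs j j' hj' with h1 | h1
      · exact sign_eq_zero_iff.1 h1
      · rw [h, sign_zero] at h1
        exact sign_eq_zero_iff.1 h1)
    rw [abs_lt] at this
    rw [h, sign_zero]
    refine ⟨⟨fun h => by simp at h, fun h => by linarith⟩,
      ⟨fun h => by simp at h, fun _ => by linarith⟩⟩
  · have := le_geom_weight haM' hs j h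
    rw [sign_pos h]
    refine ⟨⟨fun _ => this, fun _ => rfl⟩, ⟨fun h => by simp at h, fun h => by linarith⟩⟩

theorem exists_bound_and_inv_bound {β : Type*} [Finite β] (f : β → ℝ) :
    ∃ M : ℝ, 0 < M ∧ (∀ b, |f b| ≤ M) ∧ ∀ b, f b ≠ 0 → M⁻¹ ≤ |f b| := by
  obtain ⟨A, hA⟩ := (Set.finite_range fun b => |f b|).bddAbove
  obtain ⟨B, hB⟩ := (Set.finite_range fun b => |f b|⁻¹).bddAbove
  have hM : 0 < max (max A B) 1 := lt_max_of_lt_right one_pos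
  refine ⟨max (max A B) 1, hM, fun b => ?_, fun b hb => ?_⟩
  · exact (hA ⟨b, rfl⟩).trans ((le_max_left A B).trans (le_max_left _ _))
  · refine inv_le_of_inv_le₀ (abs_pos.2 hb) ?_
    exact (hB ⟨b, rfl⟩).trans ((le_max_right A B).trans (le_max_left _ _))

theorem map_sum_smul_add {E : Type*} [AddCommGroup E] [Module ℝ E] (g : E →ₗ[ℝ] ℝ) (b : ℝ) {L : ℕ}
    {w : Fin L → ℝ} (hw : ∑ j, w j = 1) (v : Fin L → E) :
    g (∑ j, w j • v j) + b = ∑ j, w j * (g (v j) + b) := by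
  simp only [map_sum, map_smul, smul_eq_mul, mul_add, Finset.sum_add_distrib, ← Finset.sum_mul, hw,
    one_mul]

/-- A chain of faces can be recovered from the position, relative to boundedly many translates of
the given hyperplanes, of a suitable weighted mean of chosen points of its faces. -/
theorem exists_faceChains_encoding {ι E : Type*} [Finite ι] [AddCommGroup E] [Module ℝ E]
    (φ : ι → E →ₗ[ℝ] ℝ) (c : ι → ℝ) (v : (ι → SignType) → E)
    (hv : ∀ σ ∈ signVectorsOn φ c Set.univ, (fun i => SignType.sign (φ i (v σ) + c i)) = σ)
    {L : ℕ} (hL : 0 < L) :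
    ∃ (w : Fin L → ℝ) (c' : ι × Fin L × Bool → ℝ), ∑ j, w j = 1 ∧
      Set.InjOn (fun (γ : Fin L → ι → SignType) (i : ι × Fin L × Bool) =>
        SignType.sign (φ i.1 (∑ j, w j • v (γ j)) + c' i)) (faceChains φ c L) := by
  obtain ⟨M, hM, hM1, hM2⟩ := exists_bound_and_inv_bound
    (fun q : ι × (ι → SignType) => φ q.1 (v q.2) + c q.1)
  set K := M ^ 2 + 2 with hK
  have hKp : 0 < K := by positivity
  set W := ∑ j : Fin L, K ^ (j : ℕ) with hW
  have hWp : 0 < W := Finset.sum_pos (fun j _ => by positivity) ⟨⟨0, hL⟩, Finset.mem_univ _⟩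
  have hw1 : ∑ j : Fin L, K ^ (j : ℕ) / W = 1 := by
    rw [← Finset.sum_div, div_self hWp.ne']
  have key : ∀ γ ∈ faceChains φ c L, ∀ i j,
      (γ j i = 1 ↔ 0 ≤ φ i (∑ j : Fin L, (K ^ (j : ℕ) / W) • v (γ j)) +
          (c i - M⁻¹ * K ^ (j : ℕ) / W)) ∧
      (γ j i = -1 ↔
        φ i (∑ j : Fin L, (K ^ (j : ℕ) / W) • v (γ j)) + (c i + M⁻¹ * K ^ (j : ℕ) / W) ≤ 0) := by
    intro γ hγ i j
    have hsg : ∀ j, SignType.sign (φ i (v (γ j)) + c i) = γ j i := fun j =>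
      congrFun (hv _ (hγ.1 j)) i
    have h1 := geom_weight_sign hM (a := fun j => φ i (v (γ j)) + c i) (fun j => hM1 (i, γ j))
      (fun j => hM2 (i, γ j)) (fun j j' hjj => by simpa only [hsg] using hγ.2 i j j' hjj) j
    simp only [hsg] at h1
    have h2 := map_sum_smul_add (φ i) (c i) hw1 fun j => v (γ j)
    have h3 : ∑ j : Fin L, K ^ (j : ℕ) / W * (φ i (v (γ j)) + c i) =
        (∑ j : Fin L, K ^ (j : ℕ) * (φ i (v (γ j)) + c i)) / W := by
      rw [Finset.sum_div]
      exact Finset.sum_congr rfl fun _ _ => by ring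
    rw [h3] at h2
    rw [← add_sub_assoc, ← add_assoc, h2, h1.1, h1.2, ← sub_div, ← add_div, le_div_iff₀ hWp,
      div_le_iff₀ hWp, zero_mul, sub_nonneg]
    refine ⟨Iff.rfl, ?_⟩
    constructor <;> intro h <;> linarith
  refine ⟨fun j => K ^ (j : ℕ) / W,
    fun q => if q.2.2 then c q.1 - M⁻¹ * K ^ (q.2.1 : ℕ) / W
      else c q.1 + M⁻¹ * K ^ (q.2.1 : ℕ) / W, hw1, ?_⟩
  intro γ hγ γ' hγ' h
  funext j i
  have ht := congrFun h (i, j, true)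
  have hf := congrFun h (i, j, false)
  simp only [if_true, Bool.false_eq_true, if_false] at ht hf
  have k1 := key γ hγ i j
  have k2 := key γ' hγ' i j
  rw [← sign_nonneg_iff, ht, sign_nonneg_iff, ← k2.1] at k1
  rw [← sign_nonpos_iff, hf, sign_nonpos_iff, ← k2.2] at k1
  obtain ⟨k1, k3⟩ := k1
  clear ht hf
  revert k1 k3
  generalize γ j i = a
  generalize γ' j i = b
  revert a b
  decide

/-- An arrangement of `n` hyperplanes in dimension `k` has at most `(4 * n * L + 1)^k` chains of `L`
faces. -/
theorem ncard_faceChains_le {ι E : Type*} [Fintype ι] [AddCommGroup E] [Module ℝ E]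
    [FiniteDimensional ℝ E] (φ : ι → E →ₗ[ℝ] ℝ) (c : ι → ℝ) (v : (ι → SignType) → E)
    (hv : ∀ σ ∈ signVectorsOn φ c Set.univ, (fun i => SignType.sign (φ i (v σ) + c i)) = σ)
    {L : ℕ} (hL : 0 < L) :
    (faceChains φ c L).ncard ≤ (4 * L * Fintype.card ι + 1) ^ Module.finrank ℝ E := by
  obtain ⟨w, c', hw, hinj⟩ := exists_faceChains_encoding φ c v hv hL
  have := ncard_signVectorsOn_univ_le (fun i : ι × Fin L × Bool => φ i.1) c'
  simp only [Fintype.card_prod, Fintype.card_fin, Fintype.card_bool] at this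
  rw [show 4 * L * Fintype.card ι + 1 = 2 * (Fintype.card ι * (L * 2)) + 1 by ring]
  refine le_trans (Set.ncard_le_ncard_of_injOn _ ?_ hinj (Set.toFinite _)) this
  exact fun γ _ => ⟨_, trivial, rfl⟩

/-- Each hyperplane contains the chosen points of few chains of faces. -/
theorem ncard_faceChains_zeroSet_le {ι E : Type*} [Fintype ι] [AddCommGroup E] [Module ℝ E]
    [FiniteDimensional ℝ E] (φ : ι → E →ₗ[ℝ] ℝ) (c : ι → ℝ) (v : (ι → SignType) → E)
    (hv : ∀ σ ∈ signVectorsOn φ c Set.univ, (fun i => SignType.sign (φ i (v σ) + c i)) = σ)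
    {L : ℕ} (hL : 0 < L) {g : E →ₗ[ℝ] ℝ} (hg : g ≠ 0) (b : ℝ) :
    {γ ∈ faceChains φ c L | ∀ j, g (v (γ j)) + b = 0}.ncard ≤
      (4 * L * Fintype.card ι + 1) ^ (Module.finrank ℝ E - 1) := by
  obtain ⟨w, c', hw, hinj⟩ := exists_faceChains_encoding φ c v hv hL
  have := ncard_signVectorsOn_zeroSet_le (fun i : ι × Fin L × Bool => φ i.1) c' hg b
  simp only [Fintype.card_prod, Fintype.card_fin, Fintype.card_bool] at this
  rw [show 4 * L * Fintype.card ι + 1 = 2 * (Fintype.card ι * (L * 2)) + 1 by ring]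
  refine le_trans (Set.ncard_le_ncard_of_injOn _ ?_ (hinj.mono fun γ h => h.1)
    (Set.toFinite _)) this
  rintro γ ⟨-, hγ⟩
  refine ⟨_, ?_, rfl⟩
  change g (∑ j, w j • v (γ j)) + b = 0
  rw [map_sum_smul_add g b hw]
  exact Finset.sum_eq_zero fun j _ => by rw [hγ j, mul_zero]

/-- A ray leaving a face through a point `p` of it, in a direction in which some function of the
family decreases, meets the boundary of the face. -/
theorem exists_exit_point {ι E : Type*} [Finite ι] [AddCommGroup E] [Module ℝ E]
    (φ : ι → E →ₗ[ℝ] ℝ) (c : ι → ℝ) {p x : E}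
    (hx : ∀ i, SignType.sign (φ i x + c i) = SignType.sign (φ i p + c i))
    (hdec : ∃ i, 0 ≤ φ i p + c i ∧ φ i (p - x) < 0) :
    ∃ (q : E) (a : ℝ), 0 < a ∧ a < 1 ∧ p = (1 - a) • x + a • q ∧
      (∀ i, φ i q + c i = 0 ∨ SignType.sign (φ i q + c i) = SignType.sign (φ i p + c i)) ∧
      ∃ i, φ i q + c i = 0 ∧ φ i p + c i ≠ 0 ∧ φ i (p - x) ≠ 0 := by
  let g : ι → ℝ := fun i => -(φ i p + c i) / φ i (p - x)
  obtain ⟨i₀, hi₀, hi₀'⟩ := hdec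
  have hsub : ∀ i, φ i x + c i = φ i p + c i - φ i (p - x) := fun i => by
    rw [map_sub]; ring
  have hpos : 0 < φ i₀ p + c i₀ := by
    have h1 : 0 < φ i₀ x + c i₀ := by rw [hsub]; linarith
    have h2 := hx i₀
    rw [sign_pos h1] at h2
    exact sign_eq_one_iff.1 h2.symm
  have hg₀ : 0 < g i₀ := div_pos_of_neg_of_neg (by linarith) hi₀'
  obtain ⟨i₁, hi₁, hmin⟩ := Set.exists_min_image {i | 0 < g i} g (Set.toFinite _) ⟨i₀, hg₀⟩
  have hi₁ : 0 < g i₁ := hi₁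
  have hq : ∀ i, φ i (p + g i₁ • (p - x)) + c i = φ i p + c i + g i₁ * φ i (p - x) := fun i => by
    rw [map_add, map_smul, smul_eq_mul]; ring
  refine ⟨p + g i₁ • (p - x), 1 / (1 + g i₁), by positivity, ?_, ?_, ?_, i₁, ?_, ?_, ?_⟩
  · rw [div_lt_one (by positivity)]
    linarith
  · have h1 : 1 + g i₁ ≠ 0 := by positivity
    have : (p + g i₁ • (p - x)) = (1 + g i₁) • p - g i₁ • x := by module
    rw [this, smul_sub, smul_smul, smul_smul, one_div_mul_cancel h1,
      show 1 - 1 / (1 + g i₁) = 1 / (1 + g i₁) * g i₁ by field_simp; ring]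
    module
  · intro i
    rw [hq]
    rcases lt_trichotomy (φ i p + c i) 0 with h | h | h
    · rcases le_or_gt (φ i (p - x)) 0 with h' | h'
      · right
        rw [sign_neg h, sign_neg (by nlinarith)]
      · have h2 : g i₁ ≤ g i := hmin i (div_pos (by linarith) h')
        rw [le_div_iff₀ h'] at h2
        rcases (show φ i p + c i + g i₁ * φ i (p - x) ≤ 0 by linarith).eq_or_lt with h3 | h3
        · exact Or.inl h3
        · right; rw [sign_neg h, sign_neg h3]
    · left
      have h1 : φ i x + c i = 0 := by
        have := hx i
        rw [h, sign_zero] at this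
        exact sign_eq_zero_iff.1 this
      have h2 := hsub i
      rw [h1, h] at h2
      rw [h, show φ i (p - x) = 0 by linarith]
      simp
    · rcases le_or_gt 0 (φ i (p - x)) with h' | h'
      · right
        rw [sign_pos h, sign_pos (by nlinarith)]
      · have h2 : g i₁ ≤ g i := hmin i (div_pos_of_neg_of_neg (by linarith) h')
        rw [le_div_iff_of_neg h'] at h2
        rcases (show 0 ≤ φ i p + c i + g i₁ * φ i (p - x) by linarith).eq_or_lt with h3 | h3
        · exact Or.inl h3.symm
        · right; rw [sign_pos h, sign_pos h3]
  · have h1 : φ i₁ (p - x) ≠ 0 := fun h => hi₁.ne' (by simp only [g, h, div_zero])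
    rw [hq, div_mul_cancel₀ _ h1]
    ring
  · exact fun h => hi₁.ne' (by simp only [g, h, neg_zero, zero_div])
  · exact fun h => hi₁.ne' (by simp only [g, h, div_zero])

/-- Every point of a bounded arrangement lies in the open simplex spanned by the chosen points of
some chain of faces. -/
theorem exists_faceChain_of_point {ι E : Type*} [Finite ι] [AddCommGroup E] [Module ℝ E]
    [FiniteDimensional ℝ E] (φ : ι → E →ₗ[ℝ] ℝ) (c : ι → ℝ) (v : (ι → SignType) → E)
    (hv : ∀ σ ∈ signVectorsOn φ c Set.univ, (fun i => SignType.sign (φ i (v σ) + c i)) = σ)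
    (J : Set ι) (hJ : ∀ u : E, u ≠ 0 → ∃ i ∈ J, φ i u < 0) (k : ℕ) :
    ∀ p : E, (∀ i ∈ J, 0 ≤ φ i p + c i) →
      Module.finrank ℝ (⨅ i : {i // φ i p + c i = 0}, LinearMap.ker (φ i) : Submodule ℝ E) ≤ k →
      ∃ γ ∈ faceChains φ c (k + 1), (γ 0 = fun i => SignType.sign (φ i p + c i)) ∧
        ∃ w : Fin (k + 1) → ℝ, (∀ j, 0 < w j) ∧ ∑ j, w j = 1 ∧ p = ∑ j, w j • v (γ j) := by
  have hmem : ∀ p u, u ∈ (⨅ i : {i // φ i p + c i = 0}, LinearMap.ker (φ i) : Submodule ℝ E) ↔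
      ∀ i, φ i p + c i = 0 → φ i u = 0 := fun p u => by
    simp [Submodule.mem_iInf]
  have hsame : ∀ p i, SignType.sign (φ i (v fun i => SignType.sign (φ i p + c i)) + c i) =
      SignType.sign (φ i p + c i) := fun p => congrFun (hv _ ⟨p, trivial, rfl⟩)
  have hconst : ∀ (k : ℕ) (p : E), p = v (fun i => SignType.sign (φ i p + c i)) →
      ∃ γ ∈ faceChains φ c (k + 1), (γ 0 = fun i => SignType.sign (φ i p + c i)) ∧
        ∃ w : Fin (k + 1) → ℝ, (∀ j, 0 < w j) ∧ ∑ j, w j = 1 ∧ p = ∑ j, w j • v (γ j) := by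
    intro k p hp
    refine ⟨fun _ i => SignType.sign (φ i p + c i), ⟨fun _ => ⟨p, trivial, rfl⟩,
      fun _ _ _ _ => Or.inr rfl⟩, rfl, fun _ => 1 / (k + 1 : ℝ), fun _ => by positivity, ?_, ?_⟩
    · simp only [Finset.sum_const, Finset.card_univ, Fintype.card_fin, nsmul_eq_mul]
      push_cast
      field_simp
    · rw [← Finset.sum_smul, ← hp]
      simp only [Finset.sum_const, Finset.card_univ, Fintype.card_fin, nsmul_eq_mul]
      push_cast
      rw [mul_one_div_cancel (by positivity), one_smul]
  have hsub : ∀ p, p - v (fun i => SignType.sign (φ i p + c i)) ∈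
      (⨅ i : {i // φ i p + c i = 0}, LinearMap.ker (φ i) : Submodule ℝ E) := by
    intro p
    rw [hmem]
    intro i hi
    have h1 := hsame p i
    rw [hi, sign_zero, sign_eq_zero_iff] at h1
    rw [map_sub]
    linarith
  induction k with
  | zero =>
    intro p hpJ hp
    refine hconst 0 p ?_
    have h1 := Submodule.finrank_eq_zero.1 (Nat.le_zero.1 hp)
    have h2 := hsub p
    rw [h1, Submodule.mem_bot] at h2
    exact sub_eq_zero.1 h2
  | succ k ih =>
    intro p hpJ hp
    by_cases hpx : p = v (fun i => SignType.sign (φ i p + c i))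
    · exact hconst _ p hpx
    set σ : ι → SignType := fun i => SignType.sign (φ i p + c i) with hσ
    obtain ⟨i₀, hi₀, hi₀'⟩ := hJ _ (sub_ne_zero.2 hpx)
    obtain ⟨q, a, ha0, ha1, hpq, hqs, i₁, hi₁, -, hi₁'⟩ :=
      exists_exit_point φ c (hsame p) ⟨i₀, hpJ i₀ hi₀, hi₀'⟩
    have hlt : (⨅ i : {i // φ i q + c i = 0}, LinearMap.ker (φ i) : Submodule ℝ E) <
        (⨅ i : {i // φ i p + c i = 0}, LinearMap.ker (φ i) : Submodule ℝ E) := by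
      refine lt_of_le_of_ne (fun u hu => ?_) fun h => ?_
      · rw [hmem] at hu ⊢
        intro i hi
        refine hu i ?_
        rcases hqs i with h | h
        · exact h
        · rwa [hi, sign_zero, sign_eq_zero_iff] at h
      · have h1 := hsub p
        rw [← h, hmem] at h1
        exact hi₁' (h1 i₁ hi₁)
    obtain ⟨γ, hγ, hγ0, w, hw, hw1, hq⟩ := ih q (fun i hi => by
      rcases hqs i with h | h
      · exact h.ge
      · rw [← sign_nonneg_iff, h, sign_nonneg_iff]
        exact hpJ i hi) (by
      have := Submodule.finrank_lt_finrank_of_lt hlt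
      omega)
    refine ⟨Fin.cons σ γ, ⟨fun j => ?_, fun i j j' hjj => ?_⟩, rfl,
      Fin.cons (1 - a) fun j => a * w j, fun j => ?_, ?_, ?_⟩
    · refine Fin.cases ⟨p, trivial, rfl⟩ (fun j => ?_) j
      exact hγ.1 j
    · induction j' using Fin.cases with
      | zero =>
        rw [Fin.le_zero_iff.1 hjj]
        exact Or.inr rfl
      | succ j' =>
        induction j using Fin.cases with
        | zero =>
          simp only [Fin.cons_succ, Fin.cons_zero]
          rcases hγ.2 i 0 j' (Fin.zero_le _) with h | h
          · exact Or.inl h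
          · rw [h, hγ0]
            rcases hqs i with h' | h'
            · left
              simp [h']
            · exact Or.inr h'
        | succ j =>
          simp only [Fin.cons_succ]
          exact hγ.2 i j j' (Fin.succ_le_succ_iff.1 hjj)
    · refine Fin.cases ?_ (fun j => ?_) j
      · simpa using ha1
      · simpa using mul_pos ha0 (hw j)
    · rw [Fin.sum_univ_succ]
      simp [← Finset.mul_sum, hw1]
    · rw [Fin.sum_univ_succ]
      simp only [Fin.cons_zero, Fin.cons_succ, mul_smul, ← Finset.smul_sum, ← hq]
      exact hpq

/-- An affine function crosses a tuple of points if it takes values of both signs on it. -/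
def Crosses {E : Type*} [AddCommGroup E] [Module ℝ E] (g : E →ₗ[ℝ] ℝ) (b : ℝ) {L : ℕ}
    (u : Fin L → E) : Prop :=
  (∃ j, 0 < g (u j) + b) ∧ ∃ j, g (u j) + b < 0

/-- Greedy choice: `k` points can be chosen so that a family of sets, each containing a fraction
`1/r` of the ground set, is hit up to a fraction `(1 - 1/r)^k`. -/
theorem exists_card_disjoint_le {α : Type*} [Fintype α] [DecidableEq α]
    (𝓕 : Finset (Finset α)) {r : ℝ} (hr : 1 ≤ r)
    (h𝓕 : ∀ F ∈ 𝓕, (Fintype.card α : ℝ) < r * F.card) (k : ℕ) :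
    ∃ S : Finset α, S.card ≤ k ∧
      ((𝓕.filter fun F => Disjoint S F).card : ℝ) ≤ 𝓕.card * (1 - 1 / r) ^ k := by
  have hr0 : 0 < r := by linarith
  induction k with
  | zero =>
    refine ⟨∅, by simp, by simp⟩
  | succ k ih =>
    obtain ⟨S, hS, hS'⟩ := ih
    set G := 𝓕.filter fun F => Disjoint S F with hG
    have h1r : (0 : ℝ) ≤ 1 - 1 / r := by
      rw [sub_nonneg, div_le_one hr0]
      exact hr
    rcases isEmpty_or_nonempty α with hα | hα
    · have : 𝓕 = ∅ := Finset.eq_empty_of_forall_notMem fun F hF => by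
        have := h𝓕 F hF
        simp [Finset.eq_empty_of_isEmpty F] at this
      exact ⟨∅, by simp, by simp [this]⟩
    have hcount : ∑ x : α, ((G.filter fun F => x ∈ F).card : ℝ) = ∑ F ∈ G, (F.card : ℝ) := by
      have := Finset.sum_card_bipartiteAbove_eq_sum_card_bipartiteBelow
        (s := (Finset.univ : Finset α)) (t := G) (fun x F => x ∈ F)
      simp only [Finset.bipartiteAbove, Finset.bipartiteBelow, Finset.filter_univ_mem] at this
      exact_mod_cast this
    obtain ⟨x, -, hx⟩ : ∃ x ∈ (Finset.univ : Finset α),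
        (G.card : ℝ) / r ≤ ((G.filter fun F => x ∈ F).card : ℝ) := by
      refine Finset.exists_le_of_sum_le Finset.univ_nonempty ?_
      rw [hcount, Finset.sum_const, Finset.card_univ, nsmul_eq_mul, mul_div_assoc', mul_comm,
        ← mul_div_assoc', ← nsmul_eq_mul, ← Finset.sum_const]
      refine Finset.sum_le_sum fun F hF => ?_
      rw [div_le_iff₀ hr0, mul_comm]
      exact (h𝓕 F (Finset.mem_filter.1 hF).1).le
    refine ⟨insert x S, (Finset.card_insert_le _ _).trans (by omega), ?_⟩
    have hsplit := Finset.card_filter_add_card_filter_not (s := G) (fun F => x ∈ F)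
    have hsub : (𝓕.filter fun F => Disjoint (insert x S) F) = G.filter fun F => x ∉ F := by
      ext F
      simp only [hG, Finset.mem_filter, Finset.disjoint_insert_left]
      tauto
    rw [hsub]
    have hsplit' : ((G.filter fun F => x ∈ F).card : ℝ) + ((G.filter fun F => x ∉ F).card : ℝ) =
        G.card := by exact_mod_cast hsplit
    calc ((G.filter fun F => x ∉ F).card : ℝ) ≤ G.card * (1 - 1 / r) := by
          rw [mul_sub, mul_one_div]; linarith
      _ ≤ 𝓕.card * (1 - 1 / r) ^ k * (1 - 1 / r) := mul_le_mul_of_nonneg_right hS' h1r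
      _ = _ := by ring

theorem exists_hitting_set {α : Type*} [Fintype α] [DecidableEq α]
    (𝓕 : Finset (Finset α)) {r : ℝ} (hr : 1 ≤ r)
    (h𝓕 : ∀ F ∈ 𝓕, (Fintype.card α : ℝ) < r * F.card) {B : ℝ} (hB : 1 ≤ B)
    (h𝓕B : (𝓕.card : ℝ) ≤ B) :
    ∃ S : Finset α, (S.card : ℝ) ≤ r * Real.log B + 1 ∧ ∀ F ∈ 𝓕, ¬ Disjoint S F := by
  have hr0 : 0 < r := by linarith
  have hB0 : 0 < B := by linarith
  have hlog : 0 ≤ Real.log B := Real.log_nonneg hB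
  obtain ⟨S, hS, hS'⟩ := exists_card_disjoint_le 𝓕 hr h𝓕 (⌊r * Real.log B⌋₊ + 1)
  refine ⟨S, ?_, ?_⟩
  · have h1 := Nat.floor_le (mul_nonneg hr0.le hlog)
    have h2 : (S.card : ℝ) ≤ (⌊r * Real.log B⌋₊ + 1 : ℕ) := by exact_mod_cast hS
    push_cast at h2
    linarith
  · have h1 : (1 - 1 / r) ^ (⌊r * Real.log B⌋₊ + 1) < B⁻¹ := by
      have h2 : 1 - 1 / r ≤ Real.exp (-(1 / r)) := by
        have := Real.add_one_le_exp (-(1 / r))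
        linarith
      have h1r : (0 : ℝ) ≤ 1 - 1 / r := by
        rw [sub_nonneg, div_le_one hr0]
        exact hr
      refine (pow_le_pow_left₀ h1r h2 _).trans_lt ?_
      rw [← Real.exp_nat_mul, ← Real.lt_log_iff_exp_lt (by positivity), Real.log_inv]
      have h3 := Nat.lt_floor_add_one (r * Real.log B)
      push_cast
      rw [mul_neg, neg_lt_neg_iff, mul_one_div, lt_div_iff₀ hr0]
      linarith
    have h2 : ((𝓕.filter fun F => Disjoint S F).card : ℝ) < 1 := by
      refine hS'.trans_lt (lt_of_le_of_lt (mul_le_mul_of_nonneg_right h𝓕B ?_)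
        ((mul_lt_mul_of_pos_left h1 hB0).trans_eq (mul_inv_cancel₀ hB0.ne')))
      refine pow_nonneg ?_ _
      rw [sub_nonneg, div_le_one hr0]
      exact hr
    have h3 : (𝓕.filter fun F => Disjoint S F).card = 0 := by
      have : (𝓕.filter fun F => Disjoint S F).card < 1 := by exact_mod_cast h2
      omega
    intro F hF hd
    rw [Finset.card_eq_zero] at h3
    exact Finset.notMem_empty F (h3 ▸ Finset.mem_filter.2 ⟨hF, hd⟩)

open Classical in
/-- Weak cutting lemma: a sample of `O(r log n)` of `n` hyperplanes crosses every tuple of `L`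
points that is crossed by more than `n/r` of the hyperplanes. -/
theorem exists_cutting {α E : Type*} [Fintype α] [AddCommGroup E] [Module ℝ E]
    [FiniteDimensional ℝ E] (φ : α → E →ₗ[ℝ] ℝ) (c : α → ℝ) (L : ℕ) {r : ℝ} (hr : 1 ≤ r) :
    ∃ R : Finset α,
      (R.card : ℝ) ≤ r * (Module.finrank ℝ E * L * Real.log (2 * Fintype.card α + 1)) + 1 ∧
      ∀ u : Fin L → E, (∀ i ∈ R, ¬ Crosses (φ i) (c i) u) →
        ((Finset.univ.filter fun i => Crosses (φ i) (c i) u).card : ℝ) ≤ Fintype.card α / r := by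
  have hr0 : 0 < r := by linarith
  let 𝒮 : Finset (α → SignType) := (signVectorsOn φ c Set.univ).toFinset
  let rng : (Fin L → α → SignType) → Finset α := fun τ =>
    Finset.univ.filter fun i => (∃ j, τ j i = 1) ∧ ∃ j, τ j i = -1
  let 𝓕 : Finset (Finset α) := ((Fintype.piFinset fun _ : Fin L => 𝒮).image rng).filter
    fun F => (Fintype.card α : ℝ) < r * F.card
  have h𝒮 : 𝒮.card ≤ (2 * Fintype.card α + 1) ^ Module.finrank ℝ E := by
    rw [← Set.ncard_eq_toFinset_card']
    exact ncard_signVectorsOn_univ_le φ c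
  have hcard : 𝓕.card ≤ ((2 * Fintype.card α + 1) ^ Module.finrank ℝ E) ^ L := by
    refine (Finset.card_filter_le _ _).trans (Finset.card_image_le.trans ?_)
    rw [Fintype.card_piFinset, Finset.prod_const, Finset.card_univ, Fintype.card_fin]
    exact Nat.pow_le_pow_left h𝒮 L
  obtain ⟨R, hR, hR'⟩ := exists_hitting_set 𝓕 hr (fun F hF => (Finset.mem_filter.1 hF).2)
    (B := ((2 * (Fintype.card α : ℝ) + 1) ^ Module.finrank ℝ E) ^ L)
    (one_le_pow₀ (one_le_pow₀ (by
      have : (0 : ℝ) ≤ Fintype.card α := by positivity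
      linarith))) (by exact_mod_cast hcard)
  refine ⟨R, ?_, ?_⟩
  · rw [Real.log_pow, Real.log_pow] at hR
    convert hR using 2
    ring
  · intro u hu
    by_contra hlt
    rw [not_le, div_lt_iff₀ hr0] at hlt
    have hrng : rng (fun j i => SignType.sign (φ i (u j) + c i)) =
        Finset.univ.filter fun i => Crosses (φ i) (c i) u := by
      ext i
      rw [Finset.mem_filter, Finset.mem_filter]
      simp [Crosses, sign_eq_one_iff, sign_eq_neg_one_iff]
    refine hR' (Finset.univ.filter fun i => Crosses (φ i) (c i) u) ?_ ?_
    · refine Finset.mem_filter.2 ⟨Finset.mem_image.2 ⟨_, ?_, hrng⟩, by linarith⟩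
      rw [Fintype.mem_piFinset]
      intro j
      exact Set.mem_toFinset.2 ⟨u j, trivial, rfl⟩
    · rw [Finset.disjoint_left]
      intro i hi hi'
      exact hu i hi (Finset.mem_filter.1 hi').2

open Classical in
/-- The Kővári–Sós–Turán bound. -/
theorem sum_card_le_of_no_biclique {α β : Type*} (Q : Finset β) (D : Finset α)
    (inc : β → α → Prop) {s t : ℕ} (hs : 2 ≤ s) (ht : 1 ≤ t)
    (hK : ∀ S ⊆ Q, ∀ T ⊆ D, S.card = s → T.card = t → ∃ p ∈ S, ∃ i ∈ T, ¬ inc p i) :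
    ∑ i ∈ D, ((Q.filter fun p => inc p i).card : ℝ) ≤
      t * Q.card * (D.card : ℝ) ^ (1 - 1 / (s : ℝ)) + s * D.card := by
  have hcount : ∑ i ∈ D, ((Q.filter fun p => inc p i).card).choose s ≤ Q.card.choose s * t := by
    have h1 := Finset.sum_card_bipartiteAbove_eq_sum_card_bipartiteBelow
        (s := D) (t := Q.powersetCard s) (fun i S => ∀ p ∈ S, inc p i)
    simp only [Finset.bipartiteAbove, Finset.bipartiteBelow] at h1
    have h2 : ∀ i, ((Q.powersetCard s).filter fun S => ∀ p ∈ S, inc p i) =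
        (Q.filter fun p => inc p i).powersetCard s := fun i => by
      ext S
      simp only [Finset.mem_filter, Finset.mem_powersetCard, Finset.subset_iff]
      grind
    simp only [h2, Finset.card_powersetCard] at h1
    rw [h1, ← Finset.card_powersetCard s Q, ← smul_eq_mul]
    refine Finset.sum_le_card_nsmul _ _ _ fun S hS => ?_
    rw [Finset.mem_powersetCard] at hS
    by_contra hlt
    obtain ⟨T, hT, hTc⟩ := Finset.exists_subset_card_eq (not_le.1 hlt).le
    obtain ⟨p, hp, i, hi, hpi⟩ := hK S hS.1 T (hT.trans (Finset.filter_subset _ _)) hS.2 hTc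
    exact hpi ((Finset.mem_filter.1 (hT hi)).2 p hp)
  have hpow : ∑ i ∈ D, ((Q.filter fun p => inc p i).card + 1 - s) ^ s ≤ t * Q.card ^ s := by
    calc ∑ i ∈ D, ((Q.filter fun p => inc p i).card + 1 - s) ^ s
        ≤ ∑ i ∈ D, s.factorial * ((Q.filter fun p => inc p i).card).choose s :=
          Finset.sum_le_sum fun i _ => by
            rw [← Nat.descFactorial_eq_factorial_mul_choose]
            exact Nat.pow_sub_le_descFactorial _ _
      _ ≤ s.factorial * (Q.card.choose s * t) := by
          rw [← Finset.mul_sum]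
          exact Nat.mul_le_mul_left _ hcount
      _ = t * Q.card.descFactorial s := by
          rw [Nat.descFactorial_eq_factorial_mul_choose]
          ring
      _ ≤ t * Q.card ^ s := Nat.mul_le_mul_left _ (Nat.descFactorial_le_pow _ _)
  set x : α → ℝ := fun i => (((Q.filter fun p => inc p i).card + 1 - s : ℕ) : ℝ) with hx
  have hx0 : ∀ i, 0 ≤ x i := fun i => Nat.cast_nonneg _
  have hpow' : ∑ i ∈ D, x i ^ s ≤ t * (Q.card : ℝ) ^ s := by
    simp only [hx]
    exact_mod_cast hpow
  have hs1 : (1 : ℝ) ≤ s := by exact_mod_cast (by omega : 1 ≤ s)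
  have hhol : (∑ i ∈ D, x i) ^ s ≤ (D.card : ℝ) ^ (s - 1) * ∑ i ∈ D, x i ^ s := by
    obtain ⟨k, rfl⟩ : ∃ k, s = k + 1 := ⟨s - 1, by omega⟩
    exact pow_sum_le_card_mul_sum_pow (fun i _ => hx0 i) k
  have hmain : ∑ i ∈ D, x i ≤ t * Q.card * (D.card : ℝ) ^ (1 - 1 / (s : ℝ)) := by
    refine le_of_pow_le_pow_left₀ (n := s) (by omega) (by positivity) (hhol.trans ?_)
    have h1 : ((D.card : ℝ) ^ (1 - 1 / (s : ℝ))) ^ s = (D.card : ℝ) ^ (s - 1) := by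
      rw [← Real.rpow_mul_natCast (by positivity), ← Real.rpow_natCast]
      congr 1
      rw [Nat.cast_sub (by omega)]
      field_simp
      simp
    rw [mul_pow, mul_pow, h1, mul_comm]
    refine mul_le_mul_of_nonneg_right (hpow'.trans (mul_le_mul_of_nonneg_right ?_ (by positivity)))
      (by positivity)
    exact le_self_pow₀ (by exact_mod_cast ht) (by omega)
  have hdeg : ∀ i, ((Q.filter fun p => inc p i).card : ℝ) ≤ x i + s := fun i => by
    have : (Q.filter fun p => inc p i).card ≤ (Q.filter fun p => inc p i).card + 1 - s + s := by
      omega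
    simp only [hx]
    exact_mod_cast this
  refine (Finset.sum_le_sum fun i _ => hdeg i).trans ?_
  rw [Finset.sum_add_distrib, Finset.sum_const, nsmul_eq_mul, mul_comm (D.card : ℝ)]
  linarith

/-- An affine function that vanishes at an interior point of a simplex without crossing its
vertices vanishes on the whole simplex. -/
theorem forall_eq_zero_of_not_crosses {E : Type*} [AddCommGroup E] [Module ℝ E] {g : E →ₗ[ℝ] ℝ}
    {b : ℝ} {L : ℕ} {u : Fin L → E} {w : Fin L → ℝ} (hw : ∀ j, 0 < w j) (hw1 : ∑ j, w j = 1)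
    (h0 : g (∑ j, w j • u j) + b = 0) (hc : ¬ Crosses g b u) : ∀ j, g (u j) + b = 0 := by
  rw [map_sum_smul_add g b hw1] at h0
  rw [Crosses, not_and_or] at hc
  push Not at hc
  intro j
  have h1 : w j * (g (u j) + b) = 0 := by
    rcases hc with hc | hc
    · exact (Finset.sum_eq_zero_iff_of_nonpos fun j _ =>
        mul_nonpos_of_nonneg_of_nonpos (hw j).le (hc j)).1 h0 j (Finset.mem_univ j)
    · exact (Finset.sum_eq_zero_iff_of_nonneg fun j _ =>
        mul_nonneg (hw j).le (hc j)).1 h0 j (Finset.mem_univ j)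
  exact (mul_eq_zero.1 h1).resolve_left (hw j).ne'

theorem not_crosses_of_mem_faceChains {ι E : Type*} [AddCommGroup E] [Module ℝ E]
    {φ : ι → E →ₗ[ℝ] ℝ} {c : ι → ℝ} {v : (ι → SignType) → E}
    (hv : ∀ σ ∈ signVectorsOn φ c Set.univ, (fun i => SignType.sign (φ i (v σ) + c i)) = σ)
    {L : ℕ} {γ : Fin L → ι → SignType} (hγ : γ ∈ faceChains φ c L) (i : ι) :
    ¬ Crosses (φ i) (c i) fun j => v (γ j) := by
  rintro ⟨⟨j, hj⟩, j', hj'⟩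
  have hsg : ∀ j, SignType.sign (φ i (v (γ j)) + c i) = γ j i := fun j =>
    congrFun (hv _ (hγ.1 j)) i
  have h1 := hsg j
  have h2 := hsg j'
  rw [sign_pos hj] at h1
  rw [sign_neg hj'] at h2
  rcases le_total j j' with h | h
  · rcases hγ.2 i j j' h with h3 | h3 <;> rw [← h2] at h3
    · simp at h3
    · rw [← h1] at h3; simp at h3
  · rcases hγ.2 i j' j h with h3 | h3 <;> rw [← h1] at h3
    · simp at h3
    · rw [← h2] at h3; simp at h3

/-- A finite point set can be covered by simplices, not crossed by the hyperplanes of a given family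
of size `N`, whose number is `O(N^d)` and of which each hyperplane contains `O(N^(d-1))`. -/
theorem exists_simplicial_cover {d : ℕ} {ρ : Type*} [Fintype ρ]
    (φ : ρ → (Fin d → ℝ) →ₗ[ℝ] ℝ) (c : ρ → ℝ) (P : Finset (Fin d → ℝ)) :
    ∃ 𝒞 : Finset (Fin (d + 1) → Fin d → ℝ),
      𝒞.card ≤ (4 * (d + 1) * (Fintype.card ρ + d * 2) + 1) ^ d ∧
      (∀ g : (Fin d → ℝ) →ₗ[ℝ] ℝ, g ≠ 0 → ∀ b : ℝ,
        {u ∈ (𝒞 : Set (Fin (d + 1) → Fin d → ℝ)) | ∀ j, g (u j) + b = 0}.ncard ≤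
          (4 * (d + 1) * (Fintype.card ρ + d * 2) + 1) ^ (d - 1)) ∧
      (∀ u ∈ 𝒞, ∀ i, ¬ Crosses (φ i) (c i) u) ∧
      ∀ p ∈ P, ∃ u ∈ 𝒞, ∃ w : Fin (d + 1) → ℝ, (∀ j, 0 < w j) ∧ ∑ j, w j = 1 ∧
        p = ∑ j, w j • u j := by
  classical
  obtain ⟨B, hB⟩ : ∃ B : ℝ, ∀ p ∈ P, ∀ k, |p k| ≤ B := by
    obtain ⟨B, hB⟩ := (P.finite_toSet.image fun p => ‖p‖).bddAbove
    exact ⟨B, fun p hp k => (norm_le_pi_norm p k).trans (hB ⟨p, hp, rfl⟩)⟩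
  let ι := ρ ⊕ (Fin d × Bool)
  let φ' : ι → (Fin d → ℝ) →ₗ[ℝ] ℝ := Sum.elim φ fun q =>
    if q.2 then LinearMap.proj q.1 else -LinearMap.proj q.1
  let c' : ι → ℝ := Sum.elim c fun _ => B
  have hex : ∀ σ : ι → SignType, ∃ x, σ ∈ signVectorsOn φ' c' Set.univ →
      (fun i => SignType.sign (φ' i x + c' i)) = σ := fun σ => by
    by_cases h : σ ∈ signVectorsOn φ' c' Set.univ
    · obtain ⟨x, -, hx⟩ := h
      exact ⟨x, fun _ => hx⟩
    · exact ⟨0, fun h' => (h h').elim⟩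
  choose v hv using hex
  have hι : Fintype.card ι = Fintype.card ρ + d * 2 := by
    simp [ι]
  have hcardE : Module.finrank ℝ (Fin d → ℝ) = d := by simp
  have hvinj : Set.InjOn (fun (γ : Fin (d + 1) → ι → SignType) j => v (γ j))
      (faceChains φ' c' (d + 1)) := by
    intro γ hγ γ' hγ' h
    funext j
    have hj : v (γ j) = v (γ' j) := congrFun h j
    rw [← hv _ (hγ.1 j), ← hv _ (hγ'.1 j), hj]
  have hJ : ∀ u : Fin d → ℝ, u ≠ 0 → ∃ i ∈ Set.range (Sum.inr : Fin d × Bool → ι), φ' i u < 0 := by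
    intro u hu
    obtain ⟨k, hk⟩ := Function.ne_iff.1 hu
    rcases lt_or_gt_of_ne hk with h | h
    · exact ⟨Sum.inr (k, true), ⟨_, rfl⟩, by simpa [φ'] using h⟩
    · exact ⟨Sum.inr (k, false), ⟨_, rfl⟩, by simpa [φ'] using h⟩
  refine ⟨(faceChains φ' c' (d + 1)).toFinset.image fun γ j => v (γ j), ?_, ?_, ?_, ?_⟩
  · have := ncard_faceChains_le φ' c' v hv (Nat.succ_pos d)
    rw [hι, hcardE, Set.ncard_eq_toFinset_card'] at this
    exact Finset.card_image_le.trans this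
  · intro g hg b
    have := ncard_faceChains_zeroSet_le φ' c' v hv (Nat.succ_pos d) hg b
    rw [hι, hcardE] at this
    refine le_trans ?_ this
    refine le_trans (Set.ncard_le_ncard (t := (fun (γ : Fin (d + 1) → ι → SignType) j => v (γ j)) ''
      {γ ∈ faceChains φ' c' (d + 1) | ∀ j, g (v (γ j)) + b = 0}) ?_ (Set.toFinite _))
      (Set.ncard_image_le (Set.toFinite _))
    rintro u ⟨hu, hu'⟩
    obtain ⟨γ, hγ, rfl⟩ := Finset.mem_image.1 (Finset.mem_coe.1 hu)
    exact ⟨γ, ⟨Set.mem_toFinset.1 hγ, hu'⟩, rfl⟩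
  · intro u hu i
    obtain ⟨γ, hγ, rfl⟩ := Finset.mem_image.1 hu
    exact not_crosses_of_mem_faceChains hv (Set.mem_toFinset.1 hγ) (Sum.inl i)
  · intro p hp
    obtain ⟨γ, hγ, -, w, hw, hw1, hpw⟩ := exists_faceChain_of_point φ' c' v hv
      (Set.range Sum.inr) hJ d p (by
        rintro _ ⟨⟨k, b⟩, rfl⟩
        have := abs_le.1 (hB p hp k)
        cases b <;> simp [φ', c'] <;> linarith)
      ((Submodule.finrank_le _).trans hcardE.le)
    exact ⟨_, Finset.mem_image.2 ⟨γ, Set.mem_toFinset.2 hγ, rfl⟩, w, hw, hw1, hpw⟩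

open Classical in
/-- Incidences inside one simplex that is crossed by at most `κ` hyperplanes. -/
theorem sum_card_simplex_le {E : Type*} [AddCommGroup E] [Module ℝ E] {α : Type*} [Fintype α]
    (φ : α → E →ₗ[ℝ] ℝ) (c : α → ℝ) (Q : Finset E) {s t : ℕ} (hs : 2 ≤ s) (ht : 1 ≤ t)
    (hK : ∀ S ⊆ Q, ∀ T : Finset α, S.card = s → T.card = t →
      ∃ p ∈ S, ∃ i ∈ T, φ i p + c i ≠ 0) {L : ℕ} (u : Fin L → E)
    (hQ : ∀ p ∈ Q, ∃ w : Fin L → ℝ, (∀ j, 0 < w j) ∧ ∑ j, w j = 1 ∧ p = ∑ j, w j • u j)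
    {κ : ℝ} (hκ : ((Finset.univ.filter fun i => Crosses (φ i) (c i) u).card : ℝ) ≤ κ) :
    ∑ i, ((Q.filter fun p => φ i p + c i = 0).card : ℝ) ≤
      t * Q.card + s * (Finset.univ.filter fun i => ∀ j, φ i (u j) + c i = 0).card +
        (t * Q.card * κ ^ (1 - 1 / (s : ℝ)) + s * κ) := by
  set D := Finset.univ.filter fun i => Crosses (φ i) (c i) u with hD
  set A := Finset.univ.filter fun i => ∀ j, φ i (u j) + c i = 0 with hA
  have hs1 : (1 : ℝ) ≤ s := by exact_mod_cast (by omega : 1 ≤ s)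
  have hexp : 0 ≤ 1 - 1 / (s : ℝ) := by
    rw [sub_nonneg, div_le_one (by linarith)]
    exact hs1
  have hsum : ∑ i, ((Q.filter fun p => φ i p + c i = 0).card : ℝ) ≤
      ∑ i ∈ A, ((Q.filter fun p => φ i p + c i = 0).card : ℝ) +
        ∑ i ∈ D, ((Q.filter fun p => φ i p + c i = 0).card : ℝ) := by
    rw [← Finset.sum_union_inter]
    refine le_trans (le_of_eq ?_) (le_add_of_nonneg_right
      (Finset.sum_nonneg fun _ _ => Nat.cast_nonneg _))
    refine (Finset.sum_subset (Finset.subset_univ _) fun i _ hi => ?_).symm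
    rw [Finset.mem_union, not_or] at hi
    rw [Nat.cast_eq_zero, Finset.card_eq_zero, Finset.filter_eq_empty_iff]
    intro p hp h0
    obtain ⟨w, hw, hw1, rfl⟩ := hQ p hp
    exact hi.1 (Finset.mem_filter.2 ⟨Finset.mem_univ _, forall_eq_zero_of_not_crosses hw hw1 h0
      fun h => hi.2 (Finset.mem_filter.2 ⟨Finset.mem_univ _, h⟩)⟩)
  have hdeg : ∀ i, (Q.filter fun p => φ i p + c i = 0).card ≤ Q.card := fun i =>
    Finset.card_filter_le _ _
  have hAle : ∑ i ∈ A, ((Q.filter fun p => φ i p + c i = 0).card : ℝ) ≤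
      t * Q.card + s * A.card := by
    have h1 : ∑ i ∈ A, (Q.filter fun p => φ i p + c i = 0).card ≤ A.card * Q.card := by
      rw [← smul_eq_mul]
      exact Finset.sum_le_card_nsmul _ _ _ fun i _ => hdeg i
    have h2 : A.card * Q.card ≤ t * Q.card + s * A.card := by
      rcases lt_or_ge A.card t with h | h
      · nlinarith
      rcases lt_or_ge Q.card s with h' | h'
      · nlinarith
      exfalso
      obtain ⟨S, hS, hSc⟩ := Finset.exists_subset_card_eq h'
      obtain ⟨T, hT, hTc⟩ := Finset.exists_subset_card_eq h
      obtain ⟨p, hp, i, hi, hpi⟩ := hK S hS T hSc hTc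
      obtain ⟨w, hw, hw1, rfl⟩ := hQ p (hS hp)
      refine hpi ?_
      rw [map_sum_smul_add _ _ hw1]
      refine Finset.sum_eq_zero fun j _ => ?_
      rw [(Finset.mem_filter.1 (hT hi)).2 j, mul_zero]
    exact_mod_cast h1.trans h2
  have hDle : ∑ i ∈ D, ((Q.filter fun p => φ i p + c i = 0).card : ℝ) ≤
      t * Q.card * κ ^ (1 - 1 / (s : ℝ)) + s * κ := by
    refine (sum_card_le_of_no_biclique Q D (fun p i => φ i p + c i = 0) hs ht
      fun S hS T _ => hK S hS T).trans ?_
    gcongr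
  linarith

open Classical in
/-- Incidence bound in terms of a subfamily `R` such that simplices not crossed by `R` are crossed
by at most `κ` hyperplanes. -/
theorem sum_card_le_of_cutting {d : ℕ} {α : Type*} [Fintype α]
    (φ : α → (Fin d → ℝ) →ₗ[ℝ] ℝ) (c : α → ℝ) (hφ : ∀ i, φ i ≠ 0) (P : Finset (Fin d → ℝ))
    {s t : ℕ} (hs : 2 ≤ s) (ht : 1 ≤ t)
    (hK : ∀ S ⊆ P, ∀ T : Finset α, S.card = s → T.card = t →
      ∃ p ∈ S, ∃ i ∈ T, φ i p + c i ≠ 0) (R : Finset α) {κ X : ℝ} (hκ : 0 ≤ κ)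
    (hR : ∀ u : Fin (d + 1) → Fin d → ℝ, (∀ i ∈ R, ¬ Crosses (φ i) (c i) u) →
        ((Finset.univ.filter fun i => Crosses (φ i) (c i) u).card : ℝ) ≤ κ)
    (hX : 4 * (d + 1) * (R.card + d * 2) + 1 ≤ X) :
    ∑ i, ((P.filter fun p => φ i p + c i = 0).card : ℝ) ≤
      t * P.card + s * (Fintype.card α * X ^ (d - 1)) +
        (t * P.card * κ ^ (1 - 1 / (s : ℝ)) + s * (κ * X ^ d)) := by
  obtain ⟨𝒞, hcard, hzero, hcross, hcover⟩ :=
    exists_simplicial_cover (fun i : R => φ i) (fun i : R => c i) P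
  rw [Fintype.card_coe] at hcard hzero
  have hX0 : 0 ≤ X := le_trans (by positivity) hX
  have hcard' : (𝒞.card : ℝ) ≤ X ^ d := by
    have : (𝒞.card : ℝ) ≤ (4 * (d + 1) * (R.card + d * 2) + 1) ^ d := by exact_mod_cast hcard
    exact this.trans (pow_le_pow_left₀ (by positivity) hX d)
  have hcell : ∀ p, ∃ u, p ∈ P → u ∈ 𝒞 ∧ ∃ w : Fin (d + 1) → ℝ, (∀ j, 0 < w j) ∧ ∑ j, w j = 1 ∧
      p = ∑ j, w j • u j := fun p => by
    by_cases hp : p ∈ P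
    · obtain ⟨u, hu⟩ := hcover p hp
      exact ⟨u, fun _ => hu⟩
    · exact ⟨0, fun h => (hp h).elim⟩
  choose cell hcell using hcell
  let Q : (Fin (d + 1) → Fin d → ℝ) → Finset (Fin d → ℝ) := fun u => P.filter fun p => cell p = u
  have hQcard : ∑ u ∈ 𝒞, ((Q u).card : ℝ) = P.card := by
    exact_mod_cast (Finset.card_eq_sum_card_fiberwise fun p hp => (hcell p hp).1).symm
  have hsplit : ∀ i, ((P.filter fun p => φ i p + c i = 0).card : ℝ) =
      ∑ u ∈ 𝒞, (((Q u).filter fun p => φ i p + c i = 0).card : ℝ) := fun i => by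
    have h1 := Finset.card_eq_sum_card_fiberwise (s := P.filter fun p => φ i p + c i = 0)
      (t := 𝒞) (f := cell) fun p hp => (hcell p (Finset.mem_filter.1 hp).1).1
    have h2 : ∀ u, ((P.filter fun p => φ i p + c i = 0).filter fun p => cell p = u) =
        (Q u).filter fun p => φ i p + c i = 0 := fun u => Finset.filter_comm _ _ _
    simp only [h2] at h1
    exact_mod_cast h1
  have hcontain : ∑ u ∈ 𝒞, ((Finset.univ.filter fun i => ∀ j, φ i (u j) + c i = 0).card : ℝ) ≤
      Fintype.card α * X ^ (d - 1) := by
    have h1 := Finset.sum_card_bipartiteAbove_eq_sum_card_bipartiteBelow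
      (s := 𝒞) (t := (Finset.univ : Finset α)) (fun u i => ∀ j, φ i (u j) + c i = 0)
    simp only [Finset.bipartiteAbove, Finset.bipartiteBelow] at h1
    have h2 : ∀ i, ((𝒞.filter fun u => ∀ j, φ i (u j) + c i = 0).card : ℝ) ≤ X ^ (d - 1) := by
      intro i
      have h3 := hzero (φ i) (hφ i) (c i)
      have h4 : {u ∈ (𝒞 : Set (Fin (d + 1) → Fin d → ℝ)) | ∀ j, φ i (u j) + c i = 0} =
          ((𝒞.filter fun u => ∀ j, φ i (u j) + c i = 0 : Finset _) :
            Set (Fin (d + 1) → Fin d → ℝ)) := by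
        ext u; simp
      rw [h4, Set.ncard_coe_finset] at h3
      have h5 : ((𝒞.filter fun u => ∀ j, φ i (u j) + c i = 0).card : ℝ) ≤
          (4 * (d + 1) * (R.card + d * 2) + 1) ^ (d - 1) := by exact_mod_cast h3
      exact h5.trans (pow_le_pow_left₀ (by positivity) hX _)
    have h1' : ∑ u ∈ 𝒞, ((Finset.univ.filter fun i => ∀ j, φ i (u j) + c i = 0).card : ℝ) =
        ∑ i, ((𝒞.filter fun u => ∀ j, φ i (u j) + c i = 0).card : ℝ) := by exact_mod_cast h1
    rw [h1', ← Finset.card_univ, ← nsmul_eq_mul]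
    exact Finset.sum_le_card_nsmul _ _ _ fun i _ => h2 i
  calc ∑ i, ((P.filter fun p => φ i p + c i = 0).card : ℝ)
      = ∑ u ∈ 𝒞, ∑ i, (((Q u).filter fun p => φ i p + c i = 0).card : ℝ) := by
        rw [Finset.sum_comm]
        exact Finset.sum_congr rfl fun i _ => hsplit i
    _ ≤ ∑ u ∈ 𝒞, (t * (Q u).card +
          s * (Finset.univ.filter fun i => ∀ j, φ i (u j) + c i = 0).card +
          (t * (Q u).card * κ ^ (1 - 1 / (s : ℝ)) + s * κ)) := by
        refine Finset.sum_le_sum fun u hu => ?_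
        refine sum_card_simplex_le φ c (Q u) hs ht
          (fun S hS => hK S (hS.trans (Finset.filter_subset _ _))) u (fun p hp => ?_)
          (hR u fun i hi => hcross u hu ⟨i, hi⟩)
        obtain ⟨hpP, rfl⟩ := Finset.mem_filter.1 hp
        exact (hcell p hpP).2
    _ = t * P.card +
          s * ∑ u ∈ 𝒞, ((Finset.univ.filter fun i => ∀ j, φ i (u j) + c i = 0).card : ℝ) +
          (t * P.card * κ ^ (1 - 1 / (s : ℝ)) + s * (κ * 𝒞.card)) := by
        simp only [Finset.sum_add_distrib, ← Finset.mul_sum, ← Finset.sum_mul, hQcard,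
          Finset.sum_const, nsmul_eq_mul]
        ring
    _ ≤ _ := by gcongr

/-- The parameter `r` balancing the two terms of the incidence bound. -/
theorem rpow_balance {m n : ℝ} (hm : 0 < m) (hn : 0 < n) {d s : ℕ} (hd : 2 ≤ d) (hs : 2 ≤ s) :
    n * ((m ^ s / n) ^ (1 / ((s : ℝ) * d - 1))) ^ (d - 1) =
        m ^ (((s : ℝ) * d - s) / (s * d - 1)) * n ^ (((s : ℝ) * d - d) / (s * d - 1)) ∧
      m * (n / (m ^ s / n) ^ (1 / ((s : ℝ) * d - 1))) ^ (1 - 1 / (s : ℝ)) =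
        m ^ (((s : ℝ) * d - s) / (s * d - 1)) * n ^ (((s : ℝ) * d - d) / (s * d - 1)) := by
  have hd' : (2 : ℝ) ≤ d := by exact_mod_cast hd
  have hs' : (2 : ℝ) ≤ s := by exact_mod_cast hs
  have hs0 : (s : ℝ) ≠ 0 := by linarith
  have hD : (s : ℝ) * d - 1 ≠ 0 := by nlinarith
  obtain ⟨x, rfl⟩ : ∃ x, m = Real.exp x := ⟨Real.log m, (Real.exp_log hm).symm⟩
  obtain ⟨y, rfl⟩ : ∃ y, n = Real.exp y := ⟨Real.log n, (Real.exp_log hn).symm⟩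
  rw [← Real.rpow_natCast _ (d - 1), Nat.cast_sub (by lia : 1 ≤ d), ← Real.exp_nat_mul,
    ← Real.exp_sub, ← Real.exp_mul, ← Real.exp_mul, ← Real.exp_mul, ← Real.exp_mul,
    ← Real.exp_add, ← Real.exp_add, ← Real.exp_sub, ← Real.exp_mul, ← Real.exp_add]
  constructor <;> congr 1 <;> push_cast <;> field_simp <;> ring_nf

theorem log_pow_le {m n ε : ℝ} {d s : ℕ} (hd : 2 ≤ d) (hs : 2 ≤ s) (hε : 0 < ε)
    (hm : 1 ≤ m) (hn : 1 ≤ n) (hnm : n ≤ m ^ s) :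
    Real.log (2 * n + 1) ^ d ≤ 3 ^ (ε / s) / (ε / (s * d)) ^ d * m ^ ε := by
  have hd' : (0 : ℝ) < d := by exact_mod_cast (by lia : 0 < d)
  have hs' : (0 : ℝ) < s := by exact_mod_cast (by lia : 0 < s)
  have hδ : 0 < ε / (s * d) := by positivity
  have h0 : 0 ≤ Real.log (2 * n + 1) := Real.log_nonneg (by linarith)
  have h1 : Real.log (2 * n + 1) ≤ (3 * m ^ s) ^ (ε / (s * d)) / (ε / (s * d)) :=
    (Real.log_le_log (by linarith) (by linarith)).trans (Real.log_le_rpow_div (by positivity) hδ)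
  refine (pow_le_pow_left₀ h0 h1 d).trans_eq ?_
  rw [div_pow, ← Real.rpow_mul_natCast (by positivity),
    show ε / (s * d) * d = ε / s by field_simp, Real.mul_rpow (by norm_num) (by positivity),
    ← Real.rpow_natCast_mul (by linarith), show (s : ℝ) * (ε / s) = ε by field_simp]
  ring

theorem incidence_terms_le {t s m n Q B L K M Y : ℝ} (ht : 0 ≤ t) (hs : 0 ≤ s) (hm : 0 ≤ m)
    (hn : 0 ≤ n) (hQ : 0 ≤ Q) (hB : 0 ≤ B) (hK : 0 ≤ K) (hM : 0 ≤ M) (hL1 : 1 ≤ L)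
    (hLK : L ≤ K * M) (hY : Y ≤ B * L * Q) :
    t * m + s * Y + (t * Q + s * (B * L * Q)) ≤
      (t + s + (2 * s * B + t) * K) * (M * Q + m + n) := by
  calc _ ≤ t * m + s * (B * L * Q) + (t * (L * Q) + s * (B * L * Q)) := by
        gcongr
        exact le_mul_of_one_le_left hQ hL1
    _ = t * m + (2 * s * B + t) * (L * Q) := by ring
    _ ≤ t * m + (2 * s * B + t) * (K * M * Q) := by gcongr
    _ ≤ (t + s + (2 * s * B + t) * K) * (M * Q + m + n) := by
      have h1 : 0 ≤ (t + s) * (M * Q + n) := by positivity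
      have h2 : 0 ≤ (2 * s * B + t) * K * (m + n) := by positivity
      have h3 : 0 ≤ s * m := by positivity
      linarith

open Classical in
/-- Incidence bound for points and hyperplanes given by affine equations. -/
theorem exists_forall_sum_card_le (d s t : ℕ) (hd : 2 ≤ d) (hs : 2 ≤ s) (ht : 1 ≤ t)
    (ε : ℝ) (hε : 0 < ε) :
    ∃ C : ℝ, 0 < C ∧ ∀ (α : Type) [Fintype α] (φ : α → (Fin d → ℝ) →ₗ[ℝ] ℝ) (c : α → ℝ)
      (_ : ∀ i, φ i ≠ 0) (P : Finset (Fin d → ℝ))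
      (_ : ∀ S ⊆ P, ∀ T : Finset α, S.card = s → T.card = t → ∃ p ∈ S, ∃ i ∈ T, φ i p + c i ≠ 0),
      ∑ i, ((P.filter fun p => φ i p + c i = 0).card : ℝ) ≤
        C * ((P.card : ℝ) ^ (((s : ℝ) * d - s) / (s * d - 1) + ε) *
          (Fintype.card α : ℝ) ^ (((s : ℝ) * d - d) / (s * d - 1)) + P.card + Fintype.card α) := by
  set C₁ : ℝ := 4 * (d + 1) * (d * (d + 1) + 1 + d * 2) + 1 with hC₁
  set K : ℝ := 3 ^ (ε / s) / (ε / (s * d)) ^ d with hK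
  have hd' : (2 : ℝ) ≤ d := by exact_mod_cast hd
  have hs' : (2 : ℝ) ≤ s := by exact_mod_cast hs
  have ht' : (1 : ℝ) ≤ t := by exact_mod_cast ht
  have hC₁1 : 1 ≤ C₁ := by
    have : (0 : ℝ) ≤ 4 * (d + 1) * (d * (d + 1) + 1 + d * 2) := by positivity
    linarith
  have hK0 : 0 ≤ K := by positivity
  refine ⟨t + s + (2 * s * C₁ ^ d + t) * K, by positivity, ?_⟩
  intro α _ φ c hφ P hfree
  obtain hm0 | hmpos := P.card.eq_zero_or_pos
  · rw [Finset.card_eq_zero] at hm0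
    subst hm0
    simp only [Finset.filter_empty, Finset.card_empty, Nat.cast_zero, Finset.sum_const_zero]
    positivity
  obtain hn0 | hnpos := (Fintype.card α).eq_zero_or_pos
  · have := Fintype.card_eq_zero_iff.1 hn0
    rw [Finset.univ_eq_empty, Finset.sum_empty]
    positivity
  have hkst := sum_card_le_of_no_biclique P Finset.univ (fun p i => φ i p + c i = 0) hs ht
    (fun S hS T _ => hfree S hS T)
  rw [Finset.card_univ] at hkst
  have hcut := sum_card_le_of_cutting φ c hφ P hs ht hfree
  have hsample := fun r (hr : (1 : ℝ) ≤ r) => exists_cutting φ c (d + 1) hr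
  set m : ℝ := (P.card : ℝ) with hm
  set n : ℝ := (Fintype.card α : ℝ) with hn
  have hm1 : 1 ≤ m := by rw [hm]; exact_mod_cast hmpos
  have hn1 : 1 ≤ n := by rw [hn]; exact_mod_cast hnpos
  have hmε : 0 ≤ m ^ ε := by positivity
  rw [Real.rpow_add (by linarith)]
  set Q : ℝ := m ^ (((s : ℝ) * d - s) / (s * d - 1)) * n ^ (((s : ℝ) * d - d) / (s * d - 1)) with hQ
  have hQ0 : 0 ≤ Q := by positivity
  rw [show m ^ (((s : ℝ) * d - s) / (s * d - 1)) * m ^ ε *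
    n ^ (((s : ℝ) * d - d) / (s * d - 1)) = m ^ ε * Q by rw [hQ]; ring]
  have hA : 0 ≤ (2 * s * C₁ ^ d + t) * K := by positivity
  have hQm : 0 ≤ m ^ ε * Q := by positivity
  obtain hlarge | hsmall := le_total (m ^ s) n
  · have h1 : m * n ^ (1 - 1 / (s : ℝ)) ≤ n := by
      have h2 : m ≤ n ^ (1 / (s : ℝ)) := by
        calc m = (m ^ s) ^ (1 / (s : ℝ)) := by
              rw [one_div, Real.pow_rpow_inv_natCast (by linarith) (by lia)]
          _ ≤ _ := Real.rpow_le_rpow (by positivity) hlarge (by positivity)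
      calc m * n ^ (1 - 1 / (s : ℝ)) ≤ n ^ (1 / (s : ℝ)) * n ^ (1 - 1 / (s : ℝ)) := by gcongr
        _ = n := by rw [← Real.rpow_add (by linarith)]; simp
    calc _ ≤ t * m * n ^ (1 - 1 / (s : ℝ)) + s * n := hkst
      _ = t * (m * n ^ (1 - 1 / (s : ℝ))) + s * n := by ring
      _ ≤ t * n + s * n := by gcongr
      _ = (t + s) * n := by ring
      _ ≤ (t + s + (2 * s * C₁ ^ d + t) * K) * (m ^ ε * Q + m + n) := by
        refine mul_le_mul ?_ ?_ ?_ ?_ <;> linarith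
  · obtain ⟨hb1, hb2⟩ := rpow_balance (by linarith : 0 < m) (by linarith : 0 < n) hd hs
    rw [← hQ] at hb1 hb2
    have hD : 0 < (s : ℝ) * d - 1 := by nlinarith
    have hr1 : 1 ≤ (m ^ s / n) ^ (1 / ((s : ℝ) * d - 1)) :=
      Real.one_le_rpow ((one_le_div (by linarith)).2 hsmall) (by positivity)
    set r : ℝ := (m ^ s / n) ^ (1 / ((s : ℝ) * d - 1)) with hr
    obtain ⟨R, hRcard, hR⟩ := hsample r hr1
    set Λ : ℝ := Real.log (2 * n + 1) with hΛ
    have hΛ1 : 1 ≤ Λ := by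
      rw [hΛ, Real.le_log_iff_exp_le (by linarith)]
      linarith [Real.exp_one_lt_three]
    have hrΛ : 1 ≤ r * Λ := one_le_mul_of_one_le_of_one_le hr1 hΛ1
    have hX : 4 * (d + 1) * (R.card + d * 2) + 1 ≤ C₁ * (r * Λ) := by
      rw [Module.finrank_fin_fun] at hRcard
      push_cast at hRcard
      have : (R.card : ℝ) + d * 2 ≤ (d * (d + 1) + 1 + d * 2) * (r * Λ) := by
        nlinarith
      calc 4 * ((d : ℝ) + 1) * (R.card + d * 2) + 1
          ≤ 4 * (d + 1) * ((d * (d + 1) + 1 + d * 2) * (r * Λ)) + r * Λ := by gcongr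
        _ = _ := by rw [hC₁]; ring
    have hmain := hcut R (κ := n / r) (by positivity) hR hX
    have hΛd : Λ ^ d ≤ K * m ^ ε := log_pow_le hd hs hε hm1 hn1 hsmall
    have hΛd1 : 1 ≤ Λ ^ d := one_le_pow₀ hΛ1
    have e1 : n * (C₁ * (r * Λ)) ^ (d - 1) ≤ C₁ ^ d * Λ ^ d * Q := by
      calc n * (C₁ * (r * Λ)) ^ (d - 1) = C₁ ^ (d - 1) * Λ ^ (d - 1) * (n * r ^ (d - 1)) := by
            ring_nf
        _ ≤ C₁ ^ d * Λ ^ d * Q := by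
            rw [hb1]
            gcongr <;> first | assumption | lia
    have e2 : n / r * (C₁ * (r * Λ)) ^ d = C₁ ^ d * Λ ^ d * Q := by
      have hr0 : r ≠ 0 := by linarith
      rw [← hb1, mul_pow, mul_pow, ← pow_sub_one_mul (by lia : d ≠ 0) r]
      field_simp
    have e3 : t * m * (n / r) ^ (1 - 1 / (s : ℝ)) = t * Q := by rw [mul_assoc, hb2]
    rw [e2, e3] at hmain
    exact hmain.trans (incidence_terms_le (by positivity) (by positivity) (by positivity)
      (by positivity) hQ0 (by positivity) hK0 hmε hΛd1 hΛd e1)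

/-- A hyperplane is the zero set of a nonconstant affine function. -/
theorem exists_equation_of_finrank_direction {d : ℕ} (hd : 2 ≤ d)
    (h : AffineSubspace ℝ (Fin d → ℝ)) (hh : Module.finrank ℝ h.direction = d - 1) :
    ∃ (φ : (Fin d → ℝ) →ₗ[ℝ] ℝ) (b : ℝ), φ ≠ 0 ∧ ∀ x, φ x + b = 0 ↔ x ∈ h := by
  have hne : (h : Set (Fin d → ℝ)).Nonempty := by
    rw [AffineSubspace.nonempty_iff_ne_bot]
    rintro rfl
    rw [AffineSubspace.direction_bot, finrank_bot] at hh
    lia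
  obtain ⟨p, hp⟩ := hne
  have hlt : h.direction < ⊤ := by
    refine lt_top_iff_ne_top.2 fun htop => ?_
    rw [htop, finrank_top, Module.finrank_fin_fun] at hh
    lia
  obtain ⟨φ, hφ, hle⟩ := Submodule.exists_le_ker_of_lt_top _ hlt
  have hker : h.direction = LinearMap.ker φ := by
    refine Submodule.eq_of_le_of_finrank_eq hle ?_
    have := Module.Dual.finrank_ker_add_one_of_ne_zero (f := φ) hφ
    rw [Module.finrank_fin_fun] at this
    lia
  refine ⟨φ, -φ p, hφ, fun x => ?_⟩
  rw [← AffineSubspace.vsub_right_mem_direction_iff_mem hp, hker, LinearMap.mem_ker, vsub_eq_sub,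
    map_sub, sub_eq_add_neg]

/-- The point–hyperplane incidence bound of Fox–Pach–Sheffer–Suk–Zahl in `ℝ^d`,
assuming the incidence graph contains no `K_{s,t}`. -/
theorem fpssz_hyperplane_incidences (d s t : ℕ) (hd : 2 ≤ d) (hs : 2 ≤ s) (ht : 2 ≤ t)
    (ε : ℝ) (hε : 0 < ε) :
    ∃ C : ℝ, 0 < C ∧
      ∀ (P : Finset (Fin d → ℝ)) (H : Finset (AffineSubspace ℝ (Fin d → ℝ))) (m n : ℕ),
        P.card = m → H.card = n →
        (∀ h ∈ H, Module.finrank ℝ h.direction = d - 1) →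
        (¬ ∃ (S : Finset (Fin d → ℝ)) (T : Finset (AffineSubspace ℝ (Fin d → ℝ))),
            S ⊆ P ∧ T ⊆ H ∧ S.card = s ∧ T.card = t ∧ ∀ p ∈ S, ∀ h ∈ T, p ∈ h) →
        (Set.ncard {x : (Fin d → ℝ) × AffineSubspace ℝ (Fin d → ℝ) |
            x.1 ∈ P ∧ x.2 ∈ H ∧ x.1 ∈ x.2} : ℝ) ≤
          C * ((m : ℝ) ^ (((s : ℝ) * (d : ℝ) - (s : ℝ)) / ((s : ℝ) * (d : ℝ) - 1) + ε) *
                (n : ℝ) ^ (((s : ℝ) * (d : ℝ) - (d : ℝ)) / ((s : ℝ) * (d : ℝ) - 1)) +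
              (m : ℝ) + (n : ℝ)) := by
  classical
  obtain ⟨C, hC, hbound⟩ := exists_forall_sum_card_le d s t hd hs (by lia) ε hε
  refine ⟨C, hC, ?_⟩
  rintro P H m n rfl rfl hH hfree
  choose φ c hφ hmem using fun h : H =>
    exists_equation_of_finrank_direction hd h.1 (hH h.1 h.2)
  have hsum := hbound H φ c hφ P fun S hS T hScard hTcard => by
    by_contra! hcon
    refine hfree ⟨S, T.map (Function.Embedding.subtype _), hS, ?_, hScard,
      (Finset.card_map _).trans hTcard, ?_⟩
    · intro h hh
      obtain ⟨i, -, rfl⟩ := Finset.mem_map.1 hh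
      exact i.2
    · intro p hp h hh
      obtain ⟨i, hi, rfl⟩ := Finset.mem_map.1 hh
      exact (hmem i p).1 (hcon p hp i hi)
  rw [Fintype.card_coe] at hsum
  refine le_trans (le_of_eq ?_) hsum
  have hset : {x : (Fin d → ℝ) × AffineSubspace ℝ (Fin d → ℝ) |
      x.1 ∈ P ∧ x.2 ∈ H ∧ x.1 ∈ x.2} = ((P ×ˢ H).filter fun x => x.1 ∈ x.2) := by
    ext x
    simp [and_assoc]
  rw [hset, Set.ncard_coe_finset, ← Nat.cast_sum]
  simp only [hmem]
  rw [Finset.sum_coe_sort H fun h => (P.filter fun p => p ∈ h).card]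
  simp only [Finset.card_filter]
  rw [Finset.sum_product_right]
end
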